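/- arXiv:1107.0101 — 2 statements merged into one kernel-verified Lean document; each statement's English description precedes it below -/
import Mathlib

section
/- Let ω ∈ (π/2, π) and let q satisfy 0 < q < min{(1/√2)·sin ω, √2·(1 − ω/π)}. Then there exist functions a, f, g on (0,∞), twice continuously differentiable, which satisfy the dyon equations (4), (5), (6) on (0,∞), have finite energy E(a,f,g) < ∞, satisfy the boundary conditions lim_{r→0⁺} a(r) = 1, lim_{r→0⁺} f(r) = 0, lim_{r→0⁺} g(r) = 0, lim_{r→∞} a(r) = 0, lim_{r→∞} f(r) = π − ω, lim_{r→∞} g(r) = q, and moreover satisfy a(r) > 0, 0 < f(r) < π − ω, 0 < g(r) < q for all r > 0, with f and g strictly increasing on (0,∞). -/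
open Real MeasureTheory Set Filter

noncomputable section

/-- `h` is continuous on `[0,∞)` and absolutely continuous on every compact
subinterval of `(0,∞)` (encoded via the fundamental theorem of calculus,
with `deriv h` playing the role of the a.e. derivative `h'`). -/
def LocAC (h : ℝ → ℝ) : Prop :=
  ContinuousOn h (Set.Ici 0) ∧
  ∀ s t : ℝ, 0 < s → s ≤ t →
    IntervalIntegrable (deriv h) MeasureTheory.volume s t ∧
    h t - h s = ∫ r in s..t, deriv h r

/-- `h` is locally absolutely continuous on `(0,∞)`, with derivative `deriv h`. -/
def LocACIoi (h : ℝ → ℝ) : Prop :=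
  ∀ s t : ℝ, 0 < s → s ≤ t →
    IntervalIntegrable (deriv h) MeasureTheory.volume s t ∧
    h t - h s = ∫ r in s..t, deriv h r

/-- The density `𝓔₁`. -/
def calE1 (κ : ℝ) (a f : ℝ → ℝ) (r : ℝ) : ℝ :=
  2 * (2 * (deriv a r) ^ 2 + ((a r) ^ 2 - 1) ^ 2 / r ^ 2)
    + (1 / 2) * (r ^ 2 * (deriv f r) ^ 2 + 2 * (a r) ^ 2 * Real.sin (f r) ^ 2)
    + 2 * κ * (a r) ^ 2 * Real.sin (f r) ^ 2
        * (2 * (deriv f r) ^ 2 + (a r) ^ 2 * Real.sin (f r) ^ 2 / r ^ 2)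

/-- The density `𝓔₂`. -/
def calE2 (a g : ℝ → ℝ) (r : ℝ) : ℝ :=
  r ^ 2 * (deriv g r) ^ 2 + 2 * (a r) ^ 2 * (g r) ^ 2

/-- Finite energy: `E(a,f,g) = ∫₀^∞ (𝓔₁ + 𝓔₂) dr < ∞`. -/
def FiniteEnergy (κ : ℝ) (a f g : ℝ → ℝ) : Prop :=
  MeasureTheory.IntegrableOn (fun r => calE1 κ a f r + calE2 a g r) (Set.Ioi 0)

/-- The action `L(a,f,g) = ∫₀^∞ (𝓔₁ - 𝓔₂) dr`. -/
def actionL (κ : ℝ) (a f g : ℝ → ℝ) : ℝ :=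
  ∫ r in Set.Ioi (0 : ℝ), (calE1 κ a f r - calE2 a g r)

/-- The admissible class `𝒜`. -/
structure Admissible (κ ω q : ℝ) (a f g : ℝ → ℝ) : Prop where
  locAC_a : LocAC a
  locAC_f : LocAC f
  locAC_g : LocAC g
  a_zero : a 0 = 1
  f_zero : f 0 = 0
  a_infty : Filter.Tendsto a Filter.atTop (nhds 0)
  f_infty : Filter.Tendsto f Filter.atTop (nhds (Real.pi - ω))
  g_infty : Filter.Tendsto g Filter.atTop (nhds q)
  finite_energy : FiniteEnergy κ a f g

/-- The constrained class `𝒞`: members of `𝒜` such that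
`∫₀^∞ (r² g' G' + 2 a² g G) dr = 0` for every admissible test function `G`. -/
def Constrained (κ ω q : ℝ) (a f g : ℝ → ℝ) : Prop :=
  Admissible κ ω q a f g ∧
  ∀ G : ℝ → ℝ, LocACIoi G → Filter.Tendsto G Filter.atTop (nhds 0) →
    MeasureTheory.IntegrableOn
      (fun r => r ^ 2 * (deriv G r) ^ 2 + 2 * (a r) ^ 2 * (G r) ^ 2) (Set.Ioi 0) →
    MeasureTheory.IntegrableOn
      (fun r => r ^ 2 * deriv g r * deriv G r + 2 * (a r) ^ 2 * g r * G r) (Set.Ioi 0) ∧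
    ∫ r in Set.Ioi (0 : ℝ), (r ^ 2 * deriv g r * deriv G r + 2 * (a r) ^ 2 * g r * G r) = 0

/-- The dyon equations (4), (5), (6) on `(0,∞)`:
(4) `a'' = a(a²-1)/r² + (1/4) a sin²f + κ a sin²f (f')² + κ a³ sin⁴f / r² - a g²/2`;
(5) `8κ (a² sin²f f')' + (r² f')' = 2a² sin f cos f + 8κ a² sin f cos f (f')² + 8κ a⁴ sin³f cos f / r²`;
(6) `(r² g')' = 2 a² g`. -/
def DyonEqs (κ : ℝ) (a f g : ℝ → ℝ) : Prop :=
  ∀ r ∈ Set.Ioi (0 : ℝ),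
    DifferentiableAt ℝ a r ∧ DifferentiableAt ℝ f r ∧ DifferentiableAt ℝ g r ∧
    HasDerivAt (deriv a)
      (a r * ((a r) ^ 2 - 1) / r ^ 2 + (1 / 4) * a r * Real.sin (f r) ^ 2
        + κ * a r * Real.sin (f r) ^ 2 * (deriv f r) ^ 2
        + κ * (a r) ^ 3 * Real.sin (f r) ^ 4 / r ^ 2
        - a r * (g r) ^ 2 / 2) r ∧
    HasDerivAt
      (fun ρ => 8 * κ * ((a ρ) ^ 2 * Real.sin (f ρ) ^ 2 * deriv f ρ) + ρ ^ 2 * deriv f ρ)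
      (2 * (a r) ^ 2 * Real.sin (f r) * Real.cos (f r)
        + 8 * κ * (a r) ^ 2 * Real.sin (f r) * Real.cos (f r) * (deriv f r) ^ 2
        + 8 * κ * (a r) ^ 4 * Real.sin (f r) ^ 3 * Real.cos (f r) / r ^ 2) r ∧
    HasDerivAt (fun ρ => ρ ^ 2 * deriv g ρ) (2 * (a r) ^ 2 * g r) r

theorem exists_subseq_tendsto_of_eventually_bounded {D : Type*} [Countable D] (z : ℕ → D → ℝ)
    (hb : ∀ d, ∃ M, ∀ᶠ n in atTop, |z n d| ≤ M) :
    ∃ φ : ℕ → ℕ, StrictMono φ ∧ ∀ d, ∃ l, Tendsto (fun n => z (φ n) d) atTop (nhds l) := by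
  choose M hM using hb
  have hM0 : ∀ d, 0 ≤ M d := fun d => by
    obtain ⟨n, hn⟩ := (hM d).exists
    exact (abs_nonneg _).trans hn
  have hK : IsCompact (univ.pi fun d => Icc (-(M d)) (M d)) :=
    isCompact_univ_pi fun d => isCompact_Icc
  obtain ⟨l, -, φ, hφ, hl⟩ := hK.tendsto_subseq
    (x := fun n d => max (-(M d)) (min (M d) (z n d)))
    (fun n d _ => ⟨le_max_left _ _, max_le (by linarith [hM0 d]) (min_le_left _ _)⟩)
  refine ⟨φ, hφ, fun d => ⟨l d, ?_⟩⟩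
  refine ((tendsto_pi_nhds.1 hl) d).congr' ?_
  filter_upwards [hφ.tendsto_atTop.eventually (hM d)] with n hn
  simp only [Function.comp_apply]
  rw [min_eq_right (abs_le.1 hn).2, max_eq_right (abs_le.1 hn).1]

theorem abs_sub_sub_mul_le_of_step (u : ℕ → ℝ) (A B : ℝ) (i j : ℕ) (hij : i ≤ j)
    (h : ∀ l, i ≤ l → l < j → |u (l + 1) - u l - A| ≤ B) :
    |u j - u i - ((j : ℝ) - i) * A| ≤ ((j : ℝ) - i) * B := by
  induction j, hij using Nat.le_induction with
  | base => simp
  | succ j hij ih =>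
    have h1 := ih fun l hl hlj => h l hl (by omega)
    have h2 := h j hij (by omega)
    rw [abs_le] at *
    push_cast
    constructor <;> nlinarith

theorem floor_mul_mem (k : ℕ) (n : ℕ) (r : ℝ) (hr : 2 / (k : ℝ) ≤ r) (hrk : r ≤ k) (hk : 0 < k)
    (hn : k ≤ n) : n ≤ ⌊r * n⌋₊ * k ∧ ⌊r * n⌋₊ ≤ k * n := by
  have hk' : (0 : ℝ) < k := by exact_mod_cast hk
  have hn' : (k : ℝ) ≤ n := by exact_mod_cast hn
  have hr0 : 0 ≤ r := le_trans (by positivity) hr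
  have h1 : (⌊r * n⌋₊ : ℝ) ≤ r * n := Nat.floor_le (by positivity)
  have h2 : r * n < (⌊r * n⌋₊ : ℝ) + 1 := Nat.lt_floor_add_one _
  rw [div_le_iff₀ hk'] at hr
  constructor
  · have : (n : ℝ) ≤ ⌊r * n⌋₊ * k := by nlinarith
    exact_mod_cast this
  · have : (⌊r * n⌋₊ : ℝ) ≤ k * n := by nlinarith
    exact_mod_cast this

theorem tendsto_floor_mul_div {φ : ℕ → ℕ} (hφ : StrictMono φ) {r : ℝ} (hr : 0 ≤ r) :
    Tendsto (fun n => (⌊r * φ n⌋₊ : ℝ) / φ n) atTop (nhds r) :=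
  (tendsto_nat_floor_mul_div_atTop hr).comp
    (tendsto_natCast_atTop_atTop.comp hφ.tendsto_atTop)

section EulerScheme

variable {ι : Type*} {Φ : ℝ → (ι → ℝ) → ι → ℝ} {Y : ℕ → ℕ → ι → ℝ} {σ : ι → ℕ}

theorem step_bound_of_bounded [Fintype ι]
    (hΦ : ContinuousOn (fun x : ℝ × (ι → ℝ) => Φ x.1 x.2) (Ioi 0 ×ˢ univ))
    (hσ : ∀ c, σ c ≤ 1)
    (hbd : ∀ k : ℕ, ∃ M : ℝ, ∀ᶠ n : ℕ in atTop, ∀ i : ℕ, n ≤ i * k → i ≤ k * n →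
      ∀ c, |Y n i c| ≤ M)
    (hstep : ∀ k : ℕ, ∀ᶠ n : ℕ in atTop, ∀ i : ℕ, n ≤ i * k → i ≤ k * n → ∀ c,
      Y n (i + 1) c - Y n i c
        = 1 / (n : ℝ) * Φ (((i + σ c : ℕ) : ℝ) / n) (Y n (i + σ c)) c) (k : ℕ) :
    ∃ L : ℝ, 0 ≤ L ∧ ∀ᶠ n : ℕ in atTop, ∀ i : ℕ, n ≤ i * k → i ≤ k * n → ∀ c,
      |Y n (i + 1) c - Y n i c| ≤ L * (1 / (n : ℝ)) := by
  obtain ⟨M, hM⟩ := hbd (k + 1)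
  have hK : IsCompact (Icc (1 / ((k : ℝ) + 1)) ((k : ℝ) + 1) ×ˢ
      (univ.pi fun _ : ι => Icc (-M) M)) :=
    isCompact_Icc.prod (isCompact_univ_pi fun _ => isCompact_Icc)
  obtain ⟨L, hL⟩ := hK.exists_bound_of_continuousOn (hΦ.mono (by
    rintro ⟨r, y⟩ ⟨h1, -⟩
    exact ⟨lt_of_lt_of_le (by positivity) h1.1, trivial⟩))
  refine ⟨max L 0, le_max_right _ _, ?_⟩
  filter_upwards [hM, hstep k, eventually_ge_atTop 1] with n hMn hn hn1 i hi1 hi2 c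
  have hn0 : (0 : ℝ) < n := by exact_mod_cast hn1
  rw [hn i hi1 hi2 c, abs_mul, abs_of_pos (by positivity), mul_comm]
  refine mul_le_mul_of_nonneg_right ?_ (by positivity)
  have hs := hσ c
  have e1 : n ≤ (i + σ c) * (k + 1) := by nlinarith
  have e2 : i + σ c ≤ (k + 1) * n := by nlinarith
  have hmem := hL (((i + σ c : ℕ) : ℝ) / n, Y n (i + σ c)) ⟨⟨?_, ?_⟩, fun c' _ => ?_⟩
  · exact (norm_le_pi_norm (Φ _ _) c).trans (hmem.trans (le_max_left _ _))
  · change 1 / ((k : ℝ) + 1) ≤ ((i + σ c : ℕ) : ℝ) / n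
    rw [div_le_div_iff₀ (by positivity) hn0, one_mul]
    exact_mod_cast e1
  · change ((i + σ c : ℕ) : ℝ) / n ≤ (k : ℝ) + 1
    rw [div_le_iff₀ hn0]
    exact_mod_cast e2
  · exact abs_le.1 (hMn _ e1 e2 c')

theorem floor_lipschitz_of_step_bound
    (hL : ∀ k : ℕ, ∃ L : ℝ, 0 ≤ L ∧ ∀ᶠ n : ℕ in atTop, ∀ i : ℕ, n ≤ i * k → i ≤ k * n → ∀ c,
      |Y n (i + 1) c - Y n i c| ≤ L * (1 / (n : ℝ))) (k : ℕ) :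
    ∃ L : ℝ, 0 ≤ L ∧ ∀ᶠ n : ℕ in atTop, ∀ i j : ℕ, i ≤ j → n ≤ i * k → j ≤ k * n →
      ∀ c, |Y n j c - Y n i c| ≤ L * (((j : ℝ) - i) / n) := by
  obtain ⟨L, hL0, hL⟩ := hL k
  refine ⟨L, hL0, ?_⟩
  filter_upwards [hL, eventually_ge_atTop 1] with n hn hn1 i j hij hi hj c
  have := abs_sub_sub_mul_le_of_step (fun l => Y n l c) 0 (L * (1 / n)) i j hij
    (fun l h1 h2 => by
      rw [sub_zero]
      exact hn l (hi.trans (Nat.mul_le_mul_right _ h1)) (h2.le.trans hj) c)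
  rw [mul_zero, sub_zero] at this
  refine this.trans (le_of_eq ?_)
  ring

/-- A locally bounded family of solutions of a (mixed forward and backward) Euler scheme with
mesh tending to zero has a subsequence converging to a solution of the differential equation. -/
theorem exists_limit_of_euler_scheme [Fintype ι]
    (hΦ : ContinuousOn (fun x : ℝ × (ι → ℝ) => Φ x.1 x.2) (Ioi 0 ×ˢ univ))
    (hσ : ∀ c, σ c ≤ 1)
    (hbd : ∀ k : ℕ, ∃ M : ℝ, ∀ᶠ n : ℕ in atTop, ∀ i : ℕ, n ≤ i * k → i ≤ k * n →
      ∀ c, |Y n i c| ≤ M)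
    (hstep : ∀ k : ℕ, ∀ᶠ n : ℕ in atTop, ∀ i : ℕ, n ≤ i * k → i ≤ k * n → ∀ c,
      Y n (i + 1) c - Y n i c
        = 1 / (n : ℝ) * Φ (((i + σ c : ℕ) : ℝ) / n) (Y n (i + σ c)) c) :
    ∃ (φ : ℕ → ℕ) (y : ℝ → ι → ℝ), StrictMono φ ∧
      (∀ r : ℝ, 0 < r → ∀ c, Tendsto (fun n => Y (φ n) ⌊r * φ n⌋₊ c) atTop (nhds (y r c))) ∧
      ∀ r, 0 < r → ∀ c, HasDerivAt (fun ρ => y ρ c) (Φ r (y r) c) r := by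
  have hLip := floor_lipschitz_of_step_bound (step_bound_of_bounded hΦ hσ hbd hstep)
  have hchoose : ∀ r : ℝ, 0 < r → ∃ k : ℕ, 0 < k ∧ 2 / (k : ℝ) < r ∧ r < k := by
    intro r hr
    obtain ⟨k, hk⟩ := exists_nat_gt (max (2 / r) r)
    have hk0 : (0 : ℝ) < k := hr.trans ((le_max_right _ _).trans_lt hk)
    refine ⟨k, by exact_mod_cast hk0, ?_, (le_max_right _ _).trans_lt hk⟩
    have := (le_max_left _ _).trans_lt hk
    rw [div_lt_iff₀ hr] at this
    rw [div_lt_iff₀ hk0]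
    linarith
  have hLip2 : ∀ k : ℕ, 0 < k → ∃ L : ℝ, 0 ≤ L ∧ ∀ᶠ n : ℕ in atTop, ∀ s t : ℝ,
      2 / (k : ℝ) ≤ s → s ≤ k → 2 / (k : ℝ) ≤ t → t ≤ k → ∀ c,
      |Y n ⌊t * n⌋₊ c - Y n ⌊s * n⌋₊ c| ≤ L * (|t - s| + 1 / n) := by
    intro k hk
    obtain ⟨L, hL0, hL⟩ := hLip k
    refine ⟨L, hL0, ?_⟩
    have key : ∀ᶠ n : ℕ in atTop, ∀ s t : ℝ, s ≤ t →
      2 / (k : ℝ) ≤ s → s ≤ k → 2 / (k : ℝ) ≤ t → t ≤ k → ∀ c,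
      |Y n ⌊t * n⌋₊ c - Y n ⌊s * n⌋₊ c| ≤ L * ((t - s) + 1 / n) := by
      filter_upwards [hL, eventually_ge_atTop k] with n hn hnk s t hst hs1 hs2 ht1 ht2 c
      have hn0 : (0 : ℝ) < n := by exact_mod_cast hk.trans_le hnk
      have hs0 : 0 ≤ s := le_trans (by positivity) hs1
      refine (hn _ _ (Nat.floor_mono (by gcongr)) (floor_mul_mem k n s hs1 hs2 hk hnk).1
        (floor_mul_mem k n t ht1 ht2 hk hnk).2 c).trans ?_
      refine mul_le_mul_of_nonneg_left ?_ hL0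
      rw [div_le_iff₀ hn0, add_mul, one_div, inv_mul_cancel₀ hn0.ne']
      have h1 : (⌊t * n⌋₊ : ℝ) ≤ t * n := Nat.floor_le (mul_nonneg (hs0.trans hst) hn0.le)
      have h2 : s * n < (⌊s * n⌋₊ : ℝ) + 1 := Nat.lt_floor_add_one _
      linarith
    filter_upwards [key] with n hn s t hs1 hs2 ht1 ht2 c
    rcases le_total s t with h | h
    · rw [abs_of_nonneg (sub_nonneg.2 h)]
      exact hn s t h hs1 hs2 ht1 ht2 c
    · rw [abs_sub_comm, abs_sub_comm t s, abs_of_nonneg (sub_nonneg.2 h)]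
      exact hn t s h ht1 ht2 hs1 hs2 c
  obtain ⟨φ, hφ, hlim⟩ := exists_subseq_tendsto_of_eventually_bounded
    (D := {d : ℚ // 0 < d} × ι) (fun n d => Y n ⌊((d.1 : ℚ) : ℝ) * n⌋₊ d.2) (by
      rintro ⟨⟨d, hd⟩, c⟩
      obtain ⟨k, hk, h1, h2⟩ := hchoose (d : ℝ) (by exact_mod_cast hd)
      obtain ⟨M, hM⟩ := hbd k
      refine ⟨M, ?_⟩
      filter_upwards [hM, eventually_ge_atTop k] with n hn hnk
      have := floor_mul_mem k n d h1.le h2.le hk hnk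
      exact hn _ this.1 this.2 c)
  have hφt := hφ.tendsto_atTop
  have hinv : Tendsto (fun n => 1 / (φ n : ℝ)) atTop (nhds 0) :=
    tendsto_one_div_atTop_nhds_zero_nat.comp hφt
  have hconv : ∀ r : ℝ, 0 < r → ∀ c, ∃ l,
      Tendsto (fun n => Y (φ n) ⌊r * φ n⌋₊ c) atTop (nhds l) := by
    intro r hr c
    obtain ⟨k, hk, h1, h2⟩ := hchoose r hr
    obtain ⟨L, hL0, hL⟩ := hLip2 k hk
    apply cauchySeq_tendsto_of_complete
    rw [Metric.cauchySeq_iff]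
    intro ε hε
    have hη : 0 < min ((k : ℝ) - r) (ε / (8 * (L + 1))) :=
      lt_min (by linarith) (by positivity)
    obtain ⟨d, hd1, hd2⟩ := exists_rat_btwn (lt_add_of_pos_right r hη)
    have hdk : (d : ℝ) ≤ k := by
      have := min_le_left ((k : ℝ) - r) (ε / (8 * (L + 1))); linarith
    have hdε : L * (d - r) ≤ ε / 8 := by
      have h3 : (d : ℝ) - r ≤ ε / (8 * (L + 1)) := by
        have := min_le_right ((k : ℝ) - r) (ε / (8 * (L + 1))); linarith
      have h4 : (L + 1) * (d - r) ≤ (L + 1) * (ε / (8 * (L + 1))) := by gcongr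
      have h5 : (L + 1) * (ε / (8 * (L + 1))) = ε / 8 := by field_simp
      nlinarith
    have hd0 : (0 : ℚ) < d := by
      have : (0 : ℝ) < d := hr.trans hd1
      exact_mod_cast this
    obtain ⟨l, hl⟩ := hlim (⟨d, hd0⟩, c)
    obtain ⟨N1, hN1⟩ := Metric.cauchySeq_iff.1 hl.cauchySeq (ε / 4) (by positivity)
    have hsm : ∀ᶠ n in atTop, L * (1 / (φ n : ℝ)) < ε / 8 := by
      have := hinv.const_mul L
      rw [mul_zero] at this
      exact this.eventually (gt_mem_nhds (by positivity))
    obtain ⟨N2, hN2⟩ := eventually_atTop.1 (hsm.and (hφt.eventually hL))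
    have hclose : ∀ n ≥ N2, |Y (φ n) ⌊(d : ℝ) * φ n⌋₊ c - Y (φ n) ⌊r * φ n⌋₊ c| < ε / 4 := by
      intro n hn
      obtain ⟨h3, h4⟩ := hN2 n hn
      have h5 := h4 r d h1.le h2.le (h1.le.trans hd1.le) hdk c
      rw [abs_of_pos (by linarith : (0 : ℝ) < d - r)] at h5
      linarith
    refine ⟨max N1 N2, fun m hm n hn => ?_⟩
    have a1 := hN1 m (le_of_max_le_left hm) n (le_of_max_le_left hn)
    have a2 := hclose m (le_of_max_le_right hm)
    have a3 := hclose n (le_of_max_le_right hn)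
    rw [Real.dist_eq] at *
    simp only at a1
    rw [abs_lt] at *
    constructor <;> linarith [a1.1, a1.2, a2.1, a2.2, a3.1, a3.2]
  have hex : ∀ r : ℝ, ∃ w : ι → ℝ, 0 < r → ∀ c,
      Tendsto (fun n => Y (φ n) ⌊r * φ n⌋₊ c) atTop (nhds (w c)) := by
    intro r
    by_cases hr : 0 < r
    · choose w hw using hconv r hr
      exact ⟨w, fun _ => hw⟩
    · exact ⟨0, fun h => absurd h hr⟩
  choose y hy using hex
  refine ⟨φ, y, hφ, hy, fun r hr c => ?_⟩
  rw [hasDerivAt_iff_isLittleO, Asymptotics.isLittleO_iff]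
  intro ε hε
  obtain ⟨k, hk, hk1, hk2⟩ := hchoose r hr
  obtain ⟨L, hL0, hL⟩ := hLip2 k hk
  have hcont : ContinuousAt (fun x : ℝ × (ι → ℝ) => Φ x.1 x.2) (r, y r) :=
    hΦ.continuousAt (prod_mem_nhds (Ioi_mem_nhds hr) univ_mem)
  obtain ⟨δ, hδ, hδΦ⟩ := Metric.continuousAt_iff.1 hcont ε hε
  set η : ℝ := min (min (r - 2 / k) (k - r)) (min (δ / 2) (δ / (8 * (L + 1)))) with hηdef
  have hη : 0 < η := by
    refine lt_min (lt_min (by linarith) (by linarith)) (lt_min (by positivity) (by positivity))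
  have hη1 : η ≤ r - 2 / k := (min_le_left _ _).trans (min_le_left _ _)
  have hη2 : η ≤ k - r := (min_le_left _ _).trans (min_le_right _ _)
  have hη3 : η ≤ δ / 2 := (min_le_right _ _).trans (min_le_left _ _)
  have hη4 : L * η ≤ δ / 8 := by
    have h3 : η ≤ δ / (8 * (L + 1)) := (min_le_right _ _).trans (min_le_right _ _)
    have h4 : (L + 1) * η ≤ (L + 1) * (δ / (8 * (L + 1))) := by gcongr
    have h5 : (L + 1) * (δ / (8 * (L + 1))) = δ / 8 := by field_simp
    nlinarith
  have hmain : ∀ s t, r - η / 2 < s → s ≤ t → t < r + η / 2 →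
      |y t c - y s c - (t - s) * Φ r (y r) c| ≤ (t - s) * ε := by
    intro s t hs hst ht
    have hs0 : 0 < s := by
      have : (0 : ℝ) ≤ 2 / k := by positivity
      linarith
    have ht0 := hs0.trans_le hst
    have hev : ∀ᶠ n in atTop,
        |Y (φ n) ⌊t * φ n⌋₊ c - Y (φ n) ⌊s * φ n⌋₊ c
          - ((⌊t * φ n⌋₊ : ℝ) / φ n - (⌊s * φ n⌋₊ : ℝ) / φ n) * Φ r (y r) c|
          ≤ ((⌊t * φ n⌋₊ : ℝ) / φ n - (⌊s * φ n⌋₊ : ℝ) / φ n) * ε := by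
      have hsm : ∀ᶠ n in atTop, (1 + L) * (1 / (φ n : ℝ)) < min (δ / 8) (η / 4) := by
        have := hinv.const_mul (1 + L)
        rw [mul_zero] at this
        exact this.eventually (gt_mem_nhds (by positivity))
      have hyr : ∀ᶠ n in atTop, ∀ c, |Y (φ n) ⌊r * φ n⌋₊ c - y r c| < δ / 8 :=
        eventually_all.2 fun c => by
          simpa [Real.dist_eq] using Metric.tendsto_nhds.1 (hy r hr c) (δ / 8) (by positivity)
      filter_upwards [hφt.eventually hL, hφt.eventually (hstep k), hsm, hyr,
        hφt.eventually (eventually_ge_atTop k)] with n hLn hsn hsmn hyn hkn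
      set m := φ n with hm
      have hm0 : (0 : ℝ) < m := by exact_mod_cast hk.trans_le hkn
      have hm1 : 0 < 1 / (m : ℝ) := by positivity
      have hsm1 : 1 / (m : ℝ) < η / 4 := by
        have := hsmn.trans_le (min_le_right _ _)
        nlinarith
      have hsm2 : (1 + L) * (1 / (m : ℝ)) < δ / 8 := hsmn.trans_le (min_le_left _ _)
      have hfl : ∀ l : ℕ, ⌊((l : ℝ) / m) * m⌋₊ = l := fun l => by
        rw [div_mul_cancel₀ _ hm0.ne', Nat.floor_natCast]
      have hk' : (0 : ℝ) < k := by exact_mod_cast hk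
      have hmem : ∀ l : ℕ, ⌊s * m⌋₊ ≤ l → l ≤ ⌊t * m⌋₊ + 1 →
          |(l : ℝ) / m - r| < η := by
        intro l h1 h2
        have h1' : (⌊s * m⌋₊ : ℝ) ≤ l := by exact_mod_cast h1
        have h2' : (l : ℝ) ≤ ⌊t * m⌋₊ + 1 := by exact_mod_cast h2
        have h3 : s * m < (⌊s * m⌋₊ : ℝ) + 1 := Nat.lt_floor_add_one _
        have h4 : (⌊t * m⌋₊ : ℝ) ≤ t * m := Nat.floor_le (by positivity)
        have h5 : s - 1 / m ≤ (l : ℝ) / m := by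
          rw [le_div_iff₀ hm0, sub_mul, one_div, inv_mul_cancel₀ hm0.ne']; linarith
        have h6 : (l : ℝ) / m ≤ t + 1 / m := by
          rw [div_le_iff₀ hm0, add_mul, one_div, inv_mul_cancel₀ hm0.ne']; linarith
        rw [abs_lt]; constructor <;> linarith
      have hΦl : ∀ l : ℕ, ⌊s * m⌋₊ ≤ l → l ≤ ⌊t * m⌋₊ + 1 →
          |Φ ((l : ℝ) / m) (Y m l) c - Φ r (y r) c| < ε := by
        intro l h1 h2
        have h3 := hmem l h1 h2
        have h3' := abs_lt.1 h3
        have h4 : dist ((l : ℝ) / m, Y m l) (r, y r) < δ := by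
          rw [Prod.dist_eq]
          refine max_lt (by rw [Real.dist_eq]; linarith) ?_
          refine (dist_pi_lt_iff hδ).2 fun c' => ?_
          have h5 := hLn r ((l : ℝ) / m) hk1.le hk2.le (by linarith) (by linarith) c'
          rw [hfl] at h5
          have h6 : L * (|(l : ℝ) / m - r| + 1 / m) ≤ L * η + L * (1 / m) := by
            rw [← mul_add]; gcongr
          have h7 := hyn c'
          rw [Real.dist_eq]
          have h8 : |Y m l c' - y r c'| ≤ |Y m l c' - Y m ⌊r * m⌋₊ c'|
            + |Y m ⌊r * m⌋₊ c' - y r c'| := abs_sub_le _ _ _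
          nlinarith
        have h5 := hδΦ h4
        exact (dist_le_pi_dist (Φ ((l : ℝ) / m) (Y m l)) (Φ r (y r)) c).trans_lt h5
      have hfle : ⌊s * m⌋₊ ≤ ⌊t * m⌋₊ := Nat.floor_mono (by gcongr)
      have := abs_sub_sub_mul_le_of_step (fun l => Y m l c) (1 / m * Φ r (y r) c) (1 / m * ε)
        ⌊s * m⌋₊ ⌊t * m⌋₊ hfle (by
          intro l h1 h2
          have e1 := hmem l h1 (by omega)
          have e1' := abs_lt.1 e1
          have e2 := floor_mul_mem k m ((l : ℝ) / m) (by linarith) (by linarith) hk hkn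
          rw [hfl] at e2
          rw [hsn l e2.1 e2.2 c, ← mul_sub, abs_mul, abs_of_pos hm1]
          refine mul_le_mul_of_nonneg_left (hΦl (l + σ c) (by omega) ?_).le hm1.le
          have := hσ c
          omega)
      convert this using 1
      · congr 1
        ring
      · ring
    have hlimt := tendsto_floor_mul_div hφ ht0.le
    have hlims := tendsto_floor_mul_div hφ hs0.le
    exact le_of_tendsto_of_tendsto
      ((((hy t ht0 c).sub (hy s hs0 c)).sub ((hlimt.sub hlims).mul_const _)).abs)
      ((hlimt.sub hlims).mul_const _) hev
  have hnhds : Ioo (r - η / 2) (r + η / 2) ∈ nhds r := Ioo_mem_nhds (by linarith) (by linarith)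
  filter_upwards [hnhds] with x hx
  rw [smul_eq_mul, Real.norm_eq_abs, Real.norm_eq_abs]
  rcases le_total r x with h | h
  · have := hmain r x (by linarith) h hx.2
    rw [abs_of_nonneg (sub_nonneg.2 h)]
    linarith
  · have := hmain x r hx.1 h (by linarith)
    rw [abs_of_nonpos (sub_nonpos.2 h), ← abs_neg]
    rw [show -(y x c - y r c - (x - r) * Φ r (y r) c)
      = y r c - y x c - (r - x) * Φ r (y r) c by ring]
    linarith

end EulerScheme

/-- The density of the static energy at radius `r`, as a function of the values `a`, `f` and of
the derivatives `b = a'`, `v = f'`. -/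
def staticDensity (κ r a b f v : ℝ) : ℝ :=
  2 * (2 * b ^ 2 + (a ^ 2 - 1) ^ 2 / r ^ 2)
    + (1 / 2) * (r ^ 2 * v ^ 2 + 2 * a ^ 2 * sin f ^ 2)
    + 2 * κ * a ^ 2 * sin f ^ 2 * (2 * v ^ 2 + a ^ 2 * sin f ^ 2 / r ^ 2)

/-- The right-hand side of the equation for `a''`. -/
def forceA (κ r a f v g : ℝ) : ℝ :=
  a * (a ^ 2 - 1) / r ^ 2 + (1 / 4) * a * sin f ^ 2 + κ * a * sin f ^ 2 * v ^ 2
    + κ * a ^ 3 * sin f ^ 4 / r ^ 2 - a * g ^ 2 / 2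

/-- The right-hand side of the equation for `f`. -/
def forceF (κ r a f v : ℝ) : ℝ :=
  2 * a ^ 2 * sin f * cos f + 8 * κ * a ^ 2 * sin f * cos f * v ^ 2
    + 8 * κ * a ^ 4 * sin f ^ 3 * cos f / r ^ 2

/-- The coefficient of `f'` in the equation for `f`. -/
def stiffness (κ r a f : ℝ) : ℝ := 8 * κ * (a ^ 2 * sin f ^ 2) + r ^ 2

/-- The discrete momentum `∑ h a s` conjugate to the third field. -/
def momentum (h : ℝ) (a s : ℕ → ℝ) (i : ℕ) : ℝ := ∑ l ∈ Finset.range i, h * (a (l + 1) * s l)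

/-- The positive part of the discrete action. -/
def discreteEnergy (κ h : ℝ) (N : ℕ) (a f s : ℕ → ℝ) : ℝ :=
  ∑ j ∈ Finset.range N, h * (staticDensity κ ((j + 1) * h) (a (j + 1)) ((a (j + 1) - a j) / h)
    (f (j + 1)) ((f (j + 1) - f j) / h) + s j ^ 2 / 2
    + momentum h a s (j + 1) ^ 2 / ((j + 1) * h) ^ 2)

/-- The discrete action, in which the third field has been replaced by its dual variable `s`. -/
def discreteAction (κ q h : ℝ) (N : ℕ) (a f s : ℕ → ℝ) : ℝ :=
  discreteEnergy κ h N a f s - 2 * q * momentum h a s N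

/-- The box of admissible discrete fields. -/
def Box (α M : ℝ) (N : ℕ) (a f s : ℕ → ℝ) : Prop :=
  (a 0 = 1 ∧ a N = 0 ∧ f 0 = 0 ∧ f N = α) ∧
    ∀ i, a i ∈ Icc 0 M ∧ f i ∈ Icc 0 α ∧ s i ∈ Icc (-M) M

theorem staticDensity_nonneg {κ : ℝ} (hκ : 0 < κ) (r a b f v : ℝ) :
    0 ≤ staticDensity κ r a b f v := by
  unfold staticDensity
  positivity

theorem momentum_zero (h : ℝ) (a s : ℕ → ℝ) : momentum h a s 0 = 0 := by simp [momentum]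

theorem momentum_succ (h : ℝ) (a s : ℕ → ℝ) (i : ℕ) :
    momentum h a s (i + 1) = momentum h a s i + h * (a (i + 1) * s i) := by
  simp [momentum, Finset.sum_range_succ]

theorem discreteEnergy_succ (κ h : ℝ) (N : ℕ) (a f s : ℕ → ℝ) :
    discreteEnergy κ h (N + 1) a f s = discreteEnergy κ h N a f s
      + h * (staticDensity κ ((N + 1) * h) (a (N + 1)) ((a (N + 1) - a N) / h)
    (f (N + 1)) ((f (N + 1) - f N) / h) + s N ^ 2 / 2
    + momentum h a s (N + 1) ^ 2 / ((N + 1) * h) ^ 2) := by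
  simp [discreteEnergy, Finset.sum_range_succ]

theorem exists_box_minimizer (κ q h α M : ℝ) (N : ℕ) (hne : ∃ a f s, Box α M N a f s) :
    ∃ a f s, Box α M N a f s ∧ ∀ a' f' s', Box α M N a' f' s' →
      discreteAction κ q h N a f s ≤ discreteAction κ q h N a' f' s' := by
  have hcont : Continuous fun x : (ℕ → ℝ) × (ℕ → ℝ) × (ℕ → ℝ) =>
      discreteAction κ q h N x.1 x.2.1 x.2.2 := by
    unfold discreteAction discreteEnergy staticDensity momentum
    simp only [div_eq_mul_inv]
    fun_prop
  have hK : IsCompact {x : (ℕ → ℝ) × (ℕ → ℝ) × (ℕ → ℝ) | Box α M N x.1 x.2.1 x.2.2} := by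
    have h1 : IsCompact ((univ.pi fun _ : ℕ => Icc 0 M) ×ˢ (univ.pi fun _ : ℕ => Icc 0 α) ×ˢ
        (univ.pi fun _ : ℕ => Icc (-M) M)) :=
      (isCompact_univ_pi fun _ => isCompact_Icc).prod
        ((isCompact_univ_pi fun _ => isCompact_Icc).prod
          (isCompact_univ_pi fun _ => isCompact_Icc))
    have h2 : IsClosed {x : (ℕ → ℝ) × (ℕ → ℝ) × (ℕ → ℝ) |
        x.1 0 = 1 ∧ x.1 N = 0 ∧ x.2.1 0 = 0 ∧ x.2.1 N = α} :=
      (isClosed_eq (by fun_prop) (by fun_prop)).inter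
        ((isClosed_eq (by fun_prop) (by fun_prop)).inter
          ((isClosed_eq (by fun_prop) (by fun_prop)).inter
            (isClosed_eq (by fun_prop) (by fun_prop))))
    convert h1.inter_left h2 using 1
    ext x
    simp only [Box, mem_ofPred_eq, mem_inter_iff, mem_prod, mem_univ_pi, forall_and]
  obtain ⟨a, f, s, hb⟩ := hne
  obtain ⟨x, hx, hmin⟩ := hK.exists_isMinOn ⟨(a, f, s), hb⟩ hcont.continuousOn
  exact ⟨x.1, x.2.1, x.2.2, hx, fun a' f' s' hb' => hmin (a := (a', f', s')) hb'⟩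

theorem discreteEnergy_nonneg {κ h : ℝ} (hκ : 0 < κ) (hh : 0 < h) (N : ℕ) (a f s : ℕ → ℝ) :
    0 ≤ discreteEnergy κ h N a f s :=
  Finset.sum_nonneg fun j _ => by
    have := staticDensity_nonneg hκ ((j + 1) * h) (a (j + 1)) ((a (j + 1) - a j) / h)
      (f (j + 1)) ((f (j + 1) - f j) / h)
    positivity

/-- Coercivity of the discrete action, obtained by testing with a multiple of `f`. -/
theorem two_mul_mul_momentum_le {κ h α c τ : ℝ} (hκ : 0 < κ) (hh : 0 < h) (hα : α ≤ π / 2)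
    (hτ : 0 < τ) (hc : c ^ 2 * π ^ 2 = 2 * τ ^ 2) (N : ℕ) (a f s : ℕ → ℝ) (hf : ∀ i, f i ∈ Icc 0 α) :
    2 * (c * f N) * momentum h a s N + τ * (h * (momentum h a s N ^ 2 / (N * h) ^ 2))
      ≤ τ * discreteEnergy κ h N a f s := by
  induction N with
  | zero => simp [momentum, discreteEnergy]
  | succ m ih =>
    rw [discreteEnergy_succ]
    push_cast
    have hpi : (3 : ℝ) < π := pi_gt_three
    have hsin : f (m + 1) * 2 ≤ π * sin (f (m + 1)) := by
      have := Real.mul_le_sin (hf (m + 1)).1 ((hf (m + 1)).2.trans hα)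
      rw [div_mul_eq_mul_div, div_le_iff₀ pi_pos] at this
      linarith
    have hf0 := (hf (m + 1)).1
    have hsq : f (m + 1) ^ 2 * 4 ≤ π ^ 2 * sin (f (m + 1)) ^ 2 := by
      nlinarith
    set v := (f (m + 1) - f m) / h with hv
    have hfm : f (m + 1) = f m + h * v := by rw [hv]; field_simp; ring
    have e1 : 2 * (c * f (m + 1)) * (a (m + 1) * s m)
        ≤ τ * (s m ^ 2 / 2 + a (m + 1) ^ 2 * sin (f (m + 1)) ^ 2) := by
      have h1 : c ^ 2 * f (m + 1) ^ 2 * 2 ≤ τ ^ 2 * sin (f (m + 1)) ^ 2 := by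
        have : π ^ 2 * (c ^ 2 * f (m + 1) ^ 2 * 2) ≤ π ^ 2 * (τ ^ 2 * sin (f (m + 1)) ^ 2) := by
          calc π ^ 2 * (c ^ 2 * f (m + 1) ^ 2 * 2) = (c ^ 2 * π ^ 2) * (f (m + 1) ^ 2 * 2) := by ring
            _ = τ ^ 2 * (f (m + 1) ^ 2 * 4) := by rw [hc]; ring
            _ ≤ τ ^ 2 * (π ^ 2 * sin (f (m + 1)) ^ 2) := by gcongr
            _ = _ := by ring
        exact le_of_mul_le_mul_left this (by positivity)
      have h2 : 0 ≤ (τ * s m - 2 * (c * f (m + 1)) * a (m + 1)) ^ 2 := sq_nonneg _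
      have h3 : a (m + 1) ^ 2 * (c ^ 2 * f (m + 1) ^ 2 * 2)
          ≤ a (m + 1) ^ 2 * (τ ^ 2 * sin (f (m + 1)) ^ 2) := by gcongr
      have h4 : τ * (2 * (c * f (m + 1)) * (a (m + 1) * s m))
          ≤ τ * (τ * (s m ^ 2 / 2 + a (m + 1) ^ 2 * sin (f (m + 1)) ^ 2)) := by nlinarith
      exact le_of_mul_le_mul_left h4 hτ
    have e2 : 2 * c * v * momentum h a s m
        ≤ τ * (momentum h a s m ^ 2 / (m * h) ^ 2 + (1 / 2) * (((m + 1) * h) ^ 2 * v ^ 2)) := by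
      rcases Nat.eq_zero_or_pos m with rfl | hm
      · simp only [momentum_zero]
        have : 0 ≤ v ^ 2 := sq_nonneg v
        simp
        positivity
      · have hm' : (0 : ℝ) < m := by exact_mod_cast hm
        set x := momentum h a s m / (m * h) with hx
        have hmx : momentum h a s m = m * h * x := by rw [hx]; field_simp
        rw [hmx]
        have h0 : (m * h * x) ^ 2 / (m * h) ^ 2 = x ^ 2 := by field_simp
        rw [h0]
        have hc' : c ^ 2 * 2 ≤ τ ^ 2 := by
          nlinarith [mul_nonneg (sq_nonneg c) (by nlinarith : (0 : ℝ) ≤ π ^ 2 - 9)]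
        have h2 : 0 ≤ (τ * x - c * (m * h * v)) ^ 2 := sq_nonneg _
        have h3 : (m * h * v) ^ 2 ≤ ((m + 1) * h) ^ 2 * v ^ 2 := by
          rw [mul_pow]; gcongr; linarith
        have h5 : c ^ 2 * (m * h * v) ^ 2 ≤ τ ^ 2 / 2 * (((m + 1) * h) ^ 2 * v ^ 2) := by
          gcongr; linarith
        have h4 : τ * (2 * c * v * (m * h * x))
            ≤ τ * (τ * (x ^ 2 + 1 / 2 * (((m + 1) * h) ^ 2 * v ^ 2))) := by nlinarith
        exact le_of_mul_le_mul_left h4 hτ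
    have e3 : 0 ≤ 2 * (2 * ((a (m + 1) - a m) / h) ^ 2
          + (a (m + 1) ^ 2 - 1) ^ 2 / ((m + 1) * h) ^ 2)
        + 2 * κ * a (m + 1) ^ 2 * sin (f (m + 1)) ^ 2 * (2 * v ^ 2
          + a (m + 1) ^ 2 * sin (f (m + 1)) ^ 2 / ((m + 1) * h) ^ 2) := by positivity
    have e4 : 2 * (c * f (m + 1)) * momentum h a s (m + 1)
        = 2 * (c * f m) * momentum h a s m + h * (2 * c * v * momentum h a s m)
          + h * (2 * (c * f (m + 1)) * (a (m + 1) * s m)) := by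
      rw [momentum_succ, mul_add]
      nth_rewrite 1 [hfm]
      ring
    have e5 := mul_le_mul_of_nonneg_left e1 hh.le
    have e6 := mul_le_mul_of_nonneg_left e2 hh.le
    have e7 := mul_nonneg (mul_nonneg hτ.le hh.le) e3
    rw [e4]
    unfold staticDensity
    generalize (a (m + 1) ^ 2 - 1) ^ 2 / (((m : ℝ) + 1) * h) ^ 2 = x1 at *
    generalize a (m + 1) ^ 2 * sin (f (m + 1)) ^ 2 / (((m : ℝ) + 1) * h) ^ 2 = x2 at *
    generalize momentum h a s m ^ 2 / ((m : ℝ) * h) ^ 2 = x3 at *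
    generalize momentum h a s (m + 1) ^ 2 / (((m : ℝ) + 1) * h) ^ 2 = x4 at *
    generalize (a (m + 1) - a m) / h = b at *
    linarith

theorem deriv_nonneg_of_isMin_right {F : ℝ → ℝ} {d δ : ℝ} (hF : HasDerivAt F d 0) (hδ : 0 < δ)
    (h : ∀ t, 0 < t → t < δ → F 0 ≤ F t) : 0 ≤ d := by
  have h1 := hF.tendsto_slope_zero_right
  refine ge_of_tendsto h1 ?_
  filter_upwards [Ioo_mem_nhdsGT hδ] with t ht
  rw [zero_add, smul_eq_mul]
  exact mul_nonneg (inv_nonneg.2 ht.1.le) (sub_nonneg.2 (h t ht.1 ht.2))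

theorem deriv_nonpos_of_isMin_left {F : ℝ → ℝ} {d δ : ℝ} (hF : HasDerivAt F d 0) (hδ : 0 < δ)
    (h : ∀ t, -δ < t → t < 0 → F 0 ≤ F t) : d ≤ 0 := by
  have h1 : HasDerivAt (fun t => F (-t)) (-d) 0 := by
    have := HasDerivAt.scomp (0 : ℝ) (g₁ := F) (h := fun t : ℝ => -t) (by simpa using hF)
      (hasDerivAt_neg 0)
    simpa [Function.comp_def] using this
  have := deriv_nonneg_of_isMin_right h1 hδ (fun t h2 h3 => by
    simpa using h (-t) (by linarith) (by linarith))
  linarith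

/-- The third field, recovered from its momentum `P`. -/
def dualField (q h : ℝ) (N : ℕ) (P : ℕ → ℝ) (i : ℕ) : ℝ :=
  q - ∑ j ∈ Finset.range N, if i ≤ j + 1 then h * (P (j + 1) / ((j + 1) * h) ^ 2) else 0

theorem hasDerivAt_affine (x y : ℝ) : HasDerivAt (fun t : ℝ => x + t * y) y 0 := by
  simpa using ((hasDerivAt_id (0 : ℝ)).mul_const y).const_add x

theorem hasDerivAt_discreteAction_dual (κ q h : ℝ) (N : ℕ) (a f s ζ : ℕ → ℝ) :
    HasDerivAt (fun t => discreteAction κ q h N a f (fun i => s i + t * ζ i))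
      (∑ j ∈ Finset.range N, h * (s j * ζ j
        + 2 * momentum h a s (j + 1) * momentum h a ζ (j + 1) / ((j + 1) * h) ^ 2)
        - 2 * q * momentum h a ζ N) 0 := by
  have hm : ∀ (t : ℝ) i, momentum h a (fun i => s i + t * ζ i) i
      = momentum h a s i + t * momentum h a ζ i := fun t i => by
    simp only [momentum, Finset.mul_sum, ← Finset.sum_add_distrib]
    exact Finset.sum_congr rfl fun l _ => by ring
  simp only [discreteAction, discreteEnergy, hm]
  refine HasDerivAt.sub (HasDerivAt.fun_sum fun j _ => HasDerivAt.const_mul _ ?_)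
    ((hasDerivAt_affine _ _).const_mul _)
  refine HasDerivAt.congr_deriv ((((hasDerivAt_affine (s j) (ζ j)).pow 2).div_const 2
    |>.const_add _).add (((hasDerivAt_affine _ _).pow 2).div_const _)) ?_
  simp
  ring

theorem hasDerivAt_discreteAction_a (κ q h : ℝ) (N : ℕ) (a f s η : ℕ → ℝ) :
    HasDerivAt (fun t => discreteAction κ q h N (fun i => a i + t * η i) f s)
      (∑ j ∈ Finset.range N, h * (8 * ((a (j + 1) - a j) / h) * ((η (j + 1) - η j) / h)
        + 8 * η (j + 1) * forceA κ ((j + 1) * h) (a (j + 1)) (f (j + 1)) ((f (j + 1) - f j) / h) 0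
        + 2 * momentum h a s (j + 1) * momentum h η s (j + 1) / ((j + 1) * h) ^ 2)
        - 2 * q * momentum h η s N) 0 := by
  have hm : ∀ (t : ℝ) i, momentum h (fun i => a i + t * η i) s i
      = momentum h a s i + t * momentum h η s i := fun t i => by
    simp only [momentum, Finset.mul_sum, ← Finset.sum_add_distrib]
    exact Finset.sum_congr rfl fun l _ => by ring
  simp only [discreteAction, discreteEnergy, hm]
  refine HasDerivAt.sub (HasDerivAt.fun_sum fun j _ => HasDerivAt.const_mul _ ?_)
    ((hasDerivAt_affine _ _).const_mul _)
  have hb : ∀ t, (a (j + 1) + t * η (j + 1) - (a j + t * η j)) / h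
      = (a (j + 1) - a j) / h + t * ((η (j + 1) - η j) / h) := fun t => by ring
  simp only [hb, staticDensity, forceA]
  have hA := (hasDerivAt_affine (a (j + 1)) (η (j + 1))).fun_pow 2
  have hB := (hasDerivAt_affine ((a (j + 1) - a j) / h) ((η (j + 1) - η j) / h)).fun_pow 2
  refine HasDerivAt.congr_deriv (((((((hB.const_mul 2).fun_add
    (((hA.sub_const 1).fun_pow 2).div_const (((j + 1) * h) ^ 2))).const_mul 2).fun_add
    ((((hA.const_mul 2).mul_const (sin (f (j + 1)) ^ 2)).const_add _).const_mul (1 / 2))).fun_add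
    (((hA.const_mul (2 * κ)).mul_const (sin (f (j + 1)) ^ 2)).fun_mul
      (((hA.mul_const (sin (f (j + 1)) ^ 2)).div_const _).const_add _))).add_const (s j ^ 2 / 2)).fun_add
    (((hasDerivAt_affine (momentum h a s (j + 1)) (momentum h η s (j + 1))).fun_pow 2).div_const
      (((j + 1) * h) ^ 2))) ?_
  simp
  ring

theorem hasDerivAt_discreteAction_f (κ q h : ℝ) (N : ℕ) (a f s ξ : ℕ → ℝ) :
    HasDerivAt (fun t => discreteAction κ q h N a (fun i => f i + t * ξ i) s)
      (∑ j ∈ Finset.range N, h * (stiffness κ ((j + 1) * h) (a (j + 1)) (f (j + 1))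
          * ((f (j + 1) - f j) / h) * ((ξ (j + 1) - ξ j) / h)
        + ξ (j + 1) * forceF κ ((j + 1) * h) (a (j + 1)) (f (j + 1)) ((f (j + 1) - f j) / h))) 0 := by
  simp only [discreteAction, discreteEnergy]
  refine HasDerivAt.sub_const _ (HasDerivAt.fun_sum fun j _ => HasDerivAt.const_mul _ ?_)
  have hb : ∀ t, (f (j + 1) + t * ξ (j + 1) - (f j + t * ξ j)) / h
      = (f (j + 1) - f j) / h + t * ((ξ (j + 1) - ξ j) / h) := fun t => by ring
  simp only [hb, staticDensity, forceF, stiffness]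
  have hA := ((hasDerivAt_affine (f (j + 1)) (ξ (j + 1))).sin).fun_pow 2
  have hB := (hasDerivAt_affine ((f (j + 1) - f j) / h) ((ξ (j + 1) - ξ j) / h)).fun_pow 2
  refine HasDerivAt.congr_deriv ((((((((hB.const_mul (((j + 1) * h) ^ 2))).fun_add
    (hA.const_mul (2 * a (j + 1) ^ 2))).const_mul (1 / 2)).const_add _).fun_add
    ((hA.const_mul (2 * κ * a (j + 1) ^ 2)).fun_mul ((hB.const_mul 2).fun_add
      ((hA.const_mul (a (j + 1) ^ 2)).div_const (((j + 1) * h) ^ 2))))).add_const _).add_const _) ?_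
  simp
  ring

theorem momentum_single_right (h : ℝ) (a : ℕ → ℝ) (k i : ℕ) :
    momentum h a (fun i => if i = k then 1 else 0) i = if k < i then h * a (k + 1) else 0 := by
  simp [momentum]

theorem momentum_single_left (h : ℝ) (s : ℕ → ℝ) (k i : ℕ) :
    momentum h (fun i => if i = k + 1 then 1 else 0) s i = if k < i then h * s k else 0 := by
  simp [momentum]

theorem sum_momentum_single (q h y : ℝ) (N k : ℕ) (hk : k < N) (P : ℕ → ℝ) :
    ∑ j ∈ Finset.range N, h * (2 * P (j + 1) * (if k < j + 1 then h * y else 0)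
      / ((j + 1) * h) ^ 2) - 2 * q * (if k < N then h * y else 0)
      = - (2 * h * y * dualField q h N P (k + 1)) := by
  rw [if_pos hk, dualField, mul_sub, Finset.mul_sum, neg_sub]
  congr 1
  · refine Finset.sum_congr rfl fun j _ => ?_
    by_cases hj : k < j + 1
    · rw [if_pos hj, if_pos (by omega)]; ring
    · rw [if_neg hj, if_neg (by omega)]; ring
  · ring

section Stationarity

variable {κ q h α M : ℝ} {N : ℕ} {a f s : ℕ → ℝ}

theorem dual_stationary (hh : 0 < h) (hbox : Box α M N a f s)
    (hmin : ∀ a' f' s', Box α M N a' f' s' →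
      discreteAction κ q h N a f s ≤ discreteAction κ q h N a' f' s')
    (k : ℕ) (hk : k < N) (hs : |s k| < M) :
    s k = 2 * a (k + 1) * dualField q h N (momentum h a s) (k + 1) := by
  have hd := hasDerivAt_discreteAction_dual κ q h N a f s (fun i => if i = k then 1 else 0)
  have hle : ∀ t, |t| < M - |s k| → discreteAction κ q h N a f (fun i => s i + 0 * (if i = k then 1 else 0))
      ≤ discreteAction κ q h N a f (fun i => s i + t * (if i = k then 1 else 0)) := by
    intro t ht
    simp only [zero_mul, add_zero]
    refine hmin _ _ _ ⟨hbox.1, fun i => ⟨(hbox.2 i).1, (hbox.2 i).2.1, ?_⟩⟩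
    beta_reduce
    split_ifs with hi
    · subst hi
      rw [mul_one]
      exact abs_le.1 ((abs_add_le _ _).trans (by linarith))
    · simpa using (hbox.2 i).2.2
  have h1 := deriv_nonneg_of_isMin_right hd (sub_pos.2 hs)
    fun t h1 h2 => hle t (by rwa [abs_of_pos h1])
  have h2 := deriv_nonpos_of_isMin_left hd (sub_pos.2 hs)
    fun t h1 h2 => hle t (by rw [abs_of_neg h2]; linarith)
  have h3 := le_antisymm h2 h1
  simp only [momentum_single_right, mul_add, Finset.sum_add_distrib] at h3
  rw [add_sub_assoc, sum_momentum_single _ _ _ _ _ hk] at h3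
  simp [hk] at h3
  have : h * (s k - 2 * a (k + 1) * dualField q h N (momentum h a s) (k + 1)) = 0 := by
    linarith
  rcases mul_eq_zero.1 this with h4 | h4
  · exact absurd h4 hh.ne'
  · linarith

theorem a_stationary (hh : 0 < h) (hbox : Box α M N a f s)
    (hmin : ∀ a' f' s', Box α M N a' f' s' →
      discreteAction κ q h N a f s ≤ discreteAction κ q h N a' f' s')
    (k : ℕ) (hk : k + 1 < N) (ha : a (k + 1) < M)
    (hs : s k = 2 * a (k + 1) * dualField q h N (momentum h a s) (k + 1)) :
    (a (k + 2) - a (k + 1)) / h = (a (k + 1) - a k) / h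
      + h * forceA κ ((k + 1) * h) (a (k + 1)) (f (k + 1)) ((f (k + 1) - f k) / h)
        (dualField q h N (momentum h a s) (k + 1)) := by
  have hd := hasDerivAt_discreteAction_a κ q h N a f s (fun i => if i = k + 1 then 1 else 0)
  have hle : ∀ t, 0 ≤ a (k + 1) + t → a (k + 1) + t ≤ M →
      discreteAction κ q h N (fun i => a i + 0 * (if i = k + 1 then 1 else 0)) f s
      ≤ discreteAction κ q h N (fun i => a i + t * (if i = k + 1 then 1 else 0)) f s := by
    intro t ht0 htM
    simp only [zero_mul, add_zero]
    refine hmin _ _ _ ⟨⟨?_, ?_, hbox.1.2.2⟩, fun i => ⟨?_, (hbox.2 i).2⟩⟩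
    · simpa using hbox.1.1
    · simpa [hk.ne'] using hbox.1.2.1
    · beta_reduce
      split_ifs with hi
      · subst hi
        rw [mul_one]
        exact ⟨ht0, htM⟩
      · simpa using (hbox.2 i).1
  have ha0 := (hbox.2 (k + 1)).1.1
  have h1 := deriv_nonneg_of_isMin_right hd (sub_pos.2 ha)
    fun t h1 h2 => hle t (by linarith) (by linarith)
  have h2 : 0 < a (k + 1) → _ := fun h0 => deriv_nonpos_of_isMin_left hd h0
    fun t h1 h2 => hle t (by linarith) (by linarith)
  have hval : (∑ j ∈ Finset.range N, h * (8 * ((a (j + 1) - a j) / h)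
        * (((if j + 1 = k + 1 then 1 else 0) - (if j = k + 1 then 1 else 0)) / h)
        + 8 * (if j + 1 = k + 1 then 1 else 0)
          * forceA κ ((j + 1) * h) (a (j + 1)) (f (j + 1)) ((f (j + 1) - f j) / h) 0
        + 2 * momentum h a s (j + 1) * momentum h (fun i => if i = k + 1 then 1 else 0) s (j + 1)
          / ((j + 1) * h) ^ 2)
        - 2 * q * momentum h (fun i => if i = k + 1 then 1 else 0) s N)
      = 8 * ((a (k + 1) - a k) / h - (a (k + 2) - a (k + 1)) / h
        + h * forceA κ ((k + 1) * h) (a (k + 1)) (f (k + 1)) ((f (k + 1) - f k) / h)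
          (dualField q h N (momentum h a s) (k + 1))) := by
    simp only [momentum_single_left]
    have e : ∀ j : ℕ, h * (8 * ((a (j + 1) - a j) / h)
        * (((if j + 1 = k + 1 then 1 else 0) - (if j = k + 1 then 1 else 0)) / h)
        + 8 * (if j + 1 = k + 1 then 1 else 0)
          * forceA κ ((j + 1) * h) (a (j + 1)) (f (j + 1)) ((f (j + 1) - f j) / h) 0
        + 2 * momentum h a s (j + 1) * (if k < j + 1 then h * s k else 0) / ((j + 1) * h) ^ 2)
        = (if j = k then 8 * ((a (j + 1) - a j) / h) + h * 8
          * forceA κ ((j + 1) * h) (a (j + 1)) (f (j + 1)) ((f (j + 1) - f j) / h) 0 else 0)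
          - (if j = k + 1 then 8 * ((a (j + 1) - a j) / h) else 0)
          + h * (2 * momentum h a s (j + 1) * (if k < j + 1 then h * s k else 0)
            / ((j + 1) * h) ^ 2) := by
      intro j
      simp only [add_left_inj]
      by_cases hj1 : j = k
      · subst hj1
        simp
        field_simp
      · by_cases hj2 : j = k + 1
        · subst hj2
          simp
          field_simp
        · simp [hj1, hj2]
    simp only [e, Finset.sum_add_distrib, Finset.sum_sub_distrib, Finset.sum_ite_eq',
      Finset.mem_range, hk, (Nat.lt_succ_self k).trans hk, if_true]
    have e2 := sum_momentum_single q h (s k) N k (by omega) (momentum h a s)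
    rw [if_pos (by omega)] at e2
    rw [add_sub_assoc, e2]
    nth_rewrite 1 [hs]
    simp only [forceA]
    ring
  rw [hval] at h1 h2
  rcases ha0.eq_or_lt with h0 | h0
  · have hs0 : forceA κ ((k + 1) * h) (a (k + 1)) (f (k + 1)) ((f (k + 1) - f k) / h)
          (dualField q h N (momentum h a s) (k + 1)) = 0 := by
      rw [← h0]; simp [forceA]
    rw [hs0, ← h0] at h1 ⊢
    have h3 : (0 - a k) / h ≤ 0 := div_nonpos_of_nonpos_of_nonneg (by linarith [(hbox.2 k).1.1]) hh.le
    have h4 : 0 ≤ (a (k + 2) - 0) / h := div_nonneg (by linarith [(hbox.2 (k + 2)).1.1]) hh.le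
    linarith
  · have := h2 h0
    linarith

theorem forceF_nonneg (hκ : 0 < κ) (hα : α ≤ π / 2) {r x y v : ℝ} (hy : y ∈ Icc 0 α) :
    0 ≤ forceF κ r x y v := by
  have h1 : 0 ≤ sin y := sin_nonneg_of_mem_Icc ⟨hy.1, by linarith [hy.2, pi_pos]⟩
  have h2 : 0 ≤ cos y := cos_nonneg_of_mem_Icc ⟨by linarith [hy.1, pi_pos], by linarith [hy.2]⟩
  unfold forceF
  positivity

theorem stiffness_pos (hκ : 0 < κ) {r : ℝ} (hr : 0 < r) (x y : ℝ) : 0 < stiffness κ r x y := by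
  unfold stiffness
  positivity

theorem f_stationary (hκ : 0 < κ) (hh : 0 < h) (hα : α ≤ π / 2) (hα0 : 0 < α)
    (hbox : Box α M N a f s)
    (hmin : ∀ a' f' s', Box α M N a' f' s' →
      discreteAction κ q h N a f s ≤ discreteAction κ q h N a' f' s')
    (k : ℕ) (hk : k + 1 < N) :
    stiffness κ ((k + 1 + 1) * h) (a (k + 2)) (f (k + 2)) * ((f (k + 2) - f (k + 1)) / h)
      = stiffness κ ((k + 1) * h) (a (k + 1)) (f (k + 1)) * ((f (k + 1) - f k) / h)
      + h * forceF κ ((k + 1) * h) (a (k + 1)) (f (k + 1)) ((f (k + 1) - f k) / h) := by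
  have hd := hasDerivAt_discreteAction_f κ q h N a f s (fun i => if i = k + 1 then 1 else 0)
  have hle : ∀ t, 0 ≤ f (k + 1) + t → f (k + 1) + t ≤ α →
      discreteAction κ q h N a (fun i => f i + 0 * (if i = k + 1 then 1 else 0)) s
      ≤ discreteAction κ q h N a (fun i => f i + t * (if i = k + 1 then 1 else 0)) s := by
    intro t ht0 htM
    simp only [zero_mul, add_zero]
    refine hmin _ _ _ ⟨⟨hbox.1.1, hbox.1.2.1, ?_, ?_⟩, fun i => ⟨(hbox.2 i).1, ?_, (hbox.2 i).2.2⟩⟩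
    · simpa using hbox.1.2.2.1
    · simpa [hk.ne'] using hbox.1.2.2.2
    · beta_reduce
      split_ifs with hi
      · subst hi
        rw [mul_one]
        exact ⟨ht0, htM⟩
      · simpa using (hbox.2 i).2.1
  have h1 : f (k + 1) < α → _ := fun h0 => deriv_nonneg_of_isMin_right hd (sub_pos.2 h0)
    fun t h1 h2 => hle t (by linarith [(hbox.2 (k + 1)).2.1.1]) (by linarith)
  have h2 : 0 < f (k + 1) → _ := fun h0 => deriv_nonpos_of_isMin_left hd h0
    fun t h1 h2 => hle t (by linarith) (by linarith [(hbox.2 (k + 1)).2.1.2])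
  have hval : (∑ j ∈ Finset.range N, h * (stiffness κ ((j + 1) * h) (a (j + 1)) (f (j + 1))
          * ((f (j + 1) - f j) / h)
          * (((if j + 1 = k + 1 then 1 else 0) - (if j = k + 1 then 1 else 0)) / h)
        + (if j + 1 = k + 1 then 1 else 0)
          * forceF κ ((j + 1) * h) (a (j + 1)) (f (j + 1)) ((f (j + 1) - f j) / h)))
      = stiffness κ ((k + 1) * h) (a (k + 1)) (f (k + 1)) * ((f (k + 1) - f k) / h)
        - stiffness κ ((k + 1 + 1) * h) (a (k + 2)) (f (k + 2)) * ((f (k + 2) - f (k + 1)) / h)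
        + h * forceF κ ((k + 1) * h) (a (k + 1)) (f (k + 1)) ((f (k + 1) - f k) / h) := by
    have e : ∀ j : ℕ, h * (stiffness κ ((j + 1) * h) (a (j + 1)) (f (j + 1))
          * ((f (j + 1) - f j) / h)
          * (((if j + 1 = k + 1 then 1 else 0) - (if j = k + 1 then 1 else 0)) / h)
        + (if j + 1 = k + 1 then 1 else 0)
          * forceF κ ((j + 1) * h) (a (j + 1)) (f (j + 1)) ((f (j + 1) - f j) / h))
        = (if j = k then stiffness κ ((j + 1) * h) (a (j + 1)) (f (j + 1))
            * ((f (j + 1) - f j) / h)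
            + h * forceF κ ((j + 1) * h) (a (j + 1)) (f (j + 1)) ((f (j + 1) - f j) / h) else 0)
          - (if j = k + 1 then stiffness κ ((j + 1) * h) (a (j + 1)) (f (j + 1))
            * ((f (j + 1) - f j) / h) else 0) := by
      intro j
      by_cases hj1 : j = k
      · subst hj1
        simp
        field_simp
      · by_cases hj2 : j = k + 1
        · subst hj2
          simp
          field_simp
        · simp [hj1, hj2]
    simp only [e, Finset.sum_sub_distrib, Finset.sum_ite_eq',
      Finset.mem_range, hk, (Nat.lt_succ_self k).trans hk, if_true]
    push_cast
    ring
  rw [hval] at h1 h2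
  have hf := (hbox.2 (k + 1)).2.1
  have hr1 : (0 : ℝ) < (k + 1) * h := by positivity
  have hr2 : (0 : ℝ) < (k + 1 + 1) * h := by positivity
  have hq1 := stiffness_pos hκ hr1 (a (k + 1)) (f (k + 1))
  have hq2 := stiffness_pos hκ hr2 (a (k + 2)) (f (k + 2))
  rcases hf.1.eq_or_lt with h0 | h0
  · have h3 := h1 (by rw [← h0]; exact hα0)
    have hs0 : forceF κ ((k + 1) * h) (a (k + 1)) (f (k + 1)) ((f (k + 1) - f k) / h) = 0 := by
      rw [← h0]; simp [forceF]
    rw [hs0] at h3 ⊢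
    have h4 : (f (k + 1) - f k) / h ≤ 0 :=
      div_nonpos_of_nonpos_of_nonneg (by linarith [(hbox.2 k).2.1.1]) hh.le
    have h5 : 0 ≤ (f (k + 2) - f (k + 1)) / h :=
      div_nonneg (by linarith [(hbox.2 (k + 2)).2.1.1]) hh.le
    have h6 := mul_nonneg hq2.le h5
    have h7 := mul_nonpos_of_nonneg_of_nonpos hq1.le h4
    linarith
  · have h3 := h2 h0
    rcases hf.2.eq_or_lt with h0' | h0'
    · have h4 : 0 ≤ (f (k + 1) - f k) / h :=
        div_nonneg (by linarith [(hbox.2 k).2.1.2]) hh.le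
      have h5 : (f (k + 2) - f (k + 1)) / h ≤ 0 :=
        div_nonpos_of_nonpos_of_nonneg (by linarith [(hbox.2 (k + 2)).2.1.2]) hh.le
      have h6 := mul_nonneg hq1.le h4
      have h7 := mul_nonpos_of_nonneg_of_nonpos hq2.le h5
      have h8 := mul_nonneg hh.le (forceF_nonneg hκ hα (r := (k + 1) * h) (x := a (k + 1))
        (v := (f (k + 1) - f k) / h) hf)
      linarith
    · have h4 := h1 h0'
      linarith

end Stationarity

theorem sq_add_le_of_sq_le {x y p q p' q' : ℝ} (hp : 0 ≤ p) (hq : 0 ≤ q) (hp' : 0 ≤ p')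
    (hq' : 0 ≤ q') (hx : x ^ 2 ≤ p * q) (hy : y ^ 2 ≤ p' * q') :
    (x + y) ^ 2 ≤ (p + p') * (q + q') := by
  have h1 : (2 * (x * y)) ^ 2 ≤ (p * q' + p' * q) ^ 2 := by
    have := mul_le_mul hx hy (sq_nonneg y) (mul_nonneg hp hq)
    nlinarith [sq_nonneg (p * q' - p' * q)]
  have h2 := abs_le_of_sq_le_sq' h1 (by positivity)
  nlinarith [h2.2]

/-- A discrete Cauchy–Schwarz inequality. -/
theorem sq_sub_le_of_step {x c w : ℕ → ℝ} {i m : ℕ} (him : i ≤ m)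
    (hc : ∀ j, i ≤ j → j < m → c j ≤ c (j + 1)) (hw : ∀ j, i ≤ j → j < m → w j ≤ w (j + 1))
    (hx : ∀ j, i ≤ j → j < m → (x (j + 1) - x j) ^ 2 ≤ (c (j + 1) - c j) * (w (j + 1) - w j)) :
    c i ≤ c m ∧ w i ≤ w m ∧ (x m - x i) ^ 2 ≤ (c m - c i) * (w m - w i) := by
  induction m, him using Nat.le_induction with
  | base => simp
  | succ m him ih =>
    obtain ⟨h1, h2, h3⟩ := ih (fun j h h' => hc j h (h'.trans m.lt_succ_self))
      (fun j h h' => hw j h (h'.trans m.lt_succ_self)) (fun j h h' => hx j h (h'.trans m.lt_succ_self))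
    have h4 := hc m him m.lt_succ_self
    have h5 := hw m him m.lt_succ_self
    refine ⟨h1.trans h4, h2.trans h5, ?_⟩
    have := sq_add_le_of_sq_le (sub_nonneg.2 h1) (sub_nonneg.2 h2) (sub_nonneg.2 h4)
      (sub_nonneg.2 h5) h3 (hx m him m.lt_succ_self)
    convert this using 1 <;> ring

theorem inv_mul_sub_inv_mul {h : ℝ} (hh : 0 < h) {m : ℕ} (hm : 0 < m) :
    h / ((m + 1) * h) ^ 2 ≤ 1 / (m * h) - 1 / ((m + 1) * h) := by
  have hm' : (0 : ℝ) < m := by exact_mod_cast hm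
  have e : 1 / (m * h) - 1 / ((m + 1) * h) = h / (m * h * ((m + 1) * h)) := by
    field_simp
    ring
  rw [e, pow_two]
  gcongr
  linarith

/-- A trial profile for `a`. -/
def trialA (r : ℝ) : ℝ := max 0 (min 1 (2 - r))

/-- A trial profile for `f`. -/
def trialF (α r : ℝ) : ℝ := α * max 0 (min 1 (r - 2))

theorem staticDensity_trial_le {κ α r r' h : ℝ} (hα : 0 < α) (hα2 : α ≤ 2)
    (hh : 0 < h) (h1 : h ≤ 1) (hr' : r = r' + h) (hr0 : 0 ≤ r') :
    staticDensity κ r (trialA r) ((trialA r - trialA r') / h) (trialF α r)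
      ((trialF α r - trialF α r') / h) ≤ if r ≤ 1 then 0 else 600 / r ^ 2 := by
  have hprod : trialA r * sin (trialF α r) = 0 := by
    rcases le_total r 2 with h | h
    · have : trialF α r = 0 := by
        rw [trialF, max_eq_left ((min_le_right _ _).trans (by linarith)), mul_zero]
      simp [this]
    · have : trialA r = 0 := by
        rw [trialA, max_eq_left ((min_le_right _ _).trans (by linarith))]
      simp [this]
  have hform : ∀ b v, staticDensity κ r (trialA r) b (trialF α r) v
      = 4 * b ^ 2 + 2 * ((trialA r ^ 2 - 1) ^ 2 / r ^ 2) + r ^ 2 * v ^ 2 / 2 := by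
    intro b v
    have e : trialA r ^ 2 * sin (trialF α r) ^ 2 = 0 := by rw [← mul_pow, hprod]; simp
    have : staticDensity κ r (trialA r) b (trialF α r) v
      = 4 * b ^ 2 + 2 * ((trialA r ^ 2 - 1) ^ 2 / r ^ 2) + r ^ 2 * v ^ 2 / 2
        + (trialA r ^ 2 * sin (trialF α r) ^ 2) * (1 + 2 * κ * (2 * v ^ 2
          + trialA r ^ 2 * sin (trialF α r) ^ 2 / r ^ 2)) := by
      unfold staticDensity; ring
    rw [this, e]; simp
  have hA0 : ∀ r, 0 ≤ trialA r := fun r => le_max_left _ _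
  have hA1 : ∀ r, trialA r ≤ 1 := fun r => max_le zero_le_one (min_le_left _ _)
  have hb : ((trialA r - trialA r') / h) ^ 2 ≤ 1 := by
    rw [div_pow, div_le_one (by positivity), sq_le_sq, abs_of_pos hh]
    refine (abs_max_sub_max_le_max _ _ _ _).trans ?_
    refine max_le (by simpa using hh.le) ((abs_min_sub_min_le_max _ _ _ _).trans ?_)
    refine max_le (by simpa using hh.le) ?_
    rw [hr', abs_le]; constructor <;> linarith
  have hv : ((trialF α r - trialF α r') / h) ^ 2 ≤ 4 := by
    rw [div_pow, div_le_iff₀ (by positivity), show 4 * h ^ 2 = (2 * h) ^ 2 by ring, sq_le_sq,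
      abs_of_pos (by positivity : 0 < 2 * h), trialF, trialF, ← mul_sub, abs_mul, abs_of_pos hα]
    refine mul_le_mul hα2 ?_ (abs_nonneg _) (by norm_num)
    refine (abs_max_sub_max_le_max _ _ _ _).trans ?_
    refine max_le (by simpa using hh.le) ((abs_min_sub_min_le_max _ _ _ _).trans ?_)
    refine max_le (by simpa using hh.le) ?_
    rw [hr', abs_le]; constructor <;> linarith
  have hr : 0 < r := by linarith
  rw [hform]
  split_ifs with hr1
  · have e1 : ∀ x, x ≤ 1 → trialA x = 1 := fun x hx => by
      rw [trialA, min_eq_left (by linarith), max_eq_right zero_le_one]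
    have e2 : ∀ x, x ≤ 1 → trialF α x = 0 := fun x hx => by
      rw [trialF, max_eq_left ((min_le_right _ _).trans (by linarith)), mul_zero]
    rw [e1 r hr1, e1 r' (by linarith), e2 r hr1, e2 r' (by linarith)]
    simp
  · have h3 : (trialA r ^ 2 - 1) ^ 2 / r ^ 2 ≤ 1 / r ^ 2 := by
      gcongr
      have := hA0 r
      have := hA1 r
      have h5 : trialA r ^ 2 ≤ 1 := by nlinarith
      nlinarith [sq_nonneg (trialA r)]
    rcases le_or_gt r 4 with h4 | h4
    · have h5 : 36 ≤ 36 * 16 / r ^ 2 := by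
        rw [le_div_iff₀ (by positivity)]; nlinarith
      have h6 : r ^ 2 * ((trialF α r - trialF α r') / h) ^ 2 ≤ 16 * 4 := by
        gcongr; nlinarith
      have e : 600 / r ^ 2 = 36 * 16 / r ^ 2 + 24 * (1 / r ^ 2) := by ring
      have : 0 < 1 / r ^ 2 := by positivity
      linarith
    · have e1 : ∀ x, 3 ≤ x → trialA x = 0 := fun x hx => by
        rw [trialA, max_eq_left ((min_le_right _ _).trans (by linarith))]
      have e2 : ∀ x, 3 ≤ x → trialF α x = α := fun x hx => by
        rw [trialF, min_eq_left (by linarith), max_eq_right zero_le_one, mul_one]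
      rw [e1 r (by linarith), e1 r' (by linarith), e2 r (by linarith), e2 r' (by linarith)]
      have : 0 < 1 / r ^ 2 := by positivity
      have e : 600 / r ^ 2 = 600 * (1 / r ^ 2) := by ring
      rw [e, sub_self, sub_self, zero_div]
      have e3 : ((0 : ℝ) ^ 2 - 1) ^ 2 = 1 := by norm_num
      rw [e3]
      nlinarith

theorem discreteEnergy_trial_le {κ α : ℝ} (hα : 0 < α) (hα2 : α ≤ 2) {n : ℕ} (hn : 0 < n) (m : ℕ) :
    discreteEnergy κ (1 / n) m (fun i => trialA (i * (1 / n))) (fun i => trialF α (i * (1 / n)))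
      (fun _ => 0) ≤ 600 * (1 - 1 / max (1 : ℝ) (m * (1 / n))) := by
  have hn' : (0 : ℝ) < n := by exact_mod_cast hn
  have hh : (0 : ℝ) < 1 / n := by positivity
  induction m with
  | zero => simp [discreteEnergy]
  | succ m ih =>
    rw [discreteEnergy_succ]
    have h0 : ∀ i, momentum (1 / (n : ℝ)) (fun i => trialA (i * (1 / n))) (fun _ => 0) i = 0 :=
      fun i => by simp [momentum]
    simp only [h0]
    have h1 : (1 : ℝ) / n ≤ 1 := by
      rw [div_le_one hn']; exact_mod_cast hn
    have := staticDensity_trial_le (κ := κ) (r := ((m + 1 : ℕ) : ℝ) * (1 / n)) (r' := m * (1 / n))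
      hα hα2 hh h1 (by push_cast; ring) (by positivity)
    have h2 := mul_le_mul_of_nonneg_left this hh.le
    simp only [Nat.cast_add, Nat.cast_one] at h2 ⊢
    split_ifs at h2 with hr
    · rw [max_eq_left hr]
      rw [max_eq_left (by linarith)] at ih
      norm_num at ih h2 ⊢
      linarith
    · rw [max_eq_right (by linarith)]
      have hm : n ≤ m := by
        by_contra hlt
        apply hr
        rw [mul_one_div, div_le_one hn']
        exact_mod_cast Nat.lt_of_not_le hlt
      have hm1 : 1 ≤ (m : ℝ) * (1 / n) := by
        rw [mul_one_div, le_div_iff₀ hn', one_mul]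
        exact_mod_cast hm
      rw [max_eq_right hm1] at ih
      have h3 := inv_mul_sub_inv_mul hh (hn.trans_le hm)
      have e : (1 : ℝ) / n * (600 / ((m + 1) * (1 / n)) ^ 2)
        = 600 * (1 / n / ((m + 1) * (1 / n)) ^ 2) := by ring
      rw [e] at h2
      simp only [ne_eq, OfNat.ofNat_ne_zero, not_false_eq_true, zero_pow, zero_div, add_zero]
      linarith

/-- A solution of the discretised dyon equations with mesh `h` on `N` cells, written as a
first-order system. -/
structure DiscreteDyon (κ q α C h : ℝ) (N : ℕ) (a b f X g P c : ℕ → ℝ) : Prop where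
  a_zero : a 0 = 1
  a_nonneg : ∀ i, 0 ≤ a i
  f_zero : f 0 = 0
  f_mem : ∀ i, f i ∈ Icc 0 α
  f_last : f N = α
  g_last : g (N + 1) = q
  P_zero : P 0 = 0
  c_zero : c 0 = 0
  c_le : ∀ i ≤ N, c i ≤ C
  a_succ : ∀ i < N, a (i + 1) = a i + h * b (i + 1)
  b_succ : ∀ i, 0 < i → i < N → b (i + 1) = b i
    + h * forceA κ (i * h) (a i) (f i) (X i / stiffness κ (i * h) (a i) (f i)) (g i)
  f_succ : ∀ i < N, f (i + 1) = f i
    + h * (X (i + 1) / stiffness κ ((i + 1 : ℕ) * h) (a (i + 1)) (f (i + 1)))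
  X_succ : ∀ i, 0 < i → i < N → X (i + 1) = X i
    + h * forceF κ (i * h) (a i) (f i) (X i / stiffness κ (i * h) (a i) (f i))
  g_succ : ∀ i, 0 < i → i ≤ N → g (i + 1) = g i + h * (P i / (i * h) ^ 2)
  P_succ : ∀ i < N, P (i + 1) = P i + h * (2 * a (i + 1) ^ 2 * g (i + 1))
  c_succ : ∀ i < N, c (i + 1) = c i + h * (staticDensity κ ((i + 1 : ℕ) * h) (a (i + 1)) (b (i + 1))
    (f (i + 1)) (X (i + 1) / stiffness κ ((i + 1 : ℕ) * h) (a (i + 1)) (f (i + 1)))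
    + P (i + 1) ^ 2 / ((i + 1 : ℕ) * h) ^ 2 + 2 * a (i + 1) ^ 2 * g (i + 1) ^ 2)

theorem dualField_succ (q h : ℝ) {N i : ℕ} (P : ℕ → ℝ) (hi : 0 < i) (hiN : i ≤ N) :
    dualField q h N P (i + 1) = dualField q h N P i + h * (P i / (i * h) ^ 2) := by
  obtain ⟨k, rfl⟩ := Nat.exists_eq_add_of_lt hi
  rw [zero_add] at *
  have : ∀ j ∈ Finset.range N, (if k + 1 ≤ j + 1 then h * (P (j + 1) / ((j + 1) * h) ^ 2) else 0)
      = (if k + 1 + 1 ≤ j + 1 then h * (P (j + 1) / ((j + 1) * h) ^ 2) else 0)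
        + if j = k then h * (P (k + 1) / ((k + 1) * h) ^ 2) else 0 := by
    intro j _
    by_cases h1 : j = k
    · subst h1; simp
    · by_cases h2 : k + 1 ≤ j + 1
      · rw [if_pos h2, if_pos (by omega), if_neg h1, add_zero]
      · rw [if_neg h2, if_neg (by omega), if_neg h1, add_zero]
  simp only [dualField]
  rw [Finset.sum_congr rfl this, Finset.sum_add_distrib, Finset.sum_ite_eq', if_pos (by simp; omega)]
  push_cast
  ring

theorem dualField_last (q h : ℝ) (N : ℕ) (P : ℕ → ℝ) : dualField q h N P (N + 1) = q := by
  rw [dualField, Finset.sum_eq_zero, sub_zero]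
  intro j hj
  rw [if_neg]
  simp at hj ⊢
  exact hj

theorem exists_discreteDyon {κ q α τ : ℝ} (hκ : 0 < κ) (hα0 : 0 < α) (hα : α ≤ π / 2)
    (hτ0 : 0 < τ) (hτ1 : τ < 1) (hq : (q / α) ^ 2 * π ^ 2 = 2 * τ ^ 2) :
    ∃ C, 0 < C ∧ ∀ n : ℕ, 3 ≤ n → ∃ a b f X g P c,
      DiscreteDyon κ q α C (1 / n) (n * n) a b f X g P c := by
  have hτ : 0 < 1 - τ := by linarith
  refine ⟨600 / (1 - τ), by positivity, fun n hn => ?_⟩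
  set C := 600 / (1 - τ) with hC
  have hC0 : 0 < C := by positivity
  have hn' : (3 : ℝ) ≤ n := by exact_mod_cast hn
  have hn0 : (0 : ℝ) < n := by linarith
  have hα2 : α ≤ 2 := by linarith [pi_le_four]
  have hh : (0 : ℝ) < 1 / n := by positivity
  have hhn : (1 : ℝ) / n * n = 1 := by field_simp
  have hNh : ((n * n : ℕ) : ℝ) * (1 / n) = n := by push_cast; field_simp
  set M := 2 + 2 * C * n with hM
  have hM1 : 1 ≤ M := by
    have : 0 < 2 * C * n := by positivity
    linarith
  have htrial : Box α M (n * n) (fun i => trialA (i * (1 / n)))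
      (fun i => trialF α (i * (1 / n))) (fun _ => 0) := by
    have e1 : max (0 : ℝ) (min 1 (2 - n)) = 0 :=
      max_eq_left ((min_le_right _ _).trans (by linarith))
    have e2 : max (0 : ℝ) (min 1 (n - 2)) = 1 := by
      rw [min_eq_left (by linarith), max_eq_right zero_le_one]
    refine ⟨⟨?_, ?_, ?_, ?_⟩, fun i => ⟨⟨?_, ?_⟩, ⟨?_, ?_⟩, ⟨by linarith, by linarith⟩⟩⟩ <;>
      simp only [hNh, trialA, trialF, e1, e2, Nat.cast_zero, zero_mul]
    · norm_num
    · norm_num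
    · simp
    · exact le_max_left _ _
    · exact (max_le zero_le_one (min_le_left _ _)).trans hM1
    · exact mul_nonneg hα0.le (le_max_left _ _)
    · exact mul_le_of_le_one_right hα0.le (max_le zero_le_one (min_le_left _ _))
  obtain ⟨a, f, s, hbox, hmin⟩ := exists_box_minimizer κ q (1 / n) α M (n * n) ⟨_, _, _, htrial⟩
  have hE : discreteEnergy κ (1 / n) (n * n) a f s ≤ C := by
    have h1 := hmin _ _ _ htrial
    have h2 := discreteEnergy_trial_le (κ := κ) hα0 hα2 (by omega : 0 < n) (n * n)
    have h3 := two_mul_mul_momentum_le hκ hh hα hτ0 hq (n * n) a f s fun i => (hbox.2 i).2.1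
    have e : momentum (1 / (n : ℝ)) (fun i => trialA (i * (1 / n))) (fun _ => 0) (n * n) = 0 := by
      simp [momentum]
    simp only [discreteAction, e] at h1
    rw [hbox.1.2.2.2, div_mul_cancel₀ _ hα0.ne'] at h3
    have h4 : 0 ≤ τ * (1 / n * (momentum (1 / n) a s (n * n) ^ 2 / (((n * n : ℕ) : ℝ) * (1 / n)) ^ 2)) := by
      positivity
    have h5 : 600 * (1 - 1 / max (1 : ℝ) (((n * n : ℕ) : ℝ) * (1 / n))) ≤ 600 := by
      have : 0 ≤ 1 / max (1 : ℝ) (((n * n : ℕ) : ℝ) * (1 / n)) := by positivity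
      linarith
    rw [hC, le_div_iff₀ hτ]
    linarith
  have hstep : ∀ j, discreteEnergy κ (1 / n) j a f s ≤ discreteEnergy κ (1 / n) (j + 1) a f s := by
    intro j
    rw [discreteEnergy_succ]
    have := staticDensity_nonneg hκ ((j + 1) * (1 / n)) (a (j + 1)) ((a (j + 1) - a j) / (1 / n))
      (f (j + 1)) ((f (j + 1) - f j) / (1 / n))
    have : 0 ≤ (1 : ℝ) / n * (staticDensity κ ((j + 1) * (1 / n)) (a (j + 1))
      ((a (j + 1) - a j) / (1 / n)) (f (j + 1)) ((f (j + 1) - f j) / (1 / n)) + s j ^ 2 / 2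
      + momentum (1 / n) a s (j + 1) ^ 2 / ((j + 1) * (1 / n)) ^ 2) := by positivity
    linarith
  have hcle : ∀ i ≤ n * n, discreteEnergy κ (1 / n) i a f s ≤ C := fun i hi =>
    (monotone_nat_of_le_succ hstep hi).trans hE
  have hsM : ∀ k < n * n, |s k| < M := by
    intro k hk
    have h1 := discreteEnergy_succ κ (1 / n) k a f s
    have h2 := hcle (k + 1) hk
    have h3 := discreteEnergy_nonneg hκ hh k a f s
    have h4 := staticDensity_nonneg hκ ((k + 1) * (1 / n)) (a (k + 1)) ((a (k + 1) - a k) / (1 / n))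
      (f (k + 1)) ((f (k + 1) - f k) / (1 / n))
    have h5 : 0 ≤ momentum (1 / n) a s (k + 1) ^ 2 / ((k + 1) * (1 / n)) ^ 2 := by positivity
    have h6 : (1 : ℝ) / n * (s k ^ 2 / 2) ≤ C := by
      have : (1 : ℝ) / n * (s k ^ 2 / 2) ≤ 1 / n * (staticDensity κ ((k + 1) * (1 / n)) (a (k + 1))
          ((a (k + 1) - a k) / (1 / n)) (f (k + 1)) ((f (k + 1) - f k) / (1 / n)) + s k ^ 2 / 2
          + momentum (1 / n) a s (k + 1) ^ 2 / ((k + 1) * (1 / n)) ^ 2) := by gcongr; linarith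
      linarith
    have h7 : s k ^ 2 ≤ 2 * C * n := by
      rw [one_div, inv_mul_le_iff₀ hn0] at h6
      linarith
    refine abs_lt_of_sq_lt_sq ?_ (by linarith)
    have : 0 < 2 * C * n := by positivity
    rw [hM]
    nlinarith
  have haM : ∀ m ≤ n * n, a m < M := by
    intro m hm
    have h1 := sq_sub_le_of_step (x := a) (c := fun j => discreteEnergy κ (1 / n) j a f s)
      (w := fun j => j * (1 / n)) (Nat.zero_le m) (fun j _ _ => hstep j)
      (fun j _ _ => by push_cast; nlinarith) (fun j _ _ => by
        rw [discreteEnergy_succ, add_sub_cancel_left]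
        push_cast
        have e : ((j : ℝ) + 1) * (1 / n) - j * (1 / n) = 1 / n := by ring
        rw [e]
        set b := (a (j + 1) - a j) / (1 / n) with hb
        have e2 : a (j + 1) - a j = 1 / n * b := by rw [hb]; field_simp
        rw [e2]
        have h5 : b ^ 2 ≤ staticDensity κ ((j + 1) * (1 / n)) (a (j + 1)) b (f (j + 1))
          ((f (j + 1) - f j) / (1 / n)) := by
          unfold staticDensity
          have : 0 ≤ 3 * b ^ 2 + 2 * ((a (j + 1) ^ 2 - 1) ^ 2 / ((j + 1) * (1 / n)) ^ 2)
            + (1 / 2) * ((((j : ℝ) + 1) * (1 / n)) ^ 2 * ((f (j + 1) - f j) / (1 / n)) ^ 2 + 2 * a (j + 1) ^ 2 * sin (f (j + 1)) ^ 2)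
            + 2 * κ * a (j + 1) ^ 2 * sin (f (j + 1)) ^ 2 * (2 * ((f (j + 1) - f j) / (1 / n)) ^ 2 + a (j + 1) ^ 2 * sin (f (j + 1)) ^ 2 / ((j + 1) * (1 / n)) ^ 2) := by
              positivity
          linarith
        have h6 : 0 ≤ s j ^ 2 / 2 + momentum (1 / n) a s (j + 1) ^ 2 / ((j + 1) * (1 / n)) ^ 2 := by
          positivity
        calc (1 / n * b) ^ 2 = 1 / n * b ^ 2 * (1 / n) := by ring
          _ ≤ _ := by gcongr; linarith)
    have h2 := h1.2.2
    have h4 : discreteEnergy κ (1 / n) 0 a f s = 0 := by simp [discreteEnergy]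
    simp only [h4, Nat.cast_zero, zero_mul, sub_zero, hbox.1.1] at h2
    have h5 : (m : ℝ) * (1 / n) ≤ n :=
      (mul_le_mul_of_nonneg_right (by exact_mod_cast hm) hh.le).trans hNh.le
    have h6 : (a m - 1) ^ 2 ≤ C * n := h2.trans
      (mul_le_mul (hcle m hm) h5 (by positivity) hC0.le)
    have h7 := abs_lt_of_sq_lt_sq (show (a m - 1) ^ 2 < (1 + C * n) ^ 2 by
      have : 0 < C * n := by positivity
      nlinarith) (by positivity)
    have h8 := (abs_lt.1 h7).2
    have : 0 < C * n := by positivity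
    linarith
  set P := momentum (1 / n) a s with hP
  set g := dualField q (1 / n) (n * n) P with hg
  have hs : ∀ k < n * n, s k = 2 * a (k + 1) * g (k + 1) := fun k hk =>
    dual_stationary hh hbox hmin k hk (hsM k hk)
  have hX : ∀ k : ℕ, stiffness κ ((k + 1 : ℕ) * (1 / n)) (a (k + 1)) (f (k + 1))
      * ((f (k + 1) - f k) / (1 / n)) / stiffness κ ((k + 1 : ℕ) * (1 / n)) (a (k + 1)) (f (k + 1))
      = (f (k + 1) - f k) / (1 / n) := fun k =>
    mul_div_cancel_left₀ _ (stiffness_pos hκ (by positivity) _ _).ne'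
  refine ⟨a, fun i => (a i - a (i - 1)) / (1 / n), f,
    fun i => stiffness κ (i * (1 / n)) (a i) (f i) * ((f i - f (i - 1)) / (1 / n)), g, P,
    fun i => discreteEnergy κ (1 / n) i a f s, ?_⟩
  constructor
  · exact hbox.1.1
  · exact fun i => (hbox.2 i).1.1
  · exact hbox.1.2.2.1
  · exact fun i => (hbox.2 i).2.1
  · exact hbox.1.2.2.2
  · exact dualField_last _ _ _ _
  · exact momentum_zero _ _ _
  · simp [discreteEnergy]
  · exact hcle
  · intro i hi
    simp only [add_tsub_cancel_right]
    field_simp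
    ring
  · intro i hi0 hi
    obtain ⟨k, rfl⟩ := Nat.exists_eq_add_of_lt hi0
    simp only [zero_add, add_tsub_cancel_right] at hi ⊢
    rw [hX]
    have := a_stationary hh hbox hmin k hi (haM _ hi.le) (hs k (by omega))
    push_cast
    exact this
  · intro i hi
    simp only [add_tsub_cancel_right]
    rw [hX]
    field_simp
    ring
  · intro i hi0 hi
    obtain ⟨k, rfl⟩ := Nat.exists_eq_add_of_lt hi0
    simp only [zero_add, add_tsub_cancel_right] at hi ⊢
    rw [hX]
    have := f_stationary hκ hh hα hα0 hbox hmin k hi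
    push_cast
    exact this
  · intro i hi0 hi
    exact dualField_succ _ _ _ hi0 hi
  · intro i hi
    rw [hP, momentum_succ, hs i hi]
    ring
  · intro i hi
    simp only [add_tsub_cancel_right]
    rw [discreteEnergy_succ, hX, hs i hi]
    push_cast
    ring

theorem abs_forceA_le {κ r a f v g A K V q : ℝ} (hκ : 0 < κ) (hr : 0 < r) (ha : 0 ≤ a) (haA : a ≤ A)
    (hK : 1 / r ^ 2 ≤ K) (hv : v ^ 2 ≤ V) (hg0 : 0 ≤ g) (hg : g ≤ q) :
    |forceA κ r a f v g| ≤ A ^ 3 * K + (1 / 4) * A + κ * A * V + κ * A ^ 3 * K + A * K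
      + A * q ^ 2 / 2 := by
  have hA : 0 ≤ A := ha.trans haA
  have hr2 : 0 < 1 / r ^ 2 := by positivity
  have hV : 0 ≤ V := (sq_nonneg v).trans hv
  have hs0 := sq_nonneg (sin f)
  have hs1 := sin_sq_le_one f
  have hs2 : sin f ^ 4 ≤ 1 := by
    rw [show sin f ^ 4 = (sin f ^ 2) ^ 2 by ring]
    exact pow_le_one₀ hs0 hs1
  have hs4 : 0 ≤ sin f ^ 4 := by positivity
  have e1 : a ^ 3 * (1 / r ^ 2) ≤ A ^ 3 * K := by gcongr
  have e2 : a * sin f ^ 2 ≤ A * 1 := by gcongr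
  have e3 : κ * a * sin f ^ 2 * v ^ 2 ≤ κ * A * 1 * V := by gcongr
  have e4 : κ * a ^ 3 * sin f ^ 4 * (1 / r ^ 2) ≤ κ * A ^ 3 * 1 * K := by gcongr
  have e5 : a * (1 / r ^ 2) ≤ A * K := by gcongr
  have e6 : a * g ^ 2 ≤ A * q ^ 2 := by gcongr
  have p1 : 0 ≤ a ^ 3 * (1 / r ^ 2) := by positivity
  have p2 : 0 ≤ a * sin f ^ 2 := by positivity
  have p3 : 0 ≤ κ * a * sin f ^ 2 * v ^ 2 := by positivity
  have p4 : 0 ≤ κ * a ^ 3 * sin f ^ 4 * (1 / r ^ 2) := by positivity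
  have p5 : 0 ≤ a * (1 / r ^ 2) := by positivity
  have p6 : 0 ≤ a * g ^ 2 := by positivity
  have e : forceA κ r a f v g = a ^ 3 * (1 / r ^ 2) - a * (1 / r ^ 2) + (1 / 4) * (a * sin f ^ 2)
      + κ * a * sin f ^ 2 * v ^ 2 + κ * a ^ 3 * sin f ^ 4 * (1 / r ^ 2) - a * g ^ 2 / 2 := by
    unfold forceA; ring
  rw [e, abs_le]
  constructor <;> linarith

theorem cos_sub_cos_mem {x y : ℝ} (hx : 0 ≤ x) (hxy : x ≤ y) (hy : y ≤ π / 2) :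
    cos x - cos y ∈ Icc 0 (sin y * (y - x)) := by
  have h1 : cos x - cos y = 2 * sin ((x + y) / 2) * sin ((y - x) / 2) := by
    rw [cos_sub_cos, show (x - y) / 2 = -((y - x) / 2) by ring, sin_neg]; ring
  have h2 : sin ((x + y) / 2) ≤ sin y :=
    sin_le_sin_of_le_of_le_pi_div_two (by linarith [pi_pos]) hy (by linarith)
  have h3 : sin ((y - x) / 2) ≤ (y - x) / 2 := sin_le (by linarith)
  have h4 : 0 ≤ sin ((x + y) / 2) :=
    sin_nonneg_of_nonneg_of_le_pi (by linarith) (by linarith [pi_pos])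
  have h5 : 0 ≤ sin ((y - x) / 2) :=
    sin_nonneg_of_nonneg_of_le_pi (by linarith) (by linarith [pi_pos])
  rw [h1]
  refine ⟨by positivity, ?_⟩
  have := mul_le_mul h2 h3 h5 (h4.trans h2)
  linarith

namespace DiscreteDyon

variable {κ q α C h : ℝ} {N : ℕ} {a b f X g P c : ℕ → ℝ}

theorem energy_terms_le (D : DiscreteDyon κ q α C h N a b f X g P c) (hκ : 0 < κ) (hh : 0 < h)
    {i : ℕ} (hi : i < N) :
    4 * (a (i + 1) - a i) ^ 2 + 1 / 2 * (((i + 1 : ℕ) * h) ^ 2 * (f (i + 1) - f i) ^ 2)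
      + 4 * κ * a (i + 1) ^ 2 * sin (f (i + 1)) ^ 2 * (f (i + 1) - f i) ^ 2
      + h ^ 2 * (P (i + 1) ^ 2 / ((i + 1 : ℕ) * h) ^ 2) ≤ (c (i + 1) - c i) * h := by
  have e1 : a (i + 1) - a i = h * b (i + 1) := by rw [D.a_succ i hi]; ring
  have e2 := D.f_succ i hi
  rw [D.c_succ i hi]
  set v := X (i + 1) / stiffness κ ((i + 1 : ℕ) * h) (a (i + 1)) (f (i + 1))
  have e2 : f (i + 1) - f i = h * v := by rw [e2]; ring
  rw [e1, e2]
  unfold staticDensity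
  have : 0 ≤ h ^ 2 * (2 * ((a (i + 1) ^ 2 - 1) ^ 2 / ((i + 1 : ℕ) * h) ^ 2)
    + a (i + 1) ^ 2 * sin (f (i + 1)) ^ 2
    + 2 * κ * a (i + 1) ^ 2 * sin (f (i + 1)) ^ 2
      * (a (i + 1) ^ 2 * sin (f (i + 1)) ^ 2 / ((i + 1 : ℕ) * h) ^ 2)
    + 2 * a (i + 1) ^ 2 * g (i + 1) ^ 2) := by positivity
  nlinarith

theorem c_le_succ (D : DiscreteDyon κ q α C h N a b f X g P c) (hκ : 0 < κ) (hh : 0 < h)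
    {i : ℕ} (hi : i < N) : c i ≤ c (i + 1) := by
  have h1 := D.energy_terms_le hκ hh hi
  have h2 : 0 ≤ 4 * (a (i + 1) - a i) ^ 2 + 1 / 2 * (((i + 1 : ℕ) * h) ^ 2 * (f (i + 1) - f i) ^ 2)
      + 4 * κ * a (i + 1) ^ 2 * sin (f (i + 1)) ^ 2 * (f (i + 1) - f i) ^ 2
      + h ^ 2 * (P (i + 1) ^ 2 / ((i + 1 : ℕ) * h) ^ 2) := by positivity
  exact sub_nonneg.1 ((mul_nonneg_iff_of_pos_right hh).1 (h2.trans h1))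

theorem c_mono (D : DiscreteDyon κ q α C h N a b f X g P c) (hκ : 0 < κ) (hh : 0 < h)
    {i j : ℕ} (hij : i ≤ j) (hj : j ≤ N) : c i ≤ c j := by
  induction j, hij using Nat.le_induction with
  | base => exact le_rfl
  | succ m him ih => exact (ih (by omega)).trans (D.c_le_succ hκ hh (by omega))

theorem c_nonneg (D : DiscreteDyon κ q α C h N a b f X g P c) (hκ : 0 < κ) (hh : 0 < h)
    {i : ℕ} (hi : i ≤ N) : 0 ≤ c i := by
  simpa [D.c_zero] using D.c_mono hκ hh (Nat.zero_le i) hi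

theorem sq_a_sub_one_le (D : DiscreteDyon κ q α C h N a b f X g P c) (hκ : 0 < κ) (hh : 0 < h)
    {i : ℕ} (hi : i ≤ N) : (a i - 1) ^ 2 ≤ C * (i * h) := by
  have h1 := (sq_sub_le_of_step (x := a) (c := c) (w := fun j => j * h) (Nat.zero_le i)
    (fun j _ hj => D.c_le_succ hκ hh (by omega))
    (fun j _ _ => by push_cast; nlinarith) (fun j _ hj => by
      have h1 := D.energy_terms_le hκ hh (by omega : j < N)
      have h2 : 0 ≤ 3 * (a (j + 1) - a j) ^ 2 + 1 / 2 * (((j + 1 : ℕ) * h) ^ 2 * (f (j + 1) - f j) ^ 2)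
        + 4 * κ * a (j + 1) ^ 2 * sin (f (j + 1)) ^ 2 * (f (j + 1) - f j) ^ 2
        + h ^ 2 * (P (j + 1) ^ 2 / ((j + 1 : ℕ) * h) ^ 2) := by positivity
      have e : ((j + 1 : ℕ) : ℝ) * h - j * h = h := by push_cast; ring
      rw [e]
      linarith)).2.2
  simp only [D.a_zero, D.c_zero, Nat.cast_zero, zero_mul, sub_zero] at h1
  exact h1.trans (mul_le_mul_of_nonneg_right (D.c_le i hi) (by positivity))

theorem X_nonneg (D : DiscreteDyon κ q α C h N a b f X g P c) (hκ : 0 < κ) (hh : 0 < h)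
    (hα : α ≤ π / 2) (hN : 0 < N) {i : ℕ} (hi0 : 0 < i) (hi : i ≤ N) : 0 ≤ X i := by
  induction i, hi0 using Nat.le_induction with
  | base =>
    have h1 := D.f_succ 0 hN
    rw [D.f_zero, zero_add] at h1
    have h2 := (D.f_mem 1).1
    have hs := stiffness_pos hκ (r := ((0 + 1 : ℕ) : ℝ) * h) (by positivity) (a (0 + 1)) (f (0 + 1))
    rw [zero_add] at *
    rw [h1] at h2
    have h3 := (mul_nonneg_iff_of_pos_left hh).1 h2
    rw [le_div_iff₀ hs, zero_mul] at h3
    exact h3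
  | succ m hm ih =>
    rw [D.X_succ m hm (by omega)]
    exact add_nonneg (ih (by omega)) (mul_nonneg hh.le (forceF_nonneg hκ hα (D.f_mem m)))

theorem X_mono (D : DiscreteDyon κ q α C h N a b f X g P c) (hκ : 0 < κ) (hh : 0 < h)
    (hα : α ≤ π / 2) {i j : ℕ} (hi0 : 0 < i) (hij : i ≤ j) (hj : j ≤ N) : X i ≤ X j := by
  induction j, hij using Nat.le_induction with
  | base => exact le_rfl
  | succ m him ih =>
    rw [D.X_succ m (by omega) (by omega)]
    have := mul_nonneg hh.le (forceF_nonneg hκ hα (D.f_mem m) (r := m * h) (x := a m)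
      (v := X m / stiffness κ (m * h) (a m) (f m)))
    linarith [ih (by omega)]

theorem f_le_succ (D : DiscreteDyon κ q α C h N a b f X g P c) (hκ : 0 < κ) (hh : 0 < h)
    (hα : α ≤ π / 2) {i : ℕ} (hi : i < N) : f i ≤ f (i + 1) := by
  rw [D.f_succ i hi]
  have h1 := D.X_nonneg hκ hh hα (by omega) i.succ_pos hi
  have := stiffness_pos hκ (r := ((i + 1 : ℕ) : ℝ) * h) (by positivity) (a (i + 1)) (f (i + 1))
  have : 0 ≤ h * (X (i + 1) / stiffness κ ((i + 1 : ℕ) * h) (a (i + 1)) (f (i + 1))) := by positivity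
  linarith

theorem sq_one_sub_cos_le (D : DiscreteDyon κ q α C h N a b f X g P c) (hκ : 0 < κ) (hh : 0 < h)
    (hα : α ≤ π / 2) {i : ℕ} (hi : i ≤ N) (hC : 0 < C) (hCi : C * (i * h) ≤ 1 / 4) :
    (1 - cos (f i)) ^ 2 ≤ C * (i * h) / κ := by
  have h1 := (sq_sub_le_of_step (x := fun j => cos (f j)) (c := c) (w := fun j => j * h / κ)
    (Nat.zero_le i) (fun j _ hj => D.c_le_succ hκ hh (by omega))
    (fun j _ _ => by push_cast; gcongr; linarith) (fun j _ hj => by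
      have h1 := D.energy_terms_le hκ hh (by omega : j < N)
      have h3 := cos_sub_cos_mem (D.f_mem j).1 (D.f_le_succ hκ hh hα (by omega : j < N))
        ((D.f_mem _).2.trans hα)
      have h4 : (cos (f (j + 1)) - cos (f j)) ^ 2
          ≤ sin (f (j + 1)) ^ 2 * (f (j + 1) - f j) ^ 2 := by
        rw [← mul_pow, ← neg_sq, neg_sub]
        exact pow_le_pow_left₀ h3.1 h3.2 2
      have h5 : (1 : ℝ) / 2 ≤ a (j + 1) := by
        have h6 := D.sq_a_sub_one_le hκ hh (by omega : j + 1 ≤ N)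
        have h7 : C * ((j + 1 : ℕ) * h) ≤ C * (i * h) := by
          gcongr
          exact hj
        have h8 := abs_le_of_sq_le_sq' (show (a (j + 1) - 1) ^ 2 ≤ (1 / 2) ^ 2 by
          linarith) (by norm_num)
        linarith [h8.1]
      have h6 : 1 ≤ 4 * a (j + 1) ^ 2 := by nlinarith
      have h7 : 0 ≤ 4 * (a (j + 1) - a j) ^ 2 + 1 / 2 * (((j + 1 : ℕ) * h) ^ 2 * (f (j + 1) - f j) ^ 2)
        + h ^ 2 * (P (j + 1) ^ 2 / ((j + 1 : ℕ) * h) ^ 2) := by positivity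
      have e : ((j + 1 : ℕ) : ℝ) * h / κ - j * h / κ = h / κ := by push_cast; ring
      rw [e, mul_div_assoc', le_div_iff₀ hκ]
      have h8 : 1 * (κ * (sin (f (j + 1)) ^ 2 * (f (j + 1) - f j) ^ 2))
        ≤ 4 * a (j + 1) ^ 2 * (κ * (sin (f (j + 1)) ^ 2 * (f (j + 1) - f j) ^ 2)) := by gcongr
      have h9 := mul_le_mul_of_nonneg_right h4 hκ.le
      linarith)).2.2
  simp only [D.f_zero, cos_zero, D.c_zero, Nat.cast_zero, zero_mul, zero_div, sub_zero] at h1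
  rw [show (1 - cos (f i)) ^ 2 = (cos (f i) - 1) ^ 2 by ring, mul_div_assoc]
  exact h1.trans (mul_le_mul_of_nonneg_right (D.c_le i hi) (by positivity))

theorem sq_sub_f_le (D : DiscreteDyon κ q α C h N a b f X g P c) (hκ : 0 < κ) (hh : 0 < h)
    {i : ℕ} (hi0 : 0 < i) (hi : i ≤ N) : (α - f i) ^ 2 ≤ 2 * C / (i * h) := by
  have hw : ∀ j : ℕ, i ≤ j → 2 * (h / (((j + 1 : ℕ) : ℝ) * h) ^ 2)
      ≤ -(2 / (((j + 1 : ℕ) : ℝ) * h)) - -(2 / (j * h)) := fun j hj => by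
    have := inv_mul_sub_inv_mul hh (hi0.trans_le hj)
    push_cast
    have e : ∀ x : ℝ, 2 / x = 2 * (1 / x) := fun x => by ring
    rw [e (_ * _), e (_ * _)]
    linarith
  have h1 := (sq_sub_le_of_step (x := f) (c := c) (w := fun j => -(2 / (j * h))) hi
    (fun j _ hj => D.c_le_succ hκ hh hj)
    (fun j hj _ => by
      have := hw j hj
      have h2 : 0 ≤ 2 * (h / (((j + 1 : ℕ) : ℝ) * h) ^ 2) := by positivity
      linarith) (fun j hij hj => by
      have h1 := D.energy_terms_le hκ hh hj
      have h2 : 0 ≤ 4 * (a (j + 1) - a j) ^ 2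
        + 4 * κ * a (j + 1) ^ 2 * sin (f (j + 1)) ^ 2 * (f (j + 1) - f j) ^ 2
        + h ^ 2 * (P (j + 1) ^ 2 / ((j + 1 : ℕ) * h) ^ 2) := by positivity
      refine le_trans ?_ (mul_le_mul_of_nonneg_left (hw j hij)
        (sub_nonneg.2 (D.c_le_succ hκ hh hj)))
      rw [show (c (j + 1) - c j) * (2 * (h / (((j + 1 : ℕ) : ℝ) * h) ^ 2))
        = 2 * ((c (j + 1) - c j) * h) / (((j + 1 : ℕ) : ℝ) * h) ^ 2 by ring,
        le_div_iff₀ (by positivity)]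
      linarith)).2.2
  rw [D.f_last] at h1
  have h2 : 0 ≤ 2 / ((N : ℝ) * h) := by positivity
  have h3 : 0 < (i : ℝ) * h := by positivity
  have h4 := D.c_nonneg hκ hh hi
  have h5 := D.c_le N le_rfl
  have h6 := D.c_mono hκ hh hi le_rfl
  calc (α - f i) ^ 2 ≤ _ := h1
    _ ≤ C * (2 / (i * h)) := by
      apply mul_le_mul
      · linarith
      · linarith
      · have : 0 < N := by omega
        have : 2 / ((N : ℝ) * h) ≤ 2 / (i * h) := by gcongr
        linarith
      · linarith
    _ = _ := by ring

theorem g_pos_aux (D : DiscreteDyon κ q α C h N a b f X g P c) (hh : 0 < h) (hg : g 1 < 0)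
    {i : ℕ} (hi0 : 0 < i) (hi : i ≤ N) : g i < 0 ∧ P i ≤ 0 := by
  have step : ∀ m < N, P m ≤ 0 → g (m + 1) < 0 → P (m + 1) ≤ 0 := fun m hm h1 h2 => by
    rw [D.P_succ m hm]
    have : h * (2 * a (m + 1) ^ 2 * g (m + 1)) ≤ 0 :=
      mul_nonpos_of_nonneg_of_nonpos hh.le
        (mul_nonpos_of_nonneg_of_nonpos (by positivity) h2.le)
    linarith
  induction i, hi0 using Nat.le_induction with
  | base => exact ⟨hg, step 0 (by omega) D.P_zero.le hg⟩
  | succ m hm ih =>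
    obtain ⟨h1, h2⟩ := ih (by omega)
    have h3 : g (m + 1) < 0 := by
      rw [D.g_succ m hm (by omega)]
      have : h * (P m / (m * h) ^ 2) ≤ 0 :=
        mul_nonpos_of_nonneg_of_nonpos hh.le (div_nonpos_of_nonpos_of_nonneg h2 (sq_nonneg _))
      linarith
    exact ⟨h3, step m (by omega) h2 h3⟩

theorem g_nonneg (D : DiscreteDyon κ q α C h N a b f X g P c) (hh : 0 < h) (hq : 0 < q)
    (hN : 0 < N) {i : ℕ} (hi0 : 0 < i) (hi : i ≤ N) : 0 ≤ g i ∧ 0 ≤ P i := by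
  have hg1 : 0 ≤ g 1 := by
    by_contra hlt
    obtain ⟨h1, h2⟩ := D.g_pos_aux hh (not_le.1 hlt) hN le_rfl
    have h3 := D.g_succ N hN le_rfl
    have : h * (P N / (N * h) ^ 2) ≤ 0 :=
      mul_nonpos_of_nonneg_of_nonpos hh.le (div_nonpos_of_nonpos_of_nonneg h2 (sq_nonneg _))
    rw [D.g_last] at h3
    linarith
  have step : ∀ m < N, 0 ≤ P m → 0 ≤ g (m + 1) → 0 ≤ P (m + 1) := fun m hm h1 h2 => by
    rw [D.P_succ m hm]
    positivity
  induction i, hi0 using Nat.le_induction with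
  | base => exact ⟨hg1, step 0 (by omega) D.P_zero.ge hg1⟩
  | succ m hm ih =>
    obtain ⟨h1, h2⟩ := ih (by omega)
    have h3 : 0 ≤ g (m + 1) := by
      rw [D.g_succ m hm (by omega)]
      positivity
    exact ⟨h3, step m (by omega) h2 h3⟩

theorem g_le_last (D : DiscreteDyon κ q α C h N a b f X g P c) (hh : 0 < h) (hq : 0 < q)
    (hN : 0 < N) {i : ℕ} (hi0 : 0 < i) (hi : i ≤ N) : g i ≤ q := by
  have : ∀ j, i ≤ j → j ≤ N + 1 → g i ≤ g j := fun j hij => by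
    induction j, hij using Nat.le_induction with
    | base => exact fun _ => le_rfl
    | succ m hm ih =>
      intro hmN
      rw [D.g_succ m (by omega) (by omega)]
      have h1 := (D.g_nonneg hh hq hN (by omega : 0 < m) (by omega)).2
      have : 0 ≤ h * (P m / (m * h) ^ 2) := by positivity
      linarith [ih (by omega)]
  rw [← D.g_last]
  exact this _ (by omega) le_rfl

theorem sq_sub_g_le (D : DiscreteDyon κ q α C h N a b f X g P c) (hκ : 0 < κ) (hh : 0 < h)
    {i : ℕ} (hi0 : 0 < i) (hi : i ≤ N) : (q - g (i + 1)) ^ 2 ≤ C / (i * h) := by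
  have hw : ∀ j : ℕ, i ≤ j → h / (((j + 1 : ℕ) : ℝ) * h) ^ 2
      ≤ -(1 / (((j + 1 : ℕ) : ℝ) * h)) - -(1 / (j * h)) := fun j hj => by
    have := inv_mul_sub_inv_mul hh (hi0.trans_le hj)
    push_cast
    linarith
  have h1 := (sq_sub_le_of_step (x := fun j => g (j + 1)) (c := c) (w := fun j => -(1 / (j * h))) hi
    (fun j _ hj => D.c_le_succ hκ hh hj)
    (fun j hj _ => by
      have := hw j hj
      have h2 : 0 ≤ h / (((j + 1 : ℕ) : ℝ) * h) ^ 2 := by positivity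
      linarith) (fun j hij hj => by
      have h1 := D.energy_terms_le hκ hh hj
      have h2 : 0 ≤ 4 * (a (j + 1) - a j) ^ 2
        + 1 / 2 * (((j + 1 : ℕ) * h) ^ 2 * (f (j + 1) - f j) ^ 2)
        + 4 * κ * a (j + 1) ^ 2 * sin (f (j + 1)) ^ 2 * (f (j + 1) - f j) ^ 2 := by positivity
      refine le_trans ?_ (mul_le_mul_of_nonneg_left (hw j hij)
        (sub_nonneg.2 (D.c_le_succ hκ hh hj)))
      rw [D.g_succ (j + 1) (by omega) (by omega), add_sub_cancel_left, ← mul_div_assoc (c (j + 1) - c j),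
        le_div_iff₀ (by positivity)]
      have e : (h * (P (j + 1) / (((j + 1 : ℕ) : ℝ) * h) ^ 2)) ^ 2 * (((j + 1 : ℕ) : ℝ) * h) ^ 2
        = h ^ 2 * (P (j + 1) ^ 2 / (((j + 1 : ℕ) : ℝ) * h) ^ 2) := by
        field_simp
      rw [e]
      linarith)).2.2
  rw [D.g_last] at h1
  have h2 : 0 ≤ 1 / ((N : ℝ) * h) := by positivity
  have h3 : 0 < (i : ℝ) * h := by positivity
  have h4 := D.c_nonneg hκ hh hi
  have h5 := D.c_le N le_rfl
  have h6 := D.c_mono hκ hh hi le_rfl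
  calc (q - g (i + 1)) ^ 2 ≤ _ := h1
    _ ≤ C * (1 / (i * h)) := by
      apply mul_le_mul
      · linarith
      · linarith
      · have : 0 < N := by omega
        have : 1 / ((N : ℝ) * h) ≤ 1 / (i * h) := by gcongr
        linarith
      · linarith
    _ = _ := by ring

theorem a_le (D : DiscreteDyon κ q α C h N a b f X g P c) (hκ : 0 < κ) (hh : 0 < h) (hC : 0 < C)
    {R : ℝ} {i : ℕ} (hi : i ≤ N) (hR : i * h ≤ R) : a i ≤ 2 + C * R := by
  have h1 := D.sq_a_sub_one_le hκ hh hi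
  have h2 : C * (i * h) ≤ C * R := by gcongr
  have h3 : 0 ≤ C * R := le_trans (by positivity) h2
  have := abs_le_of_sq_le_sq' (show (a i - 1) ^ 2 ≤ (1 + C * R) ^ 2 by nlinarith) (by linarith)
  linarith [this.2]

theorem P_le (D : DiscreteDyon κ q α C h N a b f X g P c) (hκ : 0 < κ) (hh : 0 < h) (hC : 0 < C)
    (hq : 0 < q) {R : ℝ} {i : ℕ} (hi : i ≤ N) (hR : i * h ≤ R) :
    P i ≤ 2 * (2 + C * R) ^ 2 * q * (i * h) := by
  induction i with
  | zero => simp [D.P_zero]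
  | succ m ih =>
    rw [D.P_succ m (by omega)]
    have h0 : (m : ℝ) * h ≤ R := le_trans (by push_cast; nlinarith) hR
    have h1 := ih (by omega) h0
    have h2 := D.a_le hκ hh hC hi hR
    have h3 := D.a_nonneg (m + 1)
    have h4 := (D.g_nonneg hh hq (by omega) m.succ_pos hi).1
    have h5 := D.g_le_last hh hq (by omega) m.succ_pos hi
    have : h * (2 * a (m + 1) ^ 2 * g (m + 1)) ≤ h * (2 * (2 + C * R) ^ 2 * q) := by gcongr
    push_cast
    linarith

theorem X_le (D : DiscreteDyon κ q α C h N a b f X g P c) (hκ : 0 < κ) (hh : 0 < h) (hC : 0 < C)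
    (hα : α ≤ π / 2) {R : ℝ} {i n : ℕ} (hi0 : 0 < i) (hi : i + n ≤ N) (hR : (i + n : ℕ) * h ≤ R)
    (hn : n * h = 1) : X i ≤ α * (8 * κ * (2 + C * R) ^ 2 + R ^ 2) := by
  set B := 8 * κ * (2 + C * R) ^ 2 + R ^ 2 with hB
  have hR0 : 0 < R := lt_of_lt_of_le (by positivity) hR
  have hB0 : 0 < B := by positivity
  have hX0 := D.X_nonneg hκ hh hα (by omega) hi0 (by omega)
  have key : ∀ m ≤ n, m * h * (X i / B) ≤ f (i + m) - f i := by
    intro m hm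
    induction m with
    | zero => simp
    | succ m ih =>
      have h1 := ih (by omega)
      have hr : ((i + m + 1 : ℕ) : ℝ) * h ≤ R :=
        (mul_le_mul_of_nonneg_right (by exact_mod_cast (by omega : i + m + 1 ≤ i + n)) hh.le).trans hR
      have h2 := D.a_le hκ hh hC (by omega : i + m + 1 ≤ N) hr
      have h3 := D.a_nonneg (i + m + 1)
      have h4 : stiffness κ ((i + m + 1 : ℕ) * h) (a (i + m + 1)) (f (i + m + 1)) ≤ B := by
        rw [hB, stiffness]
        have : a (i + m + 1) ^ 2 * sin (f (i + m + 1)) ^ 2 ≤ (2 + C * R) ^ 2 * 1 := by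
          gcongr
          exact sin_sq_le_one _
        rw [mul_one] at this
        gcongr
      have h5 := stiffness_pos hκ (r := ((i + m + 1 : ℕ) : ℝ) * h) (by positivity)
        (a (i + m + 1)) (f (i + m + 1))
      have h6 := D.X_mono hκ hh hα hi0 (by omega : i ≤ i + m + 1) (by omega)
      have h7 : h * (X i / B) ≤ h * (X (i + m + 1) / stiffness κ ((i + m + 1 : ℕ) * h)
        (a (i + m + 1)) (f (i + m + 1))) := by
        have := hX0.trans h6
        gcongr
      rw [← add_assoc, D.f_succ (i + m) (by omega)]
      push_cast at h7 ⊢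
      linarith
  have h1 := key n le_rfl
  have h2 := (D.f_mem (i + n)).2
  have h3 := (D.f_mem i).1
  rw [hn, one_mul] at h1
  rw [← div_le_iff₀ hB0]
  linarith

theorem abs_b_le (D : DiscreteDyon κ q α C h N a b f X g P c) (hκ : 0 < κ) (hh : 0 < h) (hC : 0 < C)
    {R L : ℝ} {i n : ℕ} (hi0 : 0 < i) (hi : i + n ≤ N) (hR : (i + n : ℕ) * h ≤ R)
    (hn : n * h = 1) (hL0 : 0 ≤ L) (hL : ∀ j, i ≤ j → j < i + n →
      |forceA κ (j * h) (a j) (f j) (X j / stiffness κ (j * h) (a j) (f j)) (g j)| ≤ L) :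
    |b i| ≤ 2 + C * R + L := by
  have key : ∀ m ≤ n, |b (i + m) - b i| ≤ m * h * L := by
    intro m hm
    induction m with
    | zero => simp
    | succ m ih =>
      have h1 := ih (by omega)
      have h2 := hL (i + m) (by omega) (by omega)
      rw [← add_assoc, D.b_succ (i + m) (by omega) (by omega)]
      set F := forceA κ ((i + m : ℕ) * h) (a (i + m)) (f (i + m))
        (X (i + m) / stiffness κ ((i + m : ℕ) * h) (a (i + m)) (f (i + m))) (g (i + m))
      rw [abs_le] at *
      push_cast
      constructor <;> nlinarith
  have key2 : ∀ m ≤ n, |a (i + m) - a i - m * h * b i| ≤ m * h * L := by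
    intro m hm
    induction m with
    | zero => simp
    | succ m ih =>
      have h1 := ih (by omega)
      have h2 := key (m + 1) hm
      have h3 : ((m + 1 : ℕ) : ℝ) * h ≤ 1 := by
        rw [← hn]
        gcongr
      have h4 : |b (i + m + 1) - b i| ≤ L :=
        h2.trans (mul_le_of_le_one_left hL0 h3)
      rw [← add_assoc, D.a_succ (i + m) (by omega)]
      rw [abs_le] at *
      push_cast
      constructor <;> nlinarith
  have h1 := key2 n le_rfl
  rw [hn, one_mul, one_mul] at h1
  have h2 := D.a_le hκ hh hC hi hR
  have h3 := D.a_le hκ hh hC (R := R) (by omega : i ≤ N) (le_trans (by gcongr; omega) hR)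
  have h4 := D.a_nonneg i
  have h5 := D.a_nonneg (i + n)
  rw [abs_le] at *
  constructor <;> linarith

end DiscreteDyon

/-- The right-hand side of the dyon equations written as a first-order system for
`(a, a', f, stiffness * f', g, r² g', energy)`. -/
def dyonField (κ r : ℝ) (y : Fin 7 → ℝ) : Fin 7 → ℝ :=
  ![y 1, forceA κ r (y 0) (y 2) (y 3 / stiffness κ r (y 0) (y 2)) (y 4),
    y 3 / stiffness κ r (y 0) (y 2), forceF κ r (y 0) (y 2) (y 3 / stiffness κ r (y 0) (y 2)),
    y 5 / r ^ 2, 2 * y 0 ^ 2 * y 4,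
    staticDensity κ r (y 0) (y 1) (y 2) (y 3 / stiffness κ r (y 0) (y 2)) + y 5 ^ 2 / r ^ 2
      + 2 * y 0 ^ 2 * y 4 ^ 2]

theorem continuousOn_dyonField {κ : ℝ} (hκ : 0 < κ) :
    ContinuousOn (fun x : ℝ × (Fin 7 → ℝ) => dyonField κ x.1 x.2) (Ioi 0 ×ˢ univ) := by
  intro x hx
  refine ContinuousAt.continuousWithinAt ?_
  have hr : x.1 ≠ 0 := ne_of_gt hx.1
  have hs : stiffness κ x.1 (x.2 0) (x.2 2) ≠ 0 := (stiffness_pos hκ hx.1 _ _).ne'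
  have hv : ContinuousAt (fun x : ℝ × (Fin 7 → ℝ) => x.2 3 / stiffness κ x.1 (x.2 0) (x.2 2)) x := by
    refine ContinuousAt.div (by fun_prop) ?_ hs
    unfold stiffness
    fun_prop
  refine continuousAt_pi.2 fun c => ?_
  fin_cases c <;> simp [dyonField]
  · fun_prop
  · unfold forceA
    fun_prop (disch := positivity)
  · exact hv
  · unfold forceF
    fun_prop (disch := positivity)
  · fun_prop (disch := positivity)
  · fun_prop
  · unfold staticDensity
    fun_prop (disch := positivity)

namespace DiscreteDyon

variable {κ q α C h : ℝ} {N : ℕ}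

/-- Discrete solutions follow a mixed forward and backward Euler scheme for `dyonField`. -/
theorem step_eq {y : Fin 7 → ℕ → ℝ}
    (D : DiscreteDyon κ q α C h N (y 0) (y 1) (y 2) (y 3) (y 4) (y 5) (y 6))
    {i : ℕ} (hi0 : 0 < i) (hi : i < N) (m : Fin 7) :
    y m (i + 1) - y m i = h * dyonField κ ((i + (![1, 0, 1, 0, 0, 1, 1] : Fin 7 → ℕ) m : ℕ) * h)
      (fun l => y l (i + (![1, 0, 1, 0, 0, 1, 1] : Fin 7 → ℕ) m)) m := by
  rw [sub_eq_iff_eq_add']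
  fin_cases m
  · exact D.a_succ i hi
  · exact D.b_succ i hi0 hi
  · exact D.f_succ i hi
  · exact D.X_succ i hi0 hi
  · exact D.g_succ i hi0 hi.le
  · exact D.P_succ i hi
  · exact D.c_succ i hi

theorem exists_bound (hκ : 0 < κ) (hC : 0 < C) (hq : 0 < q) (hα0 : 0 < α) (hα : α ≤ π / 2) (k : ℕ) :
    ∃ M, ∀ n : ℕ, k + 2 ≤ n → ∀ y : Fin 7 → ℕ → ℝ,
      DiscreteDyon κ q α C (1 / n) (n * n) (y 0) (y 1) (y 2) (y 3) (y 4) (y 5) (y 6) →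
      ∀ i, n ≤ i * k → i ≤ k * n → ∀ m, |y m i| ≤ M := by
  set R : ℝ := k + 2 with hR
  set A := 2 + C * R with hA
  set B := 8 * κ * A ^ 2 + R ^ 2 with hB
  set V := (α * B * k ^ 2) ^ 2 with hV
  set L := A ^ 3 * k ^ 2 + (1 / 4) * A + κ * A * V + κ * A ^ 3 * k ^ 2 + A * k ^ 2
      + A * q ^ 2 / 2 with hL
  have hR0 : 0 < R := by positivity
  have hA0 : 0 < A := by positivity
  have hB0 : 0 < B := by positivity
  have hL0 : 0 < L := by positivity
  refine ⟨A + (A + L) + α + α * B + q + 2 * A ^ 2 * q * R + C, ?_⟩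
  intro n hn y D i hi0' hik m
  have hn0 : 0 < n := by omega
  have hn' : (0 : ℝ) < n := by exact_mod_cast hn0
  have hh : (0 : ℝ) < 1 / n := by positivity
  have hnh : (n : ℝ) * (1 / n) = 1 := by field_simp
  have hi0 : 0 < i := by
    rcases Nat.eq_zero_or_pos i with rfl | h
    · omega
    · exact h
  have hN2 : k * n + 2 * n ≤ n * n := by rw [← add_mul]; exact Nat.mul_le_mul_right _ hn
  have hN : 0 < n * n := by positivity
  have hrad : ∀ j ≤ i + 2 * n, (j : ℝ) * (1 / n) ≤ R := by
    intro j hj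
    rw [mul_one_div, div_le_iff₀ hn', hR]
    have : j ≤ (k + 2) * n := by rw [add_mul]; omega
    exact_mod_cast this
  have hlow : ∀ j, i ≤ j → 1 / ((j : ℝ) * (1 / n)) ^ 2 ≤ k ^ 2 := by
    intro j hj
    have hj0 : (0 : ℝ) < j := by exact_mod_cast hi0.trans_le hj
    rw [← one_div_pow]
    refine pow_le_pow_left₀ (by positivity) ?_ 2
    rw [mul_one_div, one_div_div, div_le_iff₀ hj0]
    have : n ≤ k * j := hi0'.trans (by rw [mul_comm]; gcongr)
    exact_mod_cast this
  have ha : ∀ j ≤ i + 2 * n, y 0 j ≤ A := fun j hj =>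
    D.a_le hκ hh hC (by omega) (hrad j hj)
  have hX : ∀ j, 0 < j → j ≤ i + n → y 3 j ≤ α * B := fun j h0 hj =>
    D.X_le hκ hh hC hα h0 (by omega) (hrad _ (by omega)) hnh
  have hX0 : ∀ j, 0 < j → j ≤ i + n → 0 ≤ y 3 j := fun j h0 hj =>
    D.X_nonneg hκ hh hα hN h0 (by omega)
  have hv : ∀ j, i ≤ j → j ≤ i + n →
      (y 3 j / stiffness κ (j * (1 / n)) (y 0 j) (y 2 j)) ^ 2 ≤ V := by
    intro j hij hj
    have hj0 : (0 : ℝ) < j := by exact_mod_cast hi0.trans_le hij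
    have h0 := hX0 j (by omega) hj
    have hr2 : (0 : ℝ) < (j * (1 / n)) ^ 2 := by positivity
    have hs : ((j : ℝ) * (1 / n)) ^ 2 ≤ stiffness κ (j * (1 / n)) (y 0 j) (y 2 j) := by
      have : 0 ≤ 8 * κ * (y 0 j ^ 2 * sin (y 2 j) ^ 2) := by positivity
      unfold stiffness
      linarith
    refine pow_le_pow_left₀ (div_nonneg h0 (hr2.le.trans hs)) ?_ 2
    calc y 3 j / stiffness κ (j * (1 / n)) (y 0 j) (y 2 j)
        ≤ y 3 j / ((j : ℝ) * (1 / n)) ^ 2 := by gcongr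
      _ = y 3 j * (1 / ((j : ℝ) * (1 / n)) ^ 2) := by ring
      _ ≤ α * B * k ^ 2 := by
        gcongr
        · exact hX j (by omega) hj
        · exact hlow j hij
  have hgP : ∀ j, 0 < j → j ≤ i + n → 0 ≤ y 4 j ∧ 0 ≤ y 5 j := fun j h0 hj =>
    D.g_nonneg hh hq hN h0 (by omega)
  have hgq : ∀ j, 0 < j → j ≤ i + n → y 4 j ≤ q := fun j h0 hj =>
    D.g_le_last hh hq hN h0 (by omega)
  have hb := D.abs_b_le hκ hh hC hi0 (by omega) (hrad (i + n) (by omega)) hnh hL0.le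
    (fun j hij hj => abs_forceA_le hκ (by have : 0 < j := by omega
                                          positivity)
      (D.a_nonneg j) (ha j (by omega)) (hlow j hij)
      (hv j hij hj.le) (hgP j (by omega) hj.le).1 (hgq j (by omega) hj.le))
  have hP := D.P_le hκ hh hC hq (by omega) (hrad i (by omega))
  have hP' : 2 * A ^ 2 * q * (i * (1 / n)) ≤ 2 * A ^ 2 * q * R := by
    gcongr
    exact hrad i (by omega)
  have hαB : 0 < α * B := by positivity
  have hqR : 0 < 2 * A ^ 2 * q * R := by positivity
  have h1 := ha i (by omega)
  have h2 := D.a_nonneg i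
  have h3 := D.f_mem i
  have h4 := hX i hi0 (by omega)
  have h5 := hX0 i hi0 (by omega)
  have h6 := hgP i hi0 (by omega)
  have h7 := hgq i hi0 (by omega)
  have h8 := D.c_nonneg hκ hh (by omega : i ≤ n * n)
  have h9 := D.c_le i (by omega)
  rw [abs_le] at hb
  rw [abs_le]
  fin_cases m <;> simp only [Fin.zero_eta, Fin.mk_one, Fin.reduceFinMk] <;> constructor <;>
    linarith [h3.1, h3.2, h6.1, h6.2]

end DiscreteDyon

/-- A solution of the dyon equations, written as a first-order system, with the a priori estimates
inherited from its discretisations. -/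
structure DyonSystem (κ q α C : ℝ) (a b f X g P c : ℝ → ℝ) : Prop where
  deriv_a : ∀ r, 0 < r → HasDerivAt a (b r) r
  deriv_b : ∀ r, 0 < r → HasDerivAt b
    (forceA κ r (a r) (f r) (X r / stiffness κ r (a r) (f r)) (g r)) r
  deriv_f : ∀ r, 0 < r → HasDerivAt f (X r / stiffness κ r (a r) (f r)) r
  deriv_X : ∀ r, 0 < r → HasDerivAt X
    (forceF κ r (a r) (f r) (X r / stiffness κ r (a r) (f r))) r
  deriv_g : ∀ r, 0 < r → HasDerivAt g (P r / r ^ 2) r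
  deriv_P : ∀ r, 0 < r → HasDerivAt P (2 * a r ^ 2 * g r) r
  deriv_c : ∀ r, 0 < r → HasDerivAt c (staticDensity κ r (a r) (b r) (f r)
    (X r / stiffness κ r (a r) (f r)) + P r ^ 2 / r ^ 2 + 2 * a r ^ 2 * g r ^ 2) r
  a_nonneg : ∀ r, 0 < r → 0 ≤ a r
  sq_a_sub_one_le : ∀ r, 0 < r → (a r - 1) ^ 2 ≤ C * r
  f_mem : ∀ r, 0 < r → f r ∈ Icc 0 α
  sq_one_sub_cos_le : ∀ r, 0 < r → C * r < 1 / 4 → (1 - cos (f r)) ^ 2 ≤ C * r / κ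
  sq_sub_f_le : ∀ r, 0 < r → (α - f r) ^ 2 ≤ 2 * C / r
  X_nonneg : ∀ r, 0 < r → 0 ≤ X r
  g_mem : ∀ r, 0 < r → g r ∈ Icc 0 q
  sq_sub_g_le : ∀ r, 0 < r → (q - g r) ^ 2 ≤ C / r
  P_nonneg : ∀ r, 0 < r → 0 ≤ P r
  c_mem : ∀ r, 0 < r → c r ∈ Icc 0 C

theorem exists_dyonSystem {κ q α C : ℝ} (hκ : 0 < κ) (hC : 0 < C) (hq : 0 < q) (hα0 : 0 < α)
    (hα : α ≤ π / 2) (hD : ∀ n : ℕ, 3 ≤ n → ∃ a b f X g P c,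
      DiscreteDyon κ q α C (1 / n) (n * n) a b f X g P c) :
    ∃ a b f X g P c, DyonSystem κ q α C a b f X g P c := by
  have hD' : ∀ n : ℕ, ∃ y : Fin 7 → ℕ → ℝ, 3 ≤ n →
      DiscreteDyon κ q α C (1 / n) (n * n) (y 0) (y 1) (y 2) (y 3) (y 4) (y 5) (y 6) := by
    intro n
    by_cases hn : 3 ≤ n
    · obtain ⟨a, b, f, X, g, P, c, h⟩ := hD n hn
      exact ⟨![a, b, f, X, g, P, c], fun _ => h⟩
    · exact ⟨fun _ _ => 0, fun h => absurd h hn⟩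
  choose y hy using hD'
  have hpos : ∀ {n k i : ℕ}, 3 ≤ n → n ≤ i * k → 0 < i := by
    intro n k i hn hi
    rcases Nat.eq_zero_or_pos i with rfl | h
    · omega
    · exact h
  obtain ⟨φ, z, hφ, hlim, hder⟩ := exists_limit_of_euler_scheme (ι := Fin 7)
    (Φ := fun r y => dyonField κ r y)
    (Y := fun n i c => y n c i) (σ := ![1, 0, 1, 0, 0, 1, 1]) (continuousOn_dyonField hκ)
    (fun c => by fin_cases c <;> simp)
    (fun k => by
      obtain ⟨M, hM⟩ := DiscreteDyon.exists_bound hκ hC hq hα0 hα k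
      refine ⟨M, ?_⟩
      filter_upwards [eventually_ge_atTop (k + 3)] with n hn i hi hik c
      exact hM n (by omega) (y n) (hy n (by omega)) i hi hik c)
    (fun k => by
      filter_upwards [eventually_ge_atTop (k + 3)] with n hn i hi hik c
      have hik' : i < n * n := hik.trans_lt (Nat.mul_lt_mul_of_pos_right (by omega) (by omega))
      have := (hy n (by omega)).step_eq (hpos (by omega) hi) hik' c
      rw [mul_one_div] at this
      exact this)
  have hev : ∀ r : ℝ, 0 < r → ∀ᶠ n in atTop, 3 ≤ φ n ∧ 1 < ⌊r * φ n⌋₊ ∧ ⌊r * φ n⌋₊ ≤ φ n * φ n := by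
    intro r hr
    have h1 := hφ.tendsto_atTop
    have h2 : Tendsto (fun n => (φ n : ℝ)) atTop atTop := tendsto_natCast_atTop_atTop.comp h1
    filter_upwards [h1.eventually_ge_atTop 3, h2.eventually_ge_atTop r,
      h2.eventually_ge_atTop (2 / r)] with n hn1 hn2 hn3
    refine ⟨hn1, ?_, ?_⟩
    · refine Nat.lt_of_succ_le (Nat.le_floor ?_)
      rw [div_le_iff₀ hr] at hn3
      push_cast
      linarith
    · refine Nat.floor_le_of_le ?_
      push_cast
      gcongr
  have hrad : ∀ r : ℝ, 0 < r →
      Tendsto (fun n => (⌊r * φ n⌋₊ : ℝ) * (1 / (φ n : ℝ))) atTop (nhds r) := fun r hr => by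
    simpa only [mul_one_div] using tendsto_floor_mul_div hφ hr.le
  have hmesh : Tendsto (fun n => 1 / (φ n : ℝ)) atTop (nhds 0) :=
    tendsto_one_div_atTop_nhds_zero_nat.comp hφ.tendsto_atTop
  have hh : ∀ n, 3 ≤ φ n → (0 : ℝ) < 1 / (φ n : ℝ) := fun n hn => by
    have : 0 < φ n := by omega
    positivity
  refine ⟨fun r => z r 0, fun r => z r 1, fun r => z r 2, fun r => z r 3, fun r => z r 4,
    fun r => z r 5, fun r => z r 6, fun r hr => hder r hr 0, fun r hr => hder r hr 1,
    fun r hr => hder r hr 2, fun r hr => hder r hr 3, fun r hr => hder r hr 4,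
    fun r hr => hder r hr 5, fun r hr => hder r hr 6, ?_, ?_, ?_, ?_, ?_, ?_, ?_, ?_, ?_, ?_⟩
  · intro r hr
    refine ge_of_tendsto (hlim r hr 0) ?_
    filter_upwards [hev r hr] with n hn
    exact (hy _ hn.1).a_nonneg _
  · intro r hr
    refine le_of_tendsto_of_tendsto (((hlim r hr 0).sub_const 1).pow 2)
      ((hrad r hr).const_mul C) ?_
    filter_upwards [hev r hr] with n hn
    exact (hy _ hn.1).sq_a_sub_one_le hκ (hh n hn.1) hn.2.2
  · intro r hr
    refine isClosed_Icc.mem_of_tendsto (hlim r hr 2) ?_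
    filter_upwards [hev r hr] with n hn
    exact (hy _ hn.1).f_mem _
  · intro r hr hCr
    refine le_of_tendsto_of_tendsto
      ((((continuous_cos.tendsto _).comp (hlim r hr 2)).const_sub 1).pow 2)
      (((hrad r hr).const_mul C).div_const κ) ?_
    filter_upwards [hev r hr, ((hrad r hr).const_mul C).eventually_lt_const hCr] with n hn hn2
    exact (hy _ hn.1).sq_one_sub_cos_le hκ (hh n hn.1) hα hn.2.2 hC hn2.le
  · intro r hr
    refine le_of_tendsto_of_tendsto (((hlim r hr 2).const_sub α).pow 2)
      (tendsto_const_nhds.div (hrad r hr) hr.ne') ?_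
    filter_upwards [hev r hr] with n hn
    exact (hy _ hn.1).sq_sub_f_le hκ (hh n hn.1) (by omega) hn.2.2
  · intro r hr
    refine ge_of_tendsto (hlim r hr 3) ?_
    filter_upwards [hev r hr] with n hn
    exact (hy _ hn.1).X_nonneg hκ (hh n hn.1) hα (by omega) (by omega) hn.2.2
  · intro r hr
    refine isClosed_Icc.mem_of_tendsto (hlim r hr 4) ?_
    filter_upwards [hev r hr] with n hn
    exact ⟨((hy _ hn.1).g_nonneg (hh n hn.1) hq (by omega) (by omega) hn.2.2).1,
      (hy _ hn.1).g_le_last (hh n hn.1) hq (by omega) (by omega) hn.2.2⟩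
  · intro r hr
    have h1 : Tendsto (fun n => C / ((⌊r * φ n⌋₊ : ℝ) * (1 / (φ n : ℝ)) - 1 / (φ n : ℝ))) atTop
        (nhds (C / r)) := by
      have h0 := (hrad r hr).sub hmesh
      rw [sub_zero] at h0
      exact tendsto_const_nhds.div h0 hr.ne'
    refine le_of_tendsto_of_tendsto (((hlim r hr 4).const_sub q).pow 2) h1 ?_
    filter_upwards [hev r hr] with n hn
    obtain ⟨k, hk⟩ := Nat.exists_eq_add_of_lt hn.2.1
    have h2 := (hy _ hn.1).sq_sub_g_le hκ (hh n hn.1) (i := k + 1) k.succ_pos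
      (by have := hn.2.2; omega)
    rw [hk]
    rw [show 1 + k + 1 = k + 1 + 1 by omega]
    refine h2.trans_eq ?_
    push_cast
    ring
  · intro r hr
    refine ge_of_tendsto (hlim r hr 5) ?_
    filter_upwards [hev r hr] with n hn
    exact ((hy _ hn.1).g_nonneg (hh n hn.1) hq (by omega) (by omega) hn.2.2).2
  · intro r hr
    refine isClosed_Icc.mem_of_tendsto (hlim r hr 6) ?_
    filter_upwards [hev r hr] with n hn
    exact ⟨(hy _ hn.1).c_nonneg hκ (hh n hn.1) hn.2.2, (hy _ hn.1).c_le _ hn.2.2⟩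

theorem eq_zero_of_abs_deriv_le_mul_Ioi {w w' m : ℝ → ℝ}
    (hw : ∀ r, 0 < r → HasDerivAt w (w' r) r) (hm : ContinuousOn m (Ioi 0))
    (hb : ∀ r, 0 < r → |w' r| ≤ m r * |w r|) {r₀ : ℝ} (h0 : 0 < r₀) (hz : w r₀ = 0)
    {r : ℝ} (hr : 0 < r) : w r = 0 := by
  have hM : ∀ s t : ℝ, 0 < s → ∃ M, ∀ x ∈ Icc s t, |w' x| ≤ M * |w x| := fun s t hs => by
    have hsub : Icc s t ⊆ Ioi 0 := fun x hx => hs.trans_le hx.1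
    obtain ⟨M, hM⟩ := isCompact_Icc.exists_bound_of_continuousOn (hm.mono hsub)
    exact ⟨M, fun x hx => (hb x (hsub hx)).trans <|
      mul_le_mul_of_nonneg_right ((le_abs_self _).trans (hM x hx)) (abs_nonneg _)⟩
  rcases le_total r₀ r with h | h
  · obtain ⟨M, hM⟩ := hM r₀ r h0
    exact eq_zero_of_abs_deriv_le_mul_abs_self_of_eq_zero_right (f := w) (f' := w') (K := M)
      (fun x hx => (hw x (h0.trans_le hx.1)).continuousAt.continuousWithinAt)
      (fun x hx => (hw x (h0.trans_le hx.1)).hasDerivWithinAt) hz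
      (fun x hx => hM x ⟨hx.1, hx.2.le⟩) r ⟨h, le_rfl⟩
  · obtain ⟨M, hM⟩ := hM r r₀ hr
    have hd : ∀ x ∈ Icc (-r₀) (-r), HasDerivAt (fun y => w (-y)) (-w' (-x)) x := fun x hx => by
      have h1 := (hw (-x) (by linarith [hx.2])).scomp x (hasDerivAt_neg x)
      simpa [Function.comp_def] using h1
    have := eq_zero_of_abs_deriv_le_mul_abs_self_of_eq_zero_right (f := fun y => w (-y))
      (f' := fun x => -w' (-x)) (K := M) (a := -r₀) (b := -r)
      (fun x hx => (hd x hx).continuousAt.continuousWithinAt)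
      (fun x hx => (hd x ⟨hx.1, hx.2.le⟩).hasDerivWithinAt) (by simpa using hz)
      (fun x hx => by
        rw [norm_neg]
        exact hM (-x) ⟨by linarith [hx.2], by linarith [hx.1]⟩) (-r) ⟨by linarith, le_rfl⟩
    simpa using this

theorem monotoneOn_Ioi_of_hasDerivAt_nonneg {F F' : ℝ → ℝ} {R : ℝ}
    (h : ∀ r, R < r → HasDerivAt F (F' r) r) (h0 : ∀ r, R < r → 0 ≤ F' r) :
    MonotoneOn F (Ioi R) := by
  refine monotoneOn_of_deriv_nonneg (convex_Ioi R)
    (fun x hx => (h x hx).continuousAt.continuousWithinAt) ?_ ?_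
  · rw [interior_Ioi]
    exact fun x hx => (h x hx).differentiableAt.differentiableWithinAt
  · rw [interior_Ioi]
    intro x hx
    rw [(h x hx).deriv]
    exact h0 x hx

theorem strictMonoOn_Ioi_of_hasDerivAt_pos {F F' : ℝ → ℝ} {R : ℝ}
    (h : ∀ r, R < r → HasDerivAt F (F' r) r) (h0 : ∀ r, R < r → 0 < F' r) :
    StrictMonoOn F (Ioi R) := by
  refine strictMonoOn_of_deriv_pos (convex_Ioi R)
    (fun x hx => (h x hx).continuousAt.continuousWithinAt) ?_
  rw [interior_Ioi]
  intro x hx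
  rw [(h x hx).deriv]
  exact h0 x hx

theorem MonotoneOn.exists_tendsto_atTop_of_le {F : ℝ → ℝ} {R M : ℝ} (hF : MonotoneOn F (Ioi R))
    (hM : ∀ r, R < r → F r ≤ M) : ∃ l, Tendsto F atTop (nhds l) := by
  have hmono : Monotone fun r => F (max r (R + 1)) := fun x y hxy =>
    hF (lt_max_of_lt_right (lt_add_one R)) (lt_max_of_lt_right (lt_add_one R))
      (max_le_max_right _ hxy)
  refine ⟨_, (tendsto_atTop_ciSup hmono ⟨M, ?_⟩).congr' ?_⟩
  · rintro _ ⟨x, rfl⟩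
    exact hM _ (lt_max_of_lt_right (lt_add_one R))
  · filter_upwards [eventually_ge_atTop (R + 1)] with x hx
    rw [max_eq_left hx]

namespace DyonSystem

variable {κ q α C : ℝ} {a b f X g P c : ℝ → ℝ}

theorem tendsto_a_zero (S : DyonSystem κ q α C a b f X g P c) :
    Tendsto a (nhdsWithin 0 (Ioi 0)) (nhds 1) := by
  have h1 : Tendsto (fun r => C * r) (nhdsWithin 0 (Ioi 0)) (nhds 0) := by
    have : Tendsto (fun r => C * r) (nhds 0) (nhds (C * 0)) := tendsto_id.const_mul C
    rw [mul_zero] at this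
    exact this.mono_left nhdsWithin_le_nhds
  have h2 : Tendsto (fun r => (a r - 1) ^ 2) (nhdsWithin 0 (Ioi 0)) (nhds 0) :=
    squeeze_zero' (Eventually.of_forall fun r => sq_nonneg _)
      (eventually_mem_nhdsWithin.mono fun r hr => S.sq_a_sub_one_le r hr) h1
  rw [tendsto_iff_dist_tendsto_zero]
  simpa [Real.dist_eq, Real.sqrt_sq_eq_abs] using h2.sqrt

theorem tendsto_f_zero (S : DyonSystem κ q α C a b f X g P c) (hα : α ≤ π / 2) :
    Tendsto f (nhdsWithin 0 (Ioi 0)) (nhds 0) := by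
  have h1 : Tendsto (fun r => C * r) (nhdsWithin 0 (Ioi 0)) (nhds 0) := by
    have : Tendsto (fun r => C * r) (nhds 0) (nhds (C * 0)) := tendsto_id.const_mul C
    rw [mul_zero] at this
    exact this.mono_left nhdsWithin_le_nhds
  have h2 : Tendsto (fun r => (1 - cos (f r)) ^ 2) (nhdsWithin 0 (Ioi 0)) (nhds 0) := by
    refine squeeze_zero' (Eventually.of_forall fun r => sq_nonneg _) ?_
      (by simpa using h1.div_const κ)
    filter_upwards [eventually_mem_nhdsWithin,
      h1.eventually_lt_const (show (0 : ℝ) < 1 / 4 by norm_num)] with r hr hr2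
    exact S.sq_one_sub_cos_le r hr hr2
  have h3 : Tendsto (fun r => cos (f r)) (nhdsWithin 0 (Ioi 0)) (nhds 1) := by
    rw [tendsto_iff_dist_tendsto_zero]
    simpa [Real.dist_eq, Real.sqrt_sq_eq_abs, abs_sub_comm] using h2.sqrt
  have h4 := (continuous_arccos.tendsto 1).comp h3
  rw [arccos_one] at h4
  refine h4.congr' ?_
  filter_upwards [eventually_mem_nhdsWithin] with r hr
  have := S.f_mem r hr
  exact arccos_cos this.1 (by linarith [this.2, pi_pos])

theorem tendsto_f_atTop (S : DyonSystem κ q α C a b f X g P c) : Tendsto f atTop (nhds α) := by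
  have h2 : Tendsto (fun r => (α - f r) ^ 2) atTop (nhds 0) :=
    squeeze_zero' (Eventually.of_forall fun r => sq_nonneg _)
      ((eventually_gt_atTop 0).mono S.sq_sub_f_le) (tendsto_const_nhds.div_atTop tendsto_id)
  rw [tendsto_iff_dist_tendsto_zero]
  simpa [Real.dist_eq, Real.sqrt_sq_eq_abs, abs_sub_comm] using h2.sqrt

theorem tendsto_g_atTop (S : DyonSystem κ q α C a b f X g P c) : Tendsto g atTop (nhds q) := by
  have h2 : Tendsto (fun r => (q - g r) ^ 2) atTop (nhds 0) :=
    squeeze_zero' (Eventually.of_forall fun r => sq_nonneg _)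
      ((eventually_gt_atTop 0).mono S.sq_sub_g_le) (tendsto_const_nhds.div_atTop tendsto_id)
  rw [tendsto_iff_dist_tendsto_zero]
  simpa [Real.dist_eq, Real.sqrt_sq_eq_abs, abs_sub_comm] using h2.sqrt

theorem monotoneOn_c (S : DyonSystem κ q α C a b f X g P c) (hκ : 0 < κ) :
    MonotoneOn c (Ioi 0) :=
  monotoneOn_Ioi_of_hasDerivAt_nonneg S.deriv_c fun r _ => by
    have := staticDensity_nonneg hκ r (a r) (b r) (f r) (X r / stiffness κ r (a r) (f r))
    positivity

theorem exists_tendsto_c_atTop (S : DyonSystem κ q α C a b f X g P c) (hκ : 0 < κ) :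
    ∃ l, Tendsto c atTop (nhds l) :=
  (S.monotoneOn_c hκ).exists_tendsto_atTop_of_le fun r hr => (S.c_mem r hr).2

theorem tendsto_a_atTop (S : DyonSystem κ q α C a b f X g P c) (hκ : 0 < κ) (hα0 : 0 < α)
    (hα : α ≤ π / 2) : Tendsto a atTop (nhds 0) := by
  have hs : 0 < sin α ^ 2 := pow_pos (sin_pos_of_pos_of_lt_pi hα0 (by linarith [pi_pos])) 2
  obtain ⟨δ, hδ0, hδ⟩ := exists_between hs
  have hev : ∀ᶠ r in atTop, δ < sin (f r) ^ 2 :=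
    (((continuous_sin.tendsto α).comp S.tendsto_f_atTop).pow 2).eventually_const_lt hδ
  obtain ⟨R, hR⟩ := eventually_atTop.1 (hev.and (eventually_gt_atTop 0))
  have hR0 : 0 < R := (hR R le_rfl).2
  have hc : ∀ r, R < r → δ * a r ^ 2 + 4 * b r ^ 2 ≤ staticDensity κ r (a r) (b r) (f r)
      (X r / stiffness κ r (a r) (f r)) + P r ^ 2 / r ^ 2 + 2 * a r ^ 2 * g r ^ 2 := by
    intro r hr
    have h1 : δ * a r ^ 2 ≤ a r ^ 2 * sin (f r) ^ 2 := by
      rw [mul_comm]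
      exact mul_le_mul_of_nonneg_left (hR r hr.le).1.le (sq_nonneg _)
    generalize X r / stiffness κ r (a r) (f r) = v
    have h2 : 0 ≤ (a r ^ 2 - 1) ^ 2 / r ^ 2 := by positivity
    have h3 : 0 ≤ r ^ 2 * v ^ 2 := by positivity
    have h4 : 0 ≤ 2 * κ * a r ^ 2 * sin (f r) ^ 2 *
        (2 * v ^ 2 + a r ^ 2 * sin (f r) ^ 2 / r ^ 2) := by positivity
    have h5 : 0 ≤ P r ^ 2 / r ^ 2 + 2 * a r ^ 2 * g r ^ 2 := by positivity
    unfold staticDensity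
    linarith
  set K := 1 + 1 / δ with hK
  have hK1 : 1 ≤ K := by rw [hK]; have : 0 < 1 / δ := by positivity
                         linarith
  have hKδ : 1 ≤ K * δ := by rw [hK, add_mul, one_div_mul_cancel hδ0.ne']; linarith
  have hmono : MonotoneOn (fun r => K * c r - a r ^ 2) (Ioi R) := by
    refine monotoneOn_Ioi_of_hasDerivAt_nonneg
      (fun r hr => ((S.deriv_c r (hR0.trans hr)).const_mul K).sub
        ((S.deriv_a r (hR0.trans hr)).pow 2)) fun r hr => ?_
    have h1 := mul_le_mul_of_nonneg_left (hc r hr) (by linarith : 0 ≤ K)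
    have h2 : 0 ≤ (K * δ - 1) * a r ^ 2 := mul_nonneg (by linarith) (sq_nonneg _)
    have h3 : 0 ≤ (K - 1) * b r ^ 2 := mul_nonneg (by linarith) (sq_nonneg _)
    have h4 : 0 ≤ b r ^ 2 := sq_nonneg _
    simp only [Nat.cast_ofNat, Nat.add_one_sub_one, pow_one]
    nlinarith [sq_nonneg (a r - b r)]
  obtain ⟨l₁, h₁⟩ := hmono.exists_tendsto_atTop_of_le (M := K * C) fun r hr => by
    have := mul_le_mul_of_nonneg_left (S.c_mem r (hR0.trans hr)).2 (by linarith : 0 ≤ K)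
    linarith [sq_nonneg (a r)]
  obtain ⟨l₂, h₂⟩ := S.exists_tendsto_c_atTop hκ
  have h₃ : Tendsto (fun r => a r ^ 2) atTop (nhds (K * l₂ - l₁)) := by
    simpa using (h₂.const_mul K).sub h₁
  have hl0 : 0 ≤ K * l₂ - l₁ := ge_of_tendsto' h₃ fun r => sq_nonneg _
  have hl : K * l₂ - l₁ = 0 := by
    by_contra hne
    obtain ⟨ε, hε0, hε⟩ := exists_between (lt_of_le_of_ne hl0 (Ne.symm hne))
    obtain ⟨T, hT⟩ := eventually_atTop.1 ((h₃.eventually_const_lt hε).and (eventually_gt_atTop R))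
    have hRT : R < T := (hT T le_rfl).2
    have hm2 : MonotoneOn (fun r => c r - δ * ε * r) (Ioi R ∩ Ici T) := by
      refine monotoneOn_of_deriv_nonneg ((convex_Ioi R).inter (convex_Ici T)) ?_ ?_ ?_
      · exact fun x hx => ((S.deriv_c x (hR0.trans hx.1)).sub
          ((hasDerivAt_id x).const_mul (δ * ε))).continuousAt.continuousWithinAt
      · exact fun x hx => ((S.deriv_c x (hR0.trans (interior_subset hx).1)).sub
          ((hasDerivAt_id x).const_mul (δ * ε))).differentiableAt.differentiableWithinAt
      · intro x hx
        replace hx := interior_subset hx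
        have := ((S.deriv_c x (hR0.trans hx.1)).sub ((hasDerivAt_id x).const_mul (δ * ε))).deriv
        refine le_of_le_of_eq ?_ this.symm
        have h1 := hc x hx.1
        have h2 := mul_le_mul_of_nonneg_left (hT x hx.2).1.le hδ0.le
        linarith [sq_nonneg (b x)]
    have hlt : T < T + (C + 1) / (δ * ε) := by
      have := (S.c_mem T (hR0.trans hRT))
      have : 0 ≤ C := this.1.trans this.2
      have : 0 < (C + 1) / (δ * ε) := by positivity
      linarith
    have h1 := hm2 ⟨hRT, self_mem_Ici⟩ ⟨hRT.trans hlt, hlt.le⟩ hlt.le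
    have h2 := (S.c_mem _ (hR0.trans (hRT.trans hlt))).2
    have h3 := (S.c_mem _ (hR0.trans hRT)).1
    have h4 : δ * ε * ((C + 1) / (δ * ε)) = C + 1 := by field_simp
    simp only at h1
    linarith
  rw [hl] at h₃
  rw [tendsto_zero_iff_abs_tendsto_zero]
  simpa [Real.sqrt_sq_eq_abs, Function.comp_def] using h₃.sqrt

theorem continuousOn_a (S : DyonSystem κ q α C a b f X g P c) : ContinuousOn a (Ioi 0) :=
  fun r hr => (S.deriv_a r hr).continuousAt.continuousWithinAt

theorem continuousOn_f (S : DyonSystem κ q α C a b f X g P c) : ContinuousOn f (Ioi 0) :=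
  fun r hr => (S.deriv_f r hr).continuousAt.continuousWithinAt

theorem continuousOn_g (S : DyonSystem κ q α C a b f X g P c) : ContinuousOn g (Ioi 0) :=
  fun r hr => (S.deriv_g r hr).continuousAt.continuousWithinAt

theorem continuousOn_div_stiffness (S : DyonSystem κ q α C a b f X g P c) (hκ : 0 < κ) :
    ContinuousOn (fun r => X r / stiffness κ r (a r) (f r)) (Ioi 0) := by
  have ha := S.continuousOn_a
  have hf := S.continuousOn_f
  have hX : ContinuousOn X (Ioi 0) := fun r hr => (S.deriv_X r hr).continuousAt.continuousWithinAt
  refine hX.div ?_ fun r hr => (stiffness_pos hκ hr _ _).ne'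
  unfold stiffness
  fun_prop

theorem a_pos (S : DyonSystem κ q α C a b f X g P c) (hκ : 0 < κ) {r : ℝ} (hr : 0 < r) :
    0 < a r := by
  refine lt_of_le_of_ne (S.a_nonneg r hr) fun h => ?_
  have hb : b r = 0 := by
    have hmin : IsLocalMin a r := by
      filter_upwards [Ioi_mem_nhds hr] with x hx
      rw [← h]
      exact S.a_nonneg x hx
    exact hmin.hasDerivAt_eq_zero (S.deriv_a r hr)
  set m : ℝ → ℝ := fun r => (a r ^ 2 - 1) / r ^ 2 + (1 / 4) * sin (f r) ^ 2
    + κ * sin (f r) ^ 2 * (X r / stiffness κ r (a r) (f r)) ^ 2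
    + κ * a r ^ 2 * sin (f r) ^ 4 / r ^ 2 - g r ^ 2 / 2 with hm
  have hmc : ContinuousOn m (Ioi 0) := by
    have hv := S.continuousOn_div_stiffness hκ
    have ha := S.continuousOn_a
    have hf := S.continuousOn_f
    have hg := S.continuousOn_g
    have hne : ∀ x ∈ Ioi (0 : ℝ), x ^ 2 ≠ 0 := fun x hx => pow_ne_zero 2 (ne_of_gt hx)
    fun_prop (disch := assumption)
  have hforce : ∀ r, forceA κ r (a r) (f r) (X r / stiffness κ r (a r) (f r)) (g r) = a r * m r := by
    intro r
    rw [hm]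
    unfold forceA
    ring
  have hzero : ∀ x, 0 < x → a x = 0 := by
    intro x hx
    have := eq_zero_of_abs_deriv_le_mul_Ioi (w := fun r => a r ^ 2 + b r ^ 2)
      (m := fun r => 1 + |m r|)
      (fun r hr => ((S.deriv_a r hr).pow 2).add ((S.deriv_b r hr).pow 2))
      (continuousOn_const.add hmc.abs) ?_ hr (by simp [← h, hb]) hx
    · exact pow_eq_zero_iff two_ne_zero |>.1 (by linarith [sq_nonneg (a x), sq_nonneg (b x)])
    · intro r _
      rw [hforce, abs_of_nonneg (by positivity : 0 ≤ a r ^ 2 + b r ^ 2)]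
      simp only [Nat.cast_ofNat, Nat.add_one_sub_one, pow_one]
      have h1 : 2 * |a r * b r| ≤ a r ^ 2 + b r ^ 2 := by
        rw [abs_mul, ← sq_abs (a r), ← sq_abs (b r)]
        linarith [sq_nonneg (|a r| - |b r|)]
      have h2 : |1 + m r| ≤ 1 + |m r| := (abs_add_le _ _).trans_eq (by rw [abs_one])
      calc |2 * a r * b r + 2 * b r * (a r * m r)| = 2 * |a r * b r| * |1 + m r| := by
            rw [← abs_of_pos (two_pos : (0 : ℝ) < 2), mul_assoc |2|, ← abs_mul, ← abs_mul,
              abs_of_pos (two_pos : (0 : ℝ) < 2)]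
            congr 1
            ring
        _ ≤ (a r ^ 2 + b r ^ 2) * (1 + |m r|) := by gcongr
        _ = _ := mul_comm _ _
  have h1 : Tendsto a (nhdsWithin 0 (Ioi 0)) (nhds 0) :=
    tendsto_const_nhds.congr' (eventually_mem_nhdsWithin.mono fun x hx => (hzero x hx).symm)
  exact one_ne_zero (tendsto_nhds_unique S.tendsto_a_zero h1)

theorem forceF_nonneg (S : DyonSystem κ q α C a b f X g P c) (hκ : 0 < κ) (hα : α ≤ π / 2)
    {r : ℝ} (hr : 0 < r) :
    0 ≤ forceF κ r (a r) (f r) (X r / stiffness κ r (a r) (f r)) :=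
  _root_.forceF_nonneg hκ hα (S.f_mem r hr)

theorem add_X_pos (S : DyonSystem κ q α C a b f X g P c) (hκ : 0 < κ) (hα0 : 0 < α)
    (hα : α ≤ π / 2) {r : ℝ} (hr : 0 < r) : 0 < f r + X r := by
  refine lt_of_le_of_ne (add_nonneg (S.f_mem r hr).1 (S.X_nonneg r hr)) fun h => ?_
  set m : ℝ → ℝ := fun r => 2 * a r ^ 2 * cos (f r)
    + 8 * κ * a r ^ 2 * cos (f r) * (X r / stiffness κ r (a r) (f r)) ^ 2
    + 8 * κ * a r ^ 4 * sin (f r) ^ 2 * cos (f r) / r ^ 2 with hm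
  have hne : ∀ x ∈ Ioi (0 : ℝ), x ^ 2 ≠ 0 := fun x hx => pow_ne_zero 2 (ne_of_gt hx)
  have hmc : ContinuousOn m (Ioi 0) := by
    have hv := S.continuousOn_div_stiffness hκ
    have ha := S.continuousOn_a
    have hf := S.continuousOn_f
    fun_prop (disch := assumption)
  have hforce : ∀ r, forceF κ r (a r) (f r) (X r / stiffness κ r (a r) (f r))
      = sin (f r) * m r := by
    intro r
    rw [hm]
    unfold forceF
    ring
  have hzero : ∀ x, 0 < x → f x = 0 := by
    intro x hx
    have := eq_zero_of_abs_deriv_le_mul_Ioi (w := fun r => f r + X r)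
      (m := fun r => 1 / r ^ 2 + |m r|)
      (fun r hr => (S.deriv_f r hr).add (S.deriv_X r hr))
      ((by fun_prop (disch := assumption) : ContinuousOn (fun r : ℝ => 1 / r ^ 2) (Ioi 0)).add
        hmc.abs) ?_ hr h.symm hx
    · linarith [(S.f_mem x hx).1, S.X_nonneg x hx]
    · intro r hr
      have hf0 := (S.f_mem r hr).1
      have hX0 := S.X_nonneg r hr
      have hs := stiffness_pos hκ hr (a r) (f r)
      rw [abs_of_nonneg (add_nonneg hf0 hX0), abs_of_nonneg (add_nonneg
        (div_nonneg hX0 hs.le) (S.forceF_nonneg hκ hα hr)), hforce]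
      have h1 : X r / stiffness κ r (a r) (f r) ≤ 1 / r ^ 2 * X r := by
        rw [one_div_mul_eq_div]
        gcongr
        unfold stiffness
        have : 0 ≤ 8 * κ * (a r ^ 2 * sin (f r) ^ 2) := by positivity
        linarith
      have h2 : sin (f r) * m r ≤ f r * |m r| := by
        refine (le_abs_self _).trans ?_
        rw [abs_mul]
        gcongr
        exact (abs_sin_le_abs).trans_eq (abs_of_nonneg hf0)
      have h3 : 0 ≤ 1 / r ^ 2 * f r := by positivity
      have h4 : 0 ≤ |m r| * X r := by positivity
      linarith
  have h1 : Tendsto f atTop (nhds 0) :=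
    tendsto_const_nhds.congr' ((eventually_gt_atTop 0).mono fun x hx => (hzero x hx).symm)
  exact hα0.ne (tendsto_nhds_unique h1 S.tendsto_f_atTop)

theorem add_P_pos (S : DyonSystem κ q α C a b f X g P c) (hq : 0 < q) {r : ℝ} (hr : 0 < r) :
    0 < g r + P r := by
  refine lt_of_le_of_ne (add_nonneg (S.g_mem r hr).1 (S.P_nonneg r hr)) fun h => ?_
  have hne : ∀ x ∈ Ioi (0 : ℝ), x ^ 2 ≠ 0 := fun x hx => pow_ne_zero 2 (ne_of_gt hx)
  have hzero : ∀ x, 0 < x → g x = 0 := by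
    intro x hx
    have := eq_zero_of_abs_deriv_le_mul_Ioi (w := fun r => g r + P r)
      (m := fun r => 1 / r ^ 2 + 2 * a r ^ 2)
      (fun r hr => (S.deriv_g r hr).add (S.deriv_P r hr))
      (by have := S.continuousOn_a
          fun_prop (disch := assumption)) ?_ hr h.symm hx
    · linarith [(S.g_mem x hx).1, S.P_nonneg x hx]
    · intro r hr
      have hg0 := (S.g_mem r hr).1
      have hP0 := S.P_nonneg r hr
      rw [abs_of_nonneg (add_nonneg hg0 hP0), abs_of_nonneg (by positivity)]
      have h3 : 0 ≤ 1 / r ^ 2 * g r := by positivity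
      have h4 : 0 ≤ 2 * a r ^ 2 * P r := by positivity
      have h5 : P r / r ^ 2 = 1 / r ^ 2 * P r := by ring
      linarith
  have h1 : Tendsto g atTop (nhds 0) :=
    tendsto_const_nhds.congr' ((eventually_gt_atTop 0).mono fun x hx => (hzero x hx).symm)
  exact hq.ne (tendsto_nhds_unique h1 S.tendsto_g_atTop)

theorem f_pos (S : DyonSystem κ q α C a b f X g P c) (hκ : 0 < κ) (hα0 : 0 < α)
    (hα : α ≤ π / 2) {r : ℝ} (hr : 0 < r) : 0 < f r := by
  refine lt_of_le_of_ne (S.f_mem r hr).1 fun h => ?_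
  have hmin : IsLocalMin f r := by
    filter_upwards [Ioi_mem_nhds hr] with x hx
    rw [← h]
    exact (S.f_mem x hx).1
  have h1 := hmin.hasDerivAt_eq_zero (S.deriv_f r hr)
  rw [div_eq_zero_iff, or_iff_left (stiffness_pos hκ hr _ _).ne'] at h1
  linarith [S.add_X_pos hκ hα0 hα hr]

theorem g_pos (S : DyonSystem κ q α C a b f X g P c) (hq : 0 < q) {r : ℝ} (hr : 0 < r) :
    0 < g r := by
  refine lt_of_le_of_ne (S.g_mem r hr).1 fun h => ?_
  have hmin : IsLocalMin g r := by
    filter_upwards [Ioi_mem_nhds hr] with x hx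
    rw [← h]
    exact (S.g_mem x hx).1
  have h1 := hmin.hasDerivAt_eq_zero (S.deriv_g r hr)
  rw [div_eq_zero_iff, or_iff_left (by positivity)] at h1
  linarith [S.add_P_pos hq hr]

end DyonSystem

theorem contDiffOn_succ_of_hasDerivAt {F F' : ℝ → ℝ} {s : Set ℝ} (hs : IsOpen s) {n : ℕ}
    (h : ∀ r ∈ s, HasDerivAt F (F' r) r) (h' : ContDiffOn ℝ n F' s) :
    ContDiffOn ℝ (n + 1) F s := by
  rw [contDiffOn_succ_iff_deriv_of_isOpen hs]
  exact ⟨fun r hr => (h r hr).differentiableAt.differentiableWithinAt, by simp,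
    h'.congr fun r hr => (h r hr).deriv⟩

namespace DyonSystem

variable {κ q α C : ℝ} {a b f X g P c : ℝ → ℝ}

theorem X_pos (S : DyonSystem κ q α C a b f X g P c) (hκ : 0 < κ) (hα0 : 0 < α)
    (hα : α < π / 2) {r : ℝ} (hr : 0 < r) : 0 < X r := by
  refine lt_of_le_of_ne (S.X_nonneg r hr) fun h => ?_
  have hmin : IsLocalMin X r := by
    filter_upwards [Ioi_mem_nhds hr] with x hx
    rw [← h]
    exact S.X_nonneg x hx
  have h1 := hmin.hasDerivAt_eq_zero (S.deriv_X r hr)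
  have ha := S.a_pos hκ hr
  have hf := S.f_pos hκ hα0 hα.le hr
  have hfα := (S.f_mem r hr).2
  have hsin : 0 < sin (f r) := sin_pos_of_pos_of_lt_pi hf (by linarith [pi_pos])
  have hcos : 0 < cos (f r) := cos_pos_of_mem_Ioo ⟨by linarith [pi_pos], by linarith⟩
  refine absurd h1 (ne_of_gt ?_)
  unfold forceF
  positivity

theorem P_pos (S : DyonSystem κ q α C a b f X g P c) (hκ : 0 < κ) (hq : 0 < q)
    {r : ℝ} (hr : 0 < r) : 0 < P r := by
  refine lt_of_le_of_ne (S.P_nonneg r hr) fun h => ?_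
  have hmin : IsLocalMin P r := by
    filter_upwards [Ioi_mem_nhds hr] with x hx
    rw [← h]
    exact S.P_nonneg x hx
  have h1 := hmin.hasDerivAt_eq_zero (S.deriv_P r hr)
  have ha := S.a_pos hκ hr
  have hg := S.g_pos hq hr
  exact absurd h1 (by positivity)

theorem strictMonoOn_f (S : DyonSystem κ q α C a b f X g P c) (hκ : 0 < κ) (hα0 : 0 < α)
    (hα : α < π / 2) : StrictMonoOn f (Ioi 0) :=
  strictMonoOn_Ioi_of_hasDerivAt_pos S.deriv_f fun _ hr =>
    div_pos (S.X_pos hκ hα0 hα hr) (stiffness_pos hκ hr _ _)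

theorem strictMonoOn_g (S : DyonSystem κ q α C a b f X g P c) (hκ : 0 < κ) (hq : 0 < q) :
    StrictMonoOn g (Ioi 0) :=
  strictMonoOn_Ioi_of_hasDerivAt_pos S.deriv_g fun _ hr => div_pos (S.P_pos hκ hq hr) (pow_pos hr 2)

theorem f_lt (S : DyonSystem κ q α C a b f X g P c) (hκ : 0 < κ) (hα0 : 0 < α)
    (hα : α < π / 2) {r : ℝ} (hr : 0 < r) : f r < α :=
  have hr' : 0 < r + 1 := by linarith
  (S.strictMonoOn_f hκ hα0 hα hr hr' (lt_add_one r)).trans_le (S.f_mem _ hr').2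

theorem g_lt (S : DyonSystem κ q α C a b f X g P c) (hκ : 0 < κ) (hq : 0 < q)
    {r : ℝ} (hr : 0 < r) : g r < q :=
  have hr' : 0 < r + 1 := by linarith
  (S.strictMonoOn_g hκ hq hr hr' (lt_add_one r)).trans_le (S.g_mem _ hr').2

theorem tendsto_g_zero (S : DyonSystem κ q α C a b f X g P c) (hκ : 0 < κ) (hq : 0 < q) :
    Tendsto g (nhdsWithin 0 (Ioi 0)) (nhds 0) := by
  have hbdd : BddBelow (g '' Ioi 0) := ⟨0, by
    rintro _ ⟨x, hx, rfl⟩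
    exact (S.g_mem x hx).1⟩
  have hlim := (S.strictMonoOn_g hκ hq).monotoneOn.tendsto_nhdsGT hbdd
  set l := sInf (g '' Ioi 0) with hl
  have hgl : ∀ r, 0 < r → l ≤ g r := fun r hr => csInf_le hbdd ⟨r, hr, rfl⟩
  have hl0 : 0 ≤ l := ge_of_tendsto hlim (eventually_mem_nhdsWithin.mono fun r hr => (S.g_mem r hr).1)
  rcases hl0.eq_or_lt with h | hlpos
  · rwa [← h] at hlim
  exfalso
  have ha2 : ∀ᶠ r in nhdsWithin 0 (Ioi 0), 1 / 2 < a r ^ 2 :=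
    (S.tendsto_a_zero.pow 2).eventually_const_lt (by norm_num)
  obtain ⟨δ, hδ0, hδ⟩ := mem_nhdsGT_iff_exists_Ioo_subset.1 ha2
  replace hδ0 : 0 < δ := hδ0
  have hP : ∀ r ∈ Ioo 0 δ, l * r ≤ P r := by
    have hmono : MonotoneOn (fun r => P r - l * r) (Ioo 0 δ) := by
      have hd : ∀ x ∈ Ioo 0 δ, HasDerivAt (fun r => P r - l * r) (2 * a x ^ 2 * g x - l) x :=
        fun x hx => ((S.deriv_P x hx.1).sub ((hasDerivAt_id x).const_mul l)).congr_deriv (by simp)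
      refine monotoneOn_of_deriv_nonneg (convex_Ioo 0 δ)
        (fun x hx => (hd x hx).continuousAt.continuousWithinAt) ?_ ?_ <;> rw [interior_Ioo]
      · exact fun x hx => (hd x hx).differentiableAt.differentiableWithinAt
      · intro x hx
        rw [(hd x hx).deriv]
        have h1 : 1 / 2 < a x ^ 2 := hδ hx
        have h2 := hgl x hx.1
        nlinarith
    intro r hr
    have hlim0 : Tendsto (fun s => -(l * s)) (nhdsWithin 0 (Ioi 0)) (nhds 0) := by
      have : Tendsto (fun s => -(l * s)) (nhds 0) (nhds (-(l * 0))) :=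
        (tendsto_id.const_mul l).neg
      rw [mul_zero, neg_zero] at this
      exact this.mono_left nhdsWithin_le_nhds
    have : 0 ≤ P r - l * r := by
      refine le_of_tendsto hlim0 ?_
      filter_upwards [Ioo_mem_nhdsGT hr.1] with s hs
      have h1 := hmono ⟨hs.1, hs.2.trans hr.2⟩ hr hs.2.le
      have h2 := S.P_nonneg s hs.1
      simp only at h1
      linarith
    linarith
  have hmono : MonotoneOn (fun r => g r - l * log r) (Ioo 0 δ) := by
    have hd : ∀ x ∈ Ioo 0 δ, HasDerivAt (fun r => g r - l * log r) (P x / x ^ 2 - l * x⁻¹) x :=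
      fun x hx => (S.deriv_g x hx.1).sub ((hasDerivAt_log hx.1.ne').const_mul l)
    refine monotoneOn_of_deriv_nonneg (convex_Ioo 0 δ)
      (fun x hx => (hd x hx).continuousAt.continuousWithinAt) ?_ ?_ <;> rw [interior_Ioo]
    · exact fun x hx => (hd x hx).differentiableAt.differentiableWithinAt
    · intro x hx
      rw [(hd x hx).deriv, sub_nonneg, le_div_iff₀ (pow_pos hx.1 2)]
      refine le_of_eq_of_le ?_ (hP x hx)
      have := hx.1.ne'
      field_simp
  have hδ2 : δ / 2 ∈ Ioo 0 δ := ⟨by linarith, by linarith⟩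
  have htop : Tendsto (fun r => -(l * log r)) (nhdsWithin 0 (Ioi 0)) atTop :=
    tendsto_neg_atBot_atTop.comp (tendsto_log_nhdsGT_zero.const_mul_atBot hlpos)
  obtain ⟨s, hs1, hs2⟩ := ((htop.eventually_gt_atTop (g (δ / 2) - l * log (δ / 2))).and
    (Ioo_mem_nhdsGT hδ2.1)).exists
  have h1 := hmono ⟨hs2.1, hs2.2.trans hδ2.2⟩ hδ2 hs2.2.le
  have h2 := (S.g_mem s hs2.1).1
  simp only at h1
  linarith

theorem contDiffOn_a (S : DyonSystem κ q α C a b f X g P c) (hκ : 0 < κ) :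
    ContDiffOn ℝ 2 a (Ioi 0) := by
  have hv := S.continuousOn_div_stiffness hκ
  have ha := S.continuousOn_a
  have hf := S.continuousOn_f
  have hg := S.continuousOn_g
  have hne : ∀ x ∈ Ioi (0 : ℝ), x ^ 2 ≠ 0 := fun x hx => pow_ne_zero 2 (ne_of_gt hx)
  refine contDiffOn_succ_of_hasDerivAt isOpen_Ioi (n := 1) S.deriv_a ?_
  refine contDiffOn_succ_of_hasDerivAt isOpen_Ioi (n := 0) S.deriv_b (contDiffOn_zero.2 ?_)
  unfold forceA
  fun_prop (disch := assumption)

theorem contDiffOn_f (S : DyonSystem κ q α C a b f X g P c) (hκ : 0 < κ) :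
    ContDiffOn ℝ 2 f (Ioi 0) := by
  have hv := S.continuousOn_div_stiffness hκ
  have ha := S.continuousOn_a
  have hf := S.continuousOn_f
  have hne : ∀ x ∈ Ioi (0 : ℝ), x ^ 2 ≠ 0 := fun x hx => pow_ne_zero 2 (ne_of_gt hx)
  have ha1 : ContDiffOn ℝ 1 a (Ioi 0) := (S.contDiffOn_a hκ).of_le one_le_two
  have hf1 : ContDiffOn ℝ 1 f (Ioi 0) :=
    contDiffOn_succ_of_hasDerivAt isOpen_Ioi (n := 0) S.deriv_f (contDiffOn_zero.2 hv)
  have hX1 : ContDiffOn ℝ 1 X (Ioi 0) := by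
    refine contDiffOn_succ_of_hasDerivAt isOpen_Ioi (n := 0) S.deriv_X (contDiffOn_zero.2 ?_)
    unfold forceF
    fun_prop (disch := assumption)
  refine contDiffOn_succ_of_hasDerivAt isOpen_Ioi (n := 1) S.deriv_f ?_
  refine hX1.div ?_ fun r hr => (stiffness_pos hκ hr _ _).ne'
  unfold stiffness
  fun_prop

theorem contDiffOn_g (S : DyonSystem κ q α C a b f X g P c) : ContDiffOn ℝ 2 g (Ioi 0) := by
  have ha := S.continuousOn_a
  have hg := S.continuousOn_g
  have hne : ∀ x ∈ Ioi (0 : ℝ), x ^ 2 ≠ 0 := fun x hx => pow_ne_zero 2 (ne_of_gt hx)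
  have hP1 : ContDiffOn ℝ 1 P (Ioi 0) :=
    contDiffOn_succ_of_hasDerivAt isOpen_Ioi (n := 0) S.deriv_P (contDiffOn_zero.2 (by fun_prop))
  refine contDiffOn_succ_of_hasDerivAt isOpen_Ioi (n := 1) S.deriv_g ?_
  exact hP1.div (by fun_prop) hne

theorem integrableOn_density (S : DyonSystem κ q α C a b f X g P c) (hκ : 0 < κ) :
    IntegrableOn (fun r => staticDensity κ r (a r) (b r) (f r)
      (X r / stiffness κ r (a r) (f r)) + P r ^ 2 / r ^ 2 + 2 * a r ^ 2 * g r ^ 2) (Ioi 0) := by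
  obtain ⟨l, hl⟩ := S.exists_tendsto_c_atTop hκ
  have h0 := (S.monotoneOn_c hκ).tendsto_nhdsGT ⟨0, by
    rintro _ ⟨x, hx, rfl⟩
    exact (S.c_mem x hx).1⟩
  set m := sInf (c '' Ioi 0)
  refine integrableOn_Ioi_deriv_of_nonneg (g := Function.update c 0 m) (l := l) ?_ ?_ ?_ ?_
  · rw [continuousWithinAt_update_same, Ici_sdiff_left]
    exact h0
  · intro x hx
    refine (S.deriv_c x hx).congr_of_eventuallyEq ?_
    filter_upwards [Ioi_mem_nhds hx] with y hy
    exact Function.update_of_ne (ne_of_gt hy) _ _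
  · intro r _
    have := staticDensity_nonneg hκ r (a r) (b r) (f r) (X r / stiffness κ r (a r) (f r))
    positivity
  · refine hl.congr' ?_
    filter_upwards [eventually_gt_atTop 0] with y hy
    exact (Function.update_of_ne (ne_of_gt hy) _ _).symm

end DyonSystem

/-- existence of finite-energy dyon solutions of the minimally
gauged Skyrme model, with the normalized boundary conditions. -/
theorem dyon_existence
    (κ ω q : ℝ) (hκ : 0 < κ) (hω : ω ∈ Set.Ioo (Real.pi / 2) Real.pi)
    (hq0 : 0 < q)
    (hq : q < min ((1 / Real.sqrt 2) * Real.sin ω) (Real.sqrt 2 * (1 - ω / Real.pi))) :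
    ∃ a f g : ℝ → ℝ,
      ContDiffOn ℝ 2 a (Set.Ioi 0) ∧ ContDiffOn ℝ 2 f (Set.Ioi 0) ∧
      ContDiffOn ℝ 2 g (Set.Ioi 0) ∧
      DyonEqs κ a f g ∧
      FiniteEnergy κ a f g ∧
      Filter.Tendsto a (nhdsWithin 0 (Set.Ioi 0)) (nhds 1) ∧
      Filter.Tendsto f (nhdsWithin 0 (Set.Ioi 0)) (nhds 0) ∧
      Filter.Tendsto g (nhdsWithin 0 (Set.Ioi 0)) (nhds 0) ∧
      Filter.Tendsto a Filter.atTop (nhds 0) ∧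
      Filter.Tendsto f Filter.atTop (nhds (Real.pi - ω)) ∧
      Filter.Tendsto g Filter.atTop (nhds q) ∧
      (∀ r ∈ Set.Ioi (0 : ℝ),
        0 < a r ∧ 0 < f r ∧ f r < Real.pi - ω ∧ 0 < g r ∧ g r < q) ∧
      StrictMonoOn f (Set.Ioi 0) ∧ StrictMonoOn g (Set.Ioi 0) := by
  obtain ⟨hω1, hω2⟩ := hω
  have hq2 : q < √2 * (1 - ω / π) := hq.trans_le (min_le_right _ _)
  set α := π - ω with hα
  have hα0 : 0 < α := sub_pos.2 hω2
  have hα1 : α < π / 2 := by linarith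
  have hs : (0 : ℝ) < √2 := by positivity
  have hτ1 : q * π / (√2 * α) < 1 := by
    have : 1 - ω / π = α / π := by rw [hα, sub_div, div_self pi_ne_zero]
    rw [this, mul_div_assoc', lt_div_iff₀ pi_pos] at hq2
    rwa [div_lt_one (by positivity)]
  have hτ : (q / α) ^ 2 * π ^ 2 = 2 * (q * π / (√2 * α)) ^ 2 := by
    rw [div_pow, div_pow, mul_pow √2, sq_sqrt zero_le_two]
    field_simp
  obtain ⟨C, hC, hD⟩ := exists_discreteDyon hκ hα0 hα1.le (by positivity) hτ1 hτ
  obtain ⟨a, b, f, X, g, P, c, S⟩ := exists_dyonSystem hκ hC hq0 hα0 hα1.le hD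
  have hX : ∀ r, 0 < r → 8 * κ * (a r ^ 2 * sin (f r) ^ 2 * deriv f r) + r ^ 2 * deriv f r = X r :=
    fun r hr => by
      have hne := (stiffness_pos hκ hr (a r) (f r)).ne'
      rw [(S.deriv_f r hr).deriv]
      conv_rhs => rw [← div_mul_cancel₀ (X r) hne]
      unfold stiffness
      ring
  refine ⟨a, f, g, S.contDiffOn_a hκ, S.contDiffOn_f hκ, S.contDiffOn_g, ?_, ?_, S.tendsto_a_zero,
    S.tendsto_f_zero hα1.le, S.tendsto_g_zero hκ hq0, S.tendsto_a_atTop hκ hα0 hα1.le,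
    S.tendsto_f_atTop, S.tendsto_g_atTop,
    fun r hr => ⟨S.a_pos hκ hr, S.f_pos hκ hα0 hα1.le hr, S.f_lt hκ hα0 hα1 hr, S.g_pos hq0 hr,
      S.g_lt hκ hq0 hr⟩, S.strictMonoOn_f hκ hα0 hα1, S.strictMonoOn_g hκ hq0⟩
  · intro r hr
    have hev : Ioi 0 ∈ nhds r := Ioi_mem_nhds hr
    refine ⟨(S.deriv_a r hr).differentiableAt, (S.deriv_f r hr).differentiableAt,
      (S.deriv_g r hr).differentiableAt, ?_, ?_, ?_⟩
    · rw [(S.deriv_f r hr).deriv]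
      exact (S.deriv_b r hr).congr_of_eventuallyEq
        (eventually_of_mem hev fun x hx => (S.deriv_a x hx).deriv)
    · rw [(S.deriv_f r hr).deriv]
      exact (S.deriv_X r hr).congr_of_eventuallyEq (eventually_of_mem hev hX)
    · refine (S.deriv_P r hr).congr_of_eventuallyEq (eventually_of_mem hev fun x hx => ?_)
      have : x ≠ 0 := ne_of_gt hx
      simp only [(S.deriv_g x hx).deriv]
      field_simp
  · refine (S.integrableOn_density hκ).congr_fun (fun r hr => ?_) measurableSet_Ioi
    have : r ≠ 0 := ne_of_gt hr
    simp only [calE1, calE2, (S.deriv_a r hr).deriv, (S.deriv_f r hr).deriv, (S.deriv_g r hr).deriv,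
      staticDensity]
    field_simp
    ring
end
end

section
/- Let ω ∈ (π/2, π) and q > 0. For any (a,f,g) ∈ 𝒞 there exists a function f̃, continuous on [0,∞) and absolutely continuous on compact subintervals of (0,∞), with (a,f̃,g) ∈ 𝒞, 0 ≤ f̃(r) ≤ π/2 for all r ≥ 0, and L(a,f̃,g) ≤ L(a,f,g). Hence in minimizing L over 𝒞 one may restrict attention to functions f satisfying 0 ≤ f ≤ π/2. -/
open Real MeasureTheory Set Filter

noncomputable section

theorem AbsolutelyContinuousOnInterval.of_dist_le {f h : ℝ → ℝ} {s t : ℝ}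
    (hf : AbsolutelyContinuousOnInterval f s t)
    (hle : ∀ x ∈ uIcc s t, ∀ y ∈ uIcc s t, dist (h x) (h y) ≤ dist (f x) (f y)) :
    AbsolutelyContinuousOnInterval h s t := by
  rw [absolutelyContinuousOnInterval_iff] at hf ⊢
  intro ε hε
  obtain ⟨δ, hδ, hE⟩ := hf ε hε
  refine ⟨δ, hδ, fun E hEd hEδ ↦ (Finset.sum_le_sum fun i hi ↦ ?_).trans_lt (hE E hEd hEδ)⟩
  exact hle _ (hEd.1 i hi).1 _ (hEd.1 i hi).2

theorem LocAC.absolutelyContinuousOnInterval {f : ℝ → ℝ} (hf : LocAC f) {s t : ℝ}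
    (hs : 0 < s) (hst : s ≤ t) : AbsolutelyContinuousOnInterval f s t := by
  refine ((hf.2 s t hs hst).1.absolutelyContinuousOnInterval_intervalIntegral
    left_mem_uIcc).of_dist_le fun x hx y hy ↦ ?_
  rw [uIcc_of_le hst] at hx hy
  rw [← (hf.2 s x hs hx.1).2, ← (hf.2 s y hs hy.1).2, dist_sub_right]

theorem LocAC.ae_differentiableAt {f : ℝ → ℝ} (hf : LocAC f) :
    ∀ᵐ r ∂volume.restrict (Ioi (0 : ℝ)), DifferentiableAt ℝ f r := by
  rw [ae_restrict_iff' measurableSet_Ioi]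
  have key : ∀ n : ℕ, ∀ᵐ r : ℝ, r ∈ uIcc (1 / ((n : ℝ) + 1)) ((n : ℝ) + 1) →
      DifferentiableAt ℝ f r := fun n ↦ by
    have hn : (1 : ℝ) ≤ n + 1 := by linarith [n.cast_nonneg (α := ℝ)]
    refine (hf.absolutelyContinuousOnInterval (by positivity) ?_).ae_differentiableAt
    exact ((div_le_one (by positivity)).2 hn).trans hn
  filter_upwards [ae_all_iff.2 key] with r hr h0
  have h0' : 0 < r := h0
  obtain ⟨m, hm⟩ := exists_nat_one_div_lt h0'
  obtain ⟨k, hk⟩ := exists_nat_ge r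
  have h1 : (m : ℝ) ≤ (max m k : ℕ) := by exact_mod_cast le_max_left m k
  have h2 : (k : ℝ) ≤ (max m k : ℕ) := by exact_mod_cast le_max_right m k
  refine hr (max m k) (Icc_subset_uIcc ⟨le_trans ?_ hm.le, by linarith⟩)
  exact one_div_le_one_div_of_le (by positivity) (by linarith)

theorem LocAC.lipschitz_comp {T f : ℝ → ℝ} (hT : LipschitzWith 1 T) (hf : LocAC f) :
    LocAC (fun r ↦ T (f r)) := by
  refine ⟨hT.continuous.comp_continuousOn hf.1, fun s t hs hst ↦ ?_⟩
  have hac : AbsolutelyContinuousOnInterval (fun r ↦ T (f r)) s t :=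
    (hf.absolutelyContinuousOnInterval hs hst).of_dist_le fun x _ y _ ↦ by
      simpa using hT.dist_le_mul (f x) (f y)
  exact ⟨hac.intervalIntegrable_deriv, hac.integral_deriv_eq_sub.symm⟩

theorem sq_deriv_lipschitz_comp_le {T f : ℝ → ℝ} (hT : LipschitzWith 1 T) {r : ℝ}
    (hf : DifferentiableAt ℝ f r) : deriv (fun x ↦ T (f x)) r ^ 2 ≤ deriv f r ^ 2 := by
  by_cases hd : DifferentiableAt ℝ (fun x ↦ T (f x)) r
  · rw [sq_le_sq]
    refine le_of_tendsto_of_tendsto hd.hasDerivAt.tendsto_slope.abs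
      hf.hasDerivAt.tendsto_slope.abs (Eventually.of_forall fun y ↦ ?_)
    have h := hT.dist_le_mul (f y) (f r)
    simp only [NNReal.coe_one, one_mul, Real.dist_eq] at h
    simp only [slope_def_field, abs_div]
    gcongr
  · rw [deriv_zero_of_not_differentiableAt hd, zero_pow two_ne_zero]
    positivity

/-- The distance from `x` to the lattice `πℤ`. -/
def piFold (x : ℝ) : ℝ := ‖(x : AddCircle π)‖

theorem piFold_nonneg (x : ℝ) : 0 ≤ piFold x := norm_nonneg _

theorem piFold_le (x : ℝ) : piFold x ≤ π / 2 := by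
  simpa [piFold, abs_of_pos pi_pos] using
    AddCircle.norm_le_half_period π (x := (x : AddCircle π)) pi_ne_zero

theorem piFold_of_mem {x : ℝ} (h0 : 0 ≤ x) (h1 : x ≤ π / 2) : piFold x = x := by
  rw [piFold, (AddCircle.norm_coe_eq_abs_iff π pi_ne_zero).2, abs_of_nonneg h0]
  rwa [abs_of_nonneg h0, abs_of_pos pi_pos]

theorem sin_piFold_sq (x : ℝ) : sin (piFold x) ^ 2 = sin x ^ 2 := by
  rw [piFold, AddCircle.norm_eq, sq_eq_sq_iff_abs_eq_abs]
  rcases abs_choice (x - round (π⁻¹ * x) * π) with h | h <;> rw [h]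
  · simp [sin_sub_int_mul_pi, abs_mul]
  · rw [sin_neg]
    simp [sin_sub_int_mul_pi, abs_mul]

theorem piFold_lipschitz : LipschitzWith 1 piFold := by
  refine LipschitzWith.of_dist_le_mul fun x y ↦ ?_
  rw [NNReal.coe_one, one_mul, Real.dist_eq, Real.dist_eq]
  refine (abs_norm_sub_norm_le _ _).trans ?_
  rw [← AddCircle.coe_sub, AddCircle.norm_eq]
  exact (AddCircle.norm_eq π (x := x - y)).symm.trans_le (QuotientAddGroup.norm_mk_le_norm)

theorem calE1_nonneg {κ : ℝ} (hκ : 0 < κ) (a f : ℝ → ℝ) (r : ℝ) : 0 ≤ calE1 κ a f r := by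
  unfold calE1
  positivity

theorem calE2_nonneg (a g : ℝ → ℝ) (r : ℝ) : 0 ≤ calE2 a g r := by
  unfold calE2
  positivity

theorem calE1_le {κ : ℝ} (hκ : 0 < κ) (a : ℝ → ℝ) {f h : ℝ → ℝ} {r : ℝ}
    (hsin : sin (h r) ^ 2 = sin (f r) ^ 2) (hderiv : deriv h r ^ 2 ≤ deriv f r ^ 2) :
    calE1 κ a h r ≤ calE1 κ a f r := by
  unfold calE1
  rw [hsin]
  gcongr

theorem LocAC.aemeasurable {f : ℝ → ℝ} (hf : LocAC f) :
    AEMeasurable f (volume.restrict (Ioi (0 : ℝ))) :=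
  (hf.1.mono Ioi_subset_Ici_self).aemeasurable measurableSet_Ioi

theorem aestronglyMeasurable_calE1 (κ : ℝ) {a f : ℝ → ℝ} (ha : LocAC a) (hf : LocAC f) :
    AEStronglyMeasurable (calE1 κ a f) (volume.restrict (Ioi (0 : ℝ))) := by
  have ha' := ha.aemeasurable
  have hs : AEMeasurable (fun r ↦ sin (f r)) (volume.restrict (Ioi (0 : ℝ))) :=
    measurable_sin.comp_aemeasurable hf.aemeasurable
  have hda := (measurable_deriv a).aemeasurable (μ := volume.restrict (Ioi (0 : ℝ)))
  have hdf := (measurable_deriv f).aemeasurable (μ := volume.restrict (Ioi (0 : ℝ)))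
  unfold calE1
  refine AEMeasurable.aestronglyMeasurable ?_
  fun_prop

theorem aestronglyMeasurable_calE2 {a g : ℝ → ℝ} (ha : LocAC a) (hg : LocAC g) :
    AEStronglyMeasurable (calE2 a g) (volume.restrict (Ioi (0 : ℝ))) := by
  have ha' := ha.aemeasurable
  have hg' := hg.aemeasurable
  have hdg := (measurable_deriv g).aemeasurable (μ := volume.restrict (Ioi (0 : ℝ)))
  unfold calE2
  refine AEMeasurable.aestronglyMeasurable ?_
  fun_prop

/-- in minimizing `L` over `𝒞` one may restrict attention to
profile functions `f` with `0 ≤ f ≤ π/2`. -/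
theorem restrict_to_f_le_pi_div_two
    (κ ω q : ℝ) (hκ : 0 < κ) (hω : ω ∈ Set.Ioo (Real.pi / 2) Real.pi) (hq : 0 < q)
    (a f g : ℝ → ℝ) (hafg : Constrained κ ω q a f g) :
    ∃ ftil : ℝ → ℝ, LocAC ftil ∧ Constrained κ ω q a ftil g ∧
      (∀ r : ℝ, 0 ≤ r → 0 ≤ ftil r ∧ ftil r ≤ Real.pi / 2) ∧
      actionL κ a ftil g ≤ actionL κ a f g := by
  obtain ⟨hA, hC⟩ := hafg
  have hft : LocAC (fun r ↦ piFold (f r)) := hA.locAC_f.lipschitz_comp piFold_lipschitz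
  have hE1 : IntegrableOn (calE1 κ a f) (Ioi 0) :=
    hA.finite_energy.mono' (aestronglyMeasurable_calE1 κ hA.locAC_a hA.locAC_f)
      (Eventually.of_forall fun r ↦ by
        rw [norm_of_nonneg (calE1_nonneg hκ a f r)]
        linarith [calE2_nonneg a g r])
  have hE2 : IntegrableOn (calE2 a g) (Ioi 0) :=
    hA.finite_energy.mono' (aestronglyMeasurable_calE2 hA.locAC_a hA.locAC_g)
      (Eventually.of_forall fun r ↦ by
        rw [norm_of_nonneg (calE2_nonneg a g r)]
        linarith [calE1_nonneg hκ a f r])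
  have hle : ∀ᵐ r ∂volume.restrict (Ioi (0 : ℝ)),
      calE1 κ a (fun r ↦ piFold (f r)) r ≤ calE1 κ a f r := by
    filter_upwards [hA.locAC_f.ae_differentiableAt] with r hr
    exact calE1_le hκ a (sin_piFold_sq (f r)) (sq_deriv_lipschitz_comp_le piFold_lipschitz hr)
  have hE1t : IntegrableOn (calE1 κ a (fun r ↦ piFold (f r))) (Ioi 0) :=
    hE1.mono' (aestronglyMeasurable_calE1 κ hA.locAC_a hft) <| by
      filter_upwards [hle] with r hr
      rwa [norm_of_nonneg (calE1_nonneg hκ a _ r)]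
  refine ⟨fun r ↦ piFold (f r), hft, ⟨{ hA with
    locAC_f := hft
    f_zero := ?_
    f_infty := ?_
    finite_energy := hE1t.add hE2 }, hC⟩,
    fun r _ ↦ ⟨piFold_nonneg _, piFold_le _⟩, ?_⟩
  · simp only [hA.f_zero]
    exact piFold_of_mem le_rfl (by positivity)
  · have h := (piFold_lipschitz.continuous.tendsto (π - ω)).comp hA.f_infty
    rwa [piFold_of_mem (by linarith [hω.2]) (by linarith [hω.1])] at h
  · refine integral_mono_ae (hE1t.sub hE2) (hE1.sub hE2) ?_
    filter_upwards [hle] with r hr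
    exact sub_le_sub_right hr _
end
end
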